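/- Assume that b < a or that q^2 does not divide (m/s) − 1. Then the automorphism group Aut(F'/K) of the function field F' of the curve X_{a,b,n,s} is finite of order (q^3/q̄)·(q+1)·(q̄−1)·(m/s); moreover there exist a normal subgroup S of Aut(F'/K) of order q^3/q̄ and a cyclic subgroup C of Aut(F'/K) of order (q+1)·(q̄−1)·(m/s) such that S ∩ C is trivial and S·C = Aut(F'/K) (i.e. Aut(F'/K) is an internal semidirect product S ⋊ C). -/

import Mathlib

open MvPolynomial

/-- The defining ideal of the curve `X_{a,b,n,s}` : it is generated by
`Z^(m/s) - (Y^(q^2) - Y)` and `c·Y^(q+1) - Tr(X)` in `K[X,Y,Z]`, where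
`Tr(X) = X + X^q̄ + X^(q̄^2) + ⋯ + X^(q/q̄)` is the trace polynomial with `e = a/b`
terms (variables `X 0 = X`, `X 1 = Y`, `X 2 = Z`, `t` stands for `m/s`, `qb` for `q̄`). -/
noncomputable def XIdeal (K : Type) [Field K] (c : K) (q qb t e : ℕ) :
    Ideal (MvPolynomial (Fin 3) K) :=
  Ideal.span {X 2 ^ t - (X 1 ^ (q ^ 2) - X 1),
    C c * X 1 ^ (q + 1) - ∑ i ∈ Finset.range e, X 0 ^ qb ^ i}

/-- The coordinate ring `K[X,Y,Z]/I'` of the curve `X_{a,b,n,s}`. -/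
noncomputable abbrev XRing (K : Type) [Field K] (c : K) (q qb t e : ℕ) :=
  MvPolynomial (Fin 3) K ⧸ XIdeal K c q qb t e

/-- The function field `F' = Frac(K[X,Y,Z]/I')` of the curve `X_{a,b,n,s}`. -/
noncomputable abbrev XField (K : Type) [Field K] (c : K) (q qb t e : ℕ) :=
  FractionRing (XRing K c q qb t e)



set_option linter.all false

/-- The relations defining the curve. -/
def CvRel {R : Type} [CommRing R] (c : R) (q qb e t : ℕ) (x y z : R) : Prop :=
  z ^ t = y ^ (q ^ 2) - y ∧ ∑ i ∈ Finset.range e, x ^ qb ^ i = c * y ^ (q + 1)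

/-- All facts about the function field of the curve that are used later. -/
structure Cv (p : ℕ) (K F : Type) [Field K] [Field F] [Algebra K F] where
  b : ℕ
  e : ℕ
  t : ℕ
  hb : 0 < b
  he : 0 < e
  hodd : Odd t
  hpt : ¬ p ∣ t
  htM : t ≠ 1 → ¬ t ∣ (p ^ b) ^ (e - 1) * ((p ^ b) ^ e) ^ 2 + 1
  hcond : e = 1 → ¬ ((p ^ b) ^ e) ^ 2 ∣ t - 1
  c : K
  hc : c ^ ((p ^ b) ^ e) = - c
  hc0 : c ≠ 0
  x : F
  y : F
  z : F
  hrel : CvRel (algebraMap K F c) ((p ^ b) ^ e) (p ^ b) e t x y z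
  htr : Transcendental K z
  hfrac : ∀ f : F, ∃ g ∈ Algebra.adjoin K {x, y, z}, ∃ h ∈ Algebra.adjoin K {x, y, z},
    h ≠ 0 ∧ f = g / h
  hhom : ∀ x1 y1 z1 : F, CvRel (algebraMap K F c) ((p ^ b) ^ e) (p ^ b) e t x1 y1 z1 →
    Transcendental K z1 → ∃ φ : F →ₐ[K] F, φ x = x1 ∧ φ y = y1 ∧ φ z = z1
  D : Derivation K F F
  hDz : D z = 1
  hval : ∀ B : ValuationSubring F, (∀ k : K, algebraMap K F k ∈ B) → z ∈ B → ∀ f ∈ B,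
    ∃ g ∈ Algebra.adjoin K {x, y, z}, ∃ h ∈ Algebra.adjoin K {x, y, z},
      h⁻¹ ∈ B ∧ h ≠ 0 ∧ f = g / h
  hIntg : ∀ f : F, (∀ B : ValuationSubring F, (∀ k : K, algebraMap K F k ∈ B) → z ∈ B → f ∈ B) →
    f ∈ Algebra.adjoin K {x, y, z}

section setup

theorem TrP_monic {R : Type} [CommRing R] [Nontrivial R] (qb e : ℕ) (hqb : 2 ≤ qb) (he : 0 < e) (v : R) :
    (∑ i ∈ Finset.range e, (Polynomial.X : Polynomial R) ^ qb ^ i - Polynomial.C v).Monic ∧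
    (∑ i ∈ Finset.range e, (Polynomial.X : Polynomial R) ^ qb ^ i - Polynomial.C v).natDegree
      = qb ^ (e - 1) := by
  obtain ⟨k, rfl⟩ : ∃ k, e = k + 1 := ⟨e - 1, by omega⟩
  have h1 : (∑ i ∈ Finset.range (k+1), (Polynomial.X : Polynomial R) ^ qb ^ i - Polynomial.C v)
      = Polynomial.X ^ qb ^ k + (∑ i ∈ Finset.range k, (Polynomial.X : Polynomial R) ^ qb ^ i - Polynomial.C v) := by
    rw [Finset.sum_range_succ]; ring
  have hpos : 0 < qb ^ k := pow_pos (by omega) _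
  have h2 : (∑ i ∈ Finset.range k, (Polynomial.X : Polynomial R) ^ qb ^ i - Polynomial.C v).degree
      < (qb ^ k : ℕ) := by
    refine lt_of_le_of_lt (Polynomial.degree_sub_le _ _) (max_lt ?_ ?_)
    · refine lt_of_le_of_lt (Polynomial.degree_sum_le _ _) ?_
      rw [Finset.sup_lt_iff (by exact WithBot.bot_lt_coe _)]
      intro i hi
      rw [Polynomial.degree_X_pow]
      exact_mod_cast Nat.pow_lt_pow_right (by omega) (Finset.mem_range.1 hi)
    · exact lt_of_le_of_lt Polynomial.degree_C_le (by exact_mod_cast hpos)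
  rw [h1]
  refine ⟨Polynomial.monic_X_pow_add h2, ?_⟩
  rw [Polynomial.natDegree_eq_of_degree_eq_some (n := qb ^ k)]
  · simp
  · rw [Polynomial.degree_add_eq_left_of_degree_lt] <;> rw [Polynomial.degree_X_pow]
    exact h2

variable {p : ℕ} [Fact p.Prime] {K A F : Type} [Field K] [IsAlgClosed K] [CharP K p]
  [CommRing A] [IsDomain A] [Algebra K A] [Field F] [Algebra A F] [Algebra K F]
  [IsScalarTower K A F] [IsFractionRing A F]

theorem setup_integral {c : K} {q qb e t : ℕ} {x y z : A} (hqb : 2 ≤ qb) (he : 0 < e) (hq : 2 ≤ q)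
    (hrel : CvRel (algebraMap K A c) q qb e t x y z)
    (hgen : Algebra.adjoin K {x, y, z} = ⊤) (φ : Polynomial K →ₐ[K] A)
    (hφ : φ = Polynomial.aeval z) :
    letI := φ.toRingHom.toAlgebra
    Algebra.IsIntegral (Polynomial K) A ∧ Algebra.FiniteType (Polynomial K) A := by
  letI := φ.toRingHom.toAlgebra
  haveI : IsScalarTower K (Polynomial K) A := IsScalarTower.of_algebraMap_eq' (by
    ext k; simp [RingHom.algebraMap_toAlgebra, hφ])
  obtain ⟨h1, h2⟩ := hrel
  have hzi : algebraMap (Polynomial K) A Polynomial.X = z := by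
    simp [RingHom.algebraMap_toAlgebra, hφ]
  have hy : IsIntegral (Polynomial K) y := by
    refine ⟨Polynomial.X ^ (q ^ 2) + (- Polynomial.X - Polynomial.C (Polynomial.X ^ t)), ?_, ?_⟩
    · apply Polynomial.monic_X_pow_add
      refine lt_of_le_of_lt (Polynomial.degree_sub_le _ _) (max_lt ?_ ?_)
      · rw [Polynomial.degree_neg, Polynomial.degree_X]
        have : 1 < q ^ 2 := by nlinarith
        exact_mod_cast this
      · exact lt_of_le_of_lt Polynomial.degree_C_le (by
          have : 0 < q ^ 2 := by nlinarith
          exact_mod_cast this)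
    · simp [Polynomial.eval₂_add, Polynomial.eval₂_sub, hzi, h1]
      ring
  have hx : IsIntegral (Polynomial K) x := by
    let B := integralClosure (Polynomial K) A
    have hcB : algebraMap K A c * y ^ (q+1) ∈ B := by
      refine B.mul_mem ?_ (B.pow_mem hy _)
      rw [IsScalarTower.algebraMap_apply K (Polynomial K) A]
      exact B.algebraMap_mem _
    have : IsIntegral B x := by
      refine ⟨_, (TrP_monic qb e hqb he (⟨_, hcB⟩ : B)).1, ?_⟩
      simp only [Polynomial.eval₂_sub, Polynomial.eval₂_finsetSum, Polynomial.eval₂_X_pow,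
        Polynomial.eval₂_C, h2]
      exact sub_self _
    exact isIntegral_trans x this
  have hz : IsIntegral (Polynomial K) z := hzi ▸ isIntegral_algebraMap
  have htop : Algebra.adjoin (Polynomial K) {x, y, z} = ⊤ := by
    rw [eq_top_iff]
    intro a _
    have : a ∈ Algebra.adjoin K {x, y, z} := by rw [hgen]; trivial
    have hle : Algebra.adjoin K {x, y, z} ≤
      (Algebra.adjoin (Polynomial K) {x, y, z}).restrictScalars K :=
      Algebra.adjoin_le Algebra.subset_adjoin
    exact hle this
  classical
  refine ⟨⟨fun a => ?_⟩, ⟨⟨{x, y, z}, by simpa using htop⟩⟩⟩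
  have : a ∈ Algebra.adjoin (Polynomial K) {x, y, z} := by rw [htop]; trivial
  have hle : Algebra.adjoin (Polynomial K) {x, y, z} ≤ integralClosure (Polynomial K) A :=
    Algebra.adjoin_le (by
      rintro _ (rfl | rfl | rfl)
      exacts [hx, hy, hz])
  exact hle this

theorem der_pow_zero {K A M : Type} [Field K] [CommRing A] [Algebra K A] [AddCommGroup M] [Module A M]
    [Module K M] {p : ℕ} [CharP A p] (d : Derivation K A M) (a : A) {n : ℕ} (hn : p ∣ n) :
    d (a ^ n) = 0 := by
  rw [Derivation.leibniz_pow, ← Nat.cast_smul_eq_nsmul A, (CharP.cast_eq_zero_iff A p n).2 hn, zero_smul]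

theorem der_rel {K A M : Type} [Field K] [CommRing A] [Algebra K A] [AddCommGroup M] [Module A M]
    [Module K M] {p : ℕ} [CharP A p] (d : Derivation K A M)
    {c : K} {q qb e t : ℕ} {x y z : A} (he : 0 < e) 
    (hpq : p ∣ q) (hpqb : p ∣ qb)
    (hrel : CvRel (algebraMap K A c) q qb e t x y z) :
    d y = - (t • z ^ (t - 1) • d z) ∧ d x = algebraMap K A c • y ^ q • d y := by
  obtain ⟨h1, h2⟩ := hrel
  have e1 := congrArg d h1
  rw [map_sub, der_pow_zero (p := p) d y (dvd_pow hpq two_ne_zero), Derivation.leibniz_pow, zero_sub] at e1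
  refine ⟨by rw [e1, neg_neg], ?_⟩
  have e2 := congrArg d h2
  obtain ⟨k, rfl⟩ : ∃ k, e = k + 1 := ⟨e - 1, by omega⟩
  rw [map_sum, Finset.sum_range_succ', Finset.sum_eq_zero, Derivation.leibniz, pow_succ,
    Derivation.leibniz, Derivation.map_algebraMap, der_pow_zero (p := p) d y hpq] at e2
  · simpa using e2
  · intro i _
    exact der_pow_zero (p := p) d x (dvd_pow hpqb (by omega))

theorem setup_dedekind {c : K} {q qb e t : ℕ} {x y z : A} (hqb : 2 ≤ qb) (he : 0 < e) (hq : 2 ≤ q)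
    (hpq : p ∣ q) (hpqb : p ∣ qb)
    (hrel : CvRel (algebraMap K A c) q qb e t x y z)
    (hgen : Algebra.adjoin K {x, y, z} = ⊤) : IsDedekindDomainDvr A := by
  letI := ((Polynomial.aeval z : Polynomial K →ₐ[K] A)).toRingHom.toAlgebra
  have hh := setup_integral hqb he hq hrel hgen (Polynomial.aeval z) rfl
  haveI := hh.1
  haveI := hh.2
  haveI : IsScalarTower K (Polynomial K) A := IsScalarTower.of_algebraMap_eq' (by
    ext k; simp [RingHom.algebraMap_toAlgebra])
  haveI : CharP A p := charP_of_injective_algebraMap (algebraMap K A).injective p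
  haveI : Module.Finite (Polynomial K) A := Algebra.IsIntegral.finite
  haveI : Algebra.FormallyUnramified (Polynomial K) A := by
    have hDz : KaehlerDifferential.D (Polynomial K) A z = 0 := by
      have : z = algebraMap (Polynomial K) A Polynomial.X := by
        simp [RingHom.algebraMap_toAlgebra]
      rw [this, Derivation.map_algebraMap]
    have hd := der_rel (p := p) ((KaehlerDifferential.D (Polynomial K) A).restrictScalars K) he hpq hpqb hrel
    have hdy := hd.1
    have hdx := hd.2
    simp only [Derivation.restrictScalars_apply, hDz, smul_zero, neg_zero] at hdy hdx
    rw [hdy, smul_zero, smul_zero] at hdx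
    have hzero : ∀ a, KaehlerDifferential.D (Polynomial K) A a = 0 := by
      intro a
      have ha : a ∈ Algebra.adjoin K {x, y, z} := by rw [hgen]; trivial
      have := Derivation.eqOn_adjoin (D1 := (KaehlerDifferential.D (Polynomial K) A).restrictScalars K)
        (D2 := 0) (s := {x, y, z}) (by
          rintro _ (rfl | rfl | rfl)
          · exact hdx
          · exact hdy
          · exact hDz) ha
      exact this
    constructor
    have hs := KaehlerDifferential.span_range_derivation (Polynomial K) A
    have : Submodule.span A (Set.range (KaehlerDifferential.D (Polynomial K) A)) = ⊥ := by
      rw [Submodule.span_eq_bot]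
      rintro _ ⟨a, rfl⟩
      exact hzero a
    rw [this] at hs
    exact (Submodule.subsingleton_iff A).1 (subsingleton_of_bot_eq_top hs)
  exact isDedekindDomainDvr.of_formallyUnramified (Polynomial K) A

theorem setup_val [IsDedekindDomainDvr A] (B : ValuationSubring F) (hB : ∀ a : A, algebraMap A F a ∈ B)
    (f : F) (hf : f ∈ B) : ∃ g h : A, (algebraMap A F h)⁻¹ ∈ B ∧ algebraMap A F h ≠ 0 ∧
      f = algebraMap A F g / algebraMap A F h := by
  obtain ⟨g, h, hh0, rfl⟩ := IsFractionRing.div_surjective (A := A) f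
  have hh : algebraMap A F h ≠ 0 := by
    intro h0
    exact nonZeroDivisors.ne_zero hh0 ((IsFractionRing.injective A F) (by simpa using h0))
  let φ : A →+* B := (algebraMap A F).codRestrict B.toSubring hB
  let P : Ideal A := (IsLocalRing.maximalIdeal B).comap φ
  haveI : P.IsPrime := Ideal.comap_isPrime _ _
  have hPunit : ∀ s : A, s ∉ P → (algebraMap A F s)⁻¹ ∈ B ∧ algebraMap A F s ≠ 0 := by
    intro s hs
    have : IsUnit (φ s) := by
      by_contra hc
      exact hs ((IsLocalRing.mem_maximalIdeal _).2 hc)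
    obtain ⟨u, hu⟩ := this
    have h1 : (algebraMap A F s) * ((u⁻¹ : Bˣ) : B) = 1 := by
      have := congrArg (fun b : B => (b : F)) (u.mul_inv)
      rw [hu] at this
      exact this
    refine ⟨?_, left_ne_zero_of_mul_eq_one h1⟩
    rw [inv_eq_of_mul_eq_one_right h1]
    exact Subtype.property _
  by_cases hPbot : P = ⊥
  · have : h ∉ P := by
      rw [hPbot]; intro h0; apply hh; rw [show h = 0 from h0, map_zero]
    exact ⟨g, h, (hPunit h this).1, hh, rfl⟩
  · haveI : IsDiscreteValuationRing (Localization.AtPrime P) :=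
      IsDedekindDomainDvr.is_dvr_at_nonzero_prime P hPbot inferInstance
    have key : ∀ g h : A, algebraMap A (Localization.AtPrime P) g ∣ algebraMap A (Localization.AtPrime P) h →
        ∃ s ∉ P, ∃ r, s * h = g * r := by
      rintro g h ⟨w, hw⟩
      obtain ⟨r, s, rfl⟩ := IsLocalization.exists_mk'_eq P.primeCompl w
      refine ⟨s, s.2, r, ?_⟩
      apply IsLocalization.injective (Localization.AtPrime P) P.primeCompl_le_nonZeroDivisors
      rw [map_mul, map_mul, hw, ← mul_assoc, mul_comm _ (algebraMap _ _ g), mul_assoc, IsLocalization.mk'_spec']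
    rcases ValuationRing.dvd_total (algebraMap A (Localization.AtPrime P) h)
      (algebraMap A (Localization.AtPrime P) g) with hd | hd
    · obtain ⟨s, hs, r, hsr⟩ := key _ _ hd
      refine ⟨r, s, (hPunit s hs).1, (hPunit s hs).2, ?_⟩
      rw [div_eq_div_iff hh (hPunit s hs).2, ← map_mul, ← map_mul, mul_comm r h, ← hsr, mul_comm]
    · obtain ⟨s, hs, r, hsr⟩ := key _ _ hd
      have hF : algebraMap A F s = algebraMap A F g / algebraMap A F h * algebraMap A F r := by
        rw [div_mul_eq_mul_div, eq_div_iff hh, ← map_mul, ← map_mul, hsr]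
      have hr0 : algebraMap A F r ≠ 0 := by
        intro h0; rw [h0, mul_zero] at hF; exact (hPunit s hs).2 hF
      refine ⟨s, r, ?_, hr0, by rw [hF]; field_simp⟩
      have : (algebraMap A F r)⁻¹ = algebraMap A F g / algebraMap A F h * (algebraMap A F s)⁻¹ := by
        rw [hF, mul_inv, ← mul_assoc, mul_inv_cancel₀, one_mul]
        intro h0
        rw [h0, zero_mul] at hF
        exact (hPunit s hs).2 hF
      rw [this]
      exact B.mul_mem _ _ hf (hPunit s hs).1

theorem setup_int [IsDedekindDomainDvr A] (f : F)
    (hf : ∀ B : ValuationSubring F, (∀ a : A, algebraMap A F a ∈ B) → f ∈ B) :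
    ∃ a : A, algebraMap A F a = f := by
  by_contra hcon
  haveI : IsDedekindDomain A := inferInstance
  haveI : IsIntegrallyClosedIn (algebraMap A F).range F := by
    rw [isIntegrallyClosedIn_iff]
    refine ⟨Subtype.val_injective, ?_⟩
    intro x hx
    have : IsIntegral A x := by
      obtain ⟨P, hP, hP0⟩ := hx
      have hsurj : Function.Surjective (algebraMap A F).rangeRestrict := (algebraMap A F).rangeRestrict_surjective
      obtain ⟨Q, hQ, -, hQm⟩ := Polynomial.lifts_and_natDegree_eq_and_monic
        (f := (algebraMap A F).rangeRestrict) (by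
          rw [Polynomial.lifts_iff_coeff_lifts]; intro n; exact hsurj _) hP
      refine ⟨Q, hQm, ?_⟩
      rw [← hQ, Polynomial.eval₂_map] at hP0
      exact hP0
    obtain ⟨a, ha⟩ := IsIntegrallyClosed.isIntegral_iff.1 this
    exact ⟨⟨_, ⟨a, ha⟩⟩, rfl⟩
  obtain ⟨V, hV, hfV⟩ := Subring.exists_le_valuationSubring_of_isIntegrallyClosedIn
    (R := (algebraMap A F).range) (x := f) (by rintro ⟨a, ha⟩; exact hcon ⟨a, ha⟩)
  exact hfV (hf V fun a => hV ⟨a, rfl⟩)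

theorem setup_transc {c : K} {q qb e t : ℕ} {x y z : A} (hqb : 2 ≤ qb) (he : 0 < e) (hq : 2 ≤ q)
    (hlift : ∀ (B : Type) [CommRing B] [Algebra K B] (x1 y1 z1 : B),
      CvRel (algebraMap K B c) q qb e t x1 y1 z1 → ∃ φ : A →ₐ[K] B, φ x = x1 ∧ φ y = y1 ∧ φ z = z1) :
    Transcendental K z := by
  rw [transcendental_iff]
  intro P hP
  apply Polynomial.funext
  intro z0
  obtain ⟨y0, hy0⟩ := IsAlgClosed.exists_root
    (Polynomial.X ^ (q ^ 2) + (- Polynomial.X - Polynomial.C (z0 ^ t)) : Polynomial K) (by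
      intro h0
      have h1 : (Polynomial.X ^ (q ^ 2) + (- Polynomial.X - Polynomial.C (z0 ^ t)) : Polynomial K).degree = (q ^ 2 : ℕ) := by
        rw [Polynomial.degree_add_eq_left_of_degree_lt] <;> rw [Polynomial.degree_X_pow]
        refine lt_of_le_of_lt (Polynomial.degree_sub_le _ _) (max_lt ?_ ?_)
        · rw [Polynomial.degree_neg, Polynomial.degree_X]
          have : 1 < q ^ 2 := by nlinarith
          exact_mod_cast this
        · exact lt_of_le_of_lt Polynomial.degree_C_le (by
            have : 0 < q ^ 2 := by nlinarith
            exact_mod_cast this)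
      rw [h0] at h1
      have : 0 = q ^ 2 := by exact_mod_cast h1
      nlinarith)
  obtain ⟨x0, hx0⟩ := IsAlgClosed.exists_root
    (∑ i ∈ Finset.range e, (Polynomial.X : Polynomial K) ^ qb ^ i - Polynomial.C (c * y0 ^ (q+1))) (by
      intro h0
      have h1 := TrP_monic qb e hqb he (c * y0 ^ (q+1))
      rw [Polynomial.degree_eq_natDegree h1.1.ne_zero, h1.2] at h0
      have : qb ^ (e - 1) = 0 := by exact_mod_cast h0
      exact pow_ne_zero _ (by omega) this)
  obtain ⟨φ, -, -, h3⟩ := hlift K x0 y0 z0 ⟨by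
      simp [Polynomial.IsRoot] at hy0; linear_combination -hy0, by
      simp [Polynomial.IsRoot, Polynomial.eval_finsetSum] at hx0
      rw [Algebra.algebraMap_self, RingHom.id_apply]; linear_combination hx0⟩
  have := congrArg φ hP
  rw [← Polynomial.aeval_algHom_apply, h3, map_zero] at this
  simpa [Polynomial.aeval_def] using this

theorem setup_hom {c : K} {q qb e t : ℕ} {x y z : A} (hqb : 2 ≤ qb) (he : 0 < e) (hq : 2 ≤ q)
    (hrel : CvRel (algebraMap K A c) q qb e t x y z)
    (hgen : Algebra.adjoin K {x, y, z} = ⊤)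
    (hlift : ∀ (B : Type) [CommRing B] [Algebra K B] (x1 y1 z1 : B),
      CvRel (algebraMap K B c) q qb e t x1 y1 z1 → ∃ φ : A →ₐ[K] B, φ x = x1 ∧ φ y = y1 ∧ φ z = z1)
    (x1 y1 z1 : F) (h1 : CvRel (algebraMap K F c) q qb e t x1 y1 z1) (htr : Transcendental K z1) :
    ∃ φ : F →ₐ[K] F, φ (algebraMap A F x) = x1 ∧ φ (algebraMap A F y) = y1 ∧ φ (algebraMap A F z) = z1 := by
  obtain ⟨φ, hx, hy, hz⟩ := hlift F x1 y1 z1 h1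
  have hinj : Function.Injective φ := by
    letI := ((Polynomial.aeval z : Polynomial K →ₐ[K] A)).toRingHom.toAlgebra
    have hh := setup_integral hqb he hq hrel hgen (Polynomial.aeval z) rfl
    haveI := hh.1
    have : RingHom.ker φ.toRingHom = ⊥ := by
      apply Ideal.eq_bot_of_comap_eq_bot (R := Polynomial K)
      rw [eq_bot_iff]
      intro P hP
      have hP' : φ (Polynomial.aeval z P) = 0 := hP
      rw [← Polynomial.aeval_algHom_apply, hz] at hP'
      exact transcendental_iff.1 htr P hP'
    exact (RingHom.injective_iff_ker_eq_bot _).2 this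
  refine ⟨IsFractionRing.liftAlgHom (A := A) (K := F) hinj, ?_⟩
  simp [IsFractionRing.liftAlgHom_apply, hx, hy, hz]

theorem setup_der {c : K} {q qb e t : ℕ} {x y z : A} (he : 0 < e)
    (hpq : p ∣ q) (hpqb : p ∣ qb)
    (hrel : CvRel (algebraMap K A c) q qb e t x y z)
    (hgen : Algebra.adjoin K {x, y, z} = ⊤)
    (hlift : ∀ (B : Type) [CommRing B] [Algebra K B] (x1 y1 z1 : B),
      CvRel (algebraMap K B c) q qb e t x1 y1 z1 → ∃ φ : A →ₐ[K] B, φ x = x1 ∧ φ y = y1 ∧ φ z = z1) :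
    ∃ D : Derivation K F F, D (algebraMap A F z) = 1 := by
  haveI : CharP F p := charP_of_injective_algebraMap (algebraMap K F).injective p
  obtain ⟨h1, h2⟩ := hrel
  have h1' := congrArg (algebraMap A F) h1
  have h2' := congrArg (algebraMap A F) h2
  rw [map_mul, map_sum, ← IsScalarTower.algebraMap_apply] at h2'
  simp only [map_pow, map_sub] at h1' h2'
  set X := algebraMap A F x
  set Y := algebraMap A F y
  set Z := algebraMap A F z
  have hcast : ∀ n : ℕ, p ∣ n → (n : F) = 0 := fun n hn => (CharP.cast_eq_zero_iff F p n).2 hn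
  have hq2 : (q : F) = 0 := hcast q hpq
  have hqb2 : (qb : F) = 0 := hcast qb hpqb
  let Y' : F := - (t * Z ^ (t - 1))
  let X' : F := algebraMap K F c * (Y ^ q * Y')
  obtain ⟨φ, hx, hy, hz⟩ := hlift (TrivSqZeroExt F F)
    (TrivSqZeroExt.inl X + TrivSqZeroExt.inr X') (TrivSqZeroExt.inl Y + TrivSqZeroExt.inr Y')
    (TrivSqZeroExt.inl Z + TrivSqZeroExt.inr 1) (by
      obtain ⟨k, rfl⟩ : ∃ k, e = k + 1 := ⟨e - 1, by omega⟩
      constructor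
      · ext
        · simp [TrivSqZeroExt.fst_pow, h1']
        · simp [TrivSqZeroExt.snd_pow, hq2, Y']
      · ext
        · rw [TrivSqZeroExt.fst_sum]
          simpa [TrivSqZeroExt.fst_pow, TrivSqZeroExt.algebraMap_eq_inl'] using h2'
        · rw [TrivSqZeroExt.snd_sum, Finset.sum_range_succ', Finset.sum_eq_zero]
          · simp [TrivSqZeroExt.algebraMap_eq_inl', TrivSqZeroExt.snd_pow, X', hq2]
          · intro i _
            simp [TrivSqZeroExt.snd_pow, hqb2])
  have hfst : ∀ a : A, (φ a).fst = algebraMap A F a := by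
    intro a
    have ha : a ∈ Algebra.adjoin K {x, y, z} := by rw [hgen]; trivial
    have := AlgHom.eqOn_adjoin_iff (φ := (TrivSqZeroExt.fstHom K F F).comp φ)
      (ψ := IsScalarTower.toAlgHom K A F) (s := {x, y, z})
    have h := this.2 (by
      rintro _ (rfl | rfl | rfl) <;> simp [hx, hy, hz, X, Y, Z]) ha
    simpa using h
  have hu : ∀ s : nonZeroDivisors A, IsUnit (φ s) := by
    intro s
    rw [TrivSqZeroExt.isUnit_iff_isUnit_fst, hfst, isUnit_iff_ne_zero]
    intro h0
    exact nonZeroDivisors.ne_zero s.2 ((IsFractionRing.injective A F) (by simpa using h0))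
  let Φ : F →ₐ[K] TrivSqZeroExt F F := IsLocalization.liftAlgHom (M := nonZeroDivisors A) (S := F) (f := φ) hu
  have hΦ : ∀ a : A, Φ (algebraMap A F a) = φ a := fun a => by
    simp [Φ, IsLocalization.liftAlgHom_apply]
  have hΦ1 : ∀ f : F, (Φ f).fst = f := by
    intro f
    obtain ⟨g, h, hh0, rfl⟩ := IsFractionRing.div_surjective (A := A) f
    have hh : algebraMap A F h ≠ 0 := by
      intro h0
      exact nonZeroDivisors.ne_zero hh0 ((IsFractionRing.injective A F) (by simpa using h0))
    have : Φ (algebraMap A F g / algebraMap A F h) * Φ (algebraMap A F h) = Φ (algebraMap A F g) := by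
      rw [← map_mul, div_mul_cancel₀ _ hh]
    have := congrArg TrivSqZeroExt.fst this
    rw [TrivSqZeroExt.fst_mul, hΦ, hΦ, hfst, hfst] at this
    rw [eq_div_iff hh, this]
  let D : Derivation K F F := Derivation.mk'
    { toFun := fun f => (Φ f).snd
      map_add' := by intro a b; simp
      map_smul' := by intro a b; simp } (by
      intro f g
      show (Φ (f * g)).snd = _
      rw [map_mul, TrivSqZeroExt.snd_mul, hΦ1, hΦ1]
      simp [mul_comm])
  refine ⟨D, ?_⟩
  show (Φ Z).snd = 1
  rw [hΦ, hz]
  simp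

theorem mkCv {b e t : ℕ} (hb : 0 < b) (he : 0 < e) (hodd : Odd t) (hpt : ¬ p ∣ t)
    (htM : t ≠ 1 → ¬ t ∣ (p ^ b) ^ (e - 1) * ((p ^ b) ^ e) ^ 2 + 1)
    (hcond : e = 1 → ¬ ((p ^ b) ^ e) ^ 2 ∣ t - 1) (c : K) (hc : c ^ ((p ^ b) ^ e) = - c)
    (hc0 : c ≠ 0) {x y z : A}
    (hrel : CvRel (algebraMap K A c) ((p ^ b) ^ e) (p ^ b) e t x y z)
    (hgen : Algebra.adjoin K {x, y, z} = ⊤)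
    (hlift : ∀ (B : Type) [CommRing B] [Algebra K B] (x1 y1 z1 : B),
      CvRel (algebraMap K B c) ((p ^ b) ^ e) (p ^ b) e t x1 y1 z1 →
        ∃ φ : A →ₐ[K] B, φ x = x1 ∧ φ y = y1 ∧ φ z = z1) :
    ∃ S : Cv p K F, S.b = b ∧ S.e = e ∧ S.t = t := by
  have hp : p.Prime := Fact.out
  have hqb : 2 ≤ p ^ b := hp.two_le.trans (Nat.le_self_pow hb.ne' p)
  have hq : 2 ≤ (p ^ b) ^ e := hqb.trans (Nat.le_self_pow he.ne' _)
  have hpqb : p ∣ p ^ b := dvd_pow_self _ hb.ne'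
  have hpq : p ∣ (p ^ b) ^ e := dvd_pow hpqb he.ne'
  haveI := setup_dedekind (p := p) hqb he hq hpq hpqb hrel hgen
  obtain ⟨D, hD⟩ := setup_der (F := F) he hpq hpqb hrel hgen hlift
  have hAmem : ∀ a : A, algebraMap A F a ∈ Algebra.adjoin K {algebraMap A F x, algebraMap A F y, algebraMap A F z} := by
    intro a
    have ha : a ∈ Algebra.adjoin K {x, y, z} := by rw [hgen]; trivial
    have h2 : Algebra.adjoin K {x, y, z} ≤ (Algebra.adjoin K
      {algebraMap A F x, algebraMap A F y, algebraMap A F z}).comap (IsScalarTower.toAlgHom K A F) := by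
      apply Algebra.adjoin_le
      rintro _ (rfl | rfl | rfl) <;> exact Algebra.subset_adjoin (by simp)
    exact h2 ha
  have hrelF : CvRel (algebraMap K F c) ((p ^ b) ^ e) (p ^ b) e t (algebraMap A F x) (algebraMap A F y)
      (algebraMap A F z) := by
    obtain ⟨h1, h2⟩ := hrel
    refine ⟨?_, ?_⟩
    · rw [← map_pow, h1, map_sub, map_pow]
    · simp only [← map_pow, ← map_sum]
      rw [h2, map_mul, map_pow, ← IsScalarTower.algebraMap_apply]
  have hBA : ∀ B : ValuationSubring F, (∀ k : K, algebraMap K F k ∈ B) → algebraMap A F z ∈ B →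
      ∀ a : A, algebraMap A F a ∈ B := by
    intro B hB hz a
    letI := ((Polynomial.aeval z : Polynomial K →ₐ[K] A)).toRingHom.toAlgebra
    have hh := setup_integral hqb he hq hrel hgen (Polynomial.aeval z) rfl
    haveI := hh.1
    obtain ⟨P, hP, hP0⟩ := Algebra.IsIntegral.isIntegral (R := Polynomial K) a
    let φ : Polynomial K →+* B := ((algebraMap A F).comp (algebraMap (Polynomial K) A)).codRestrict B.toSubring (by
      intro Q
      show algebraMap A F (Polynomial.aeval z Q) ∈ B
      rw [← Polynomial.aeval_algebraMap_apply, Polynomial.aeval_eq_sum_range]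
      refine B.toSubring.sum_mem fun i _ => ?_
      rw [Algebra.smul_def]
      exact B.mul_mem _ _ (hB _) (B.toSubring.pow_mem hz _))
    have hIntg : IsIntegral B (algebraMap A F a) := by
      refine ⟨P.map φ, hP.map _, ?_⟩
      rw [Polynomial.eval₂_map]
      have h2 := congrArg (algebraMap A F) hP0
      rw [Polynomial.hom_eval₂, map_zero] at h2
      exact h2
    obtain ⟨w, hw⟩ := IsIntegrallyClosed.isIntegral_iff.1 hIntg
    rw [← hw]
    exact w.2
  refine ⟨{ b := b, e := e, t := t, hb := hb, he := he, hodd := hodd, hpt := hpt, htM := htM,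
            hcond := hcond, c := c, hc := hc, hc0 := hc0, x := algebraMap A F x, y := algebraMap A F y,
            z := algebraMap A F z, hrel := hrelF, htr := ?_, hfrac := ?_,
            hhom := setup_hom hqb he hq hrel hgen hlift, D := D, hDz := hD, hval := ?_, hIntg := ?_ },
          rfl, rfl, rfl⟩
  · have := setup_transc hqb he hq hlift
    rwa [transcendental_algebraMap_iff (IsFractionRing.injective A F)]
  · intro f
    obtain ⟨g, h, hh0, rfl⟩ := IsFractionRing.div_surjective (A := A) f
    refine ⟨_, hAmem g, _, hAmem h, ?_, rfl⟩
    intro h0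
    exact nonZeroDivisors.ne_zero hh0 ((IsFractionRing.injective A F) (by simpa using h0))
  · intro B hB hz f hf
    obtain ⟨g, h, h1, h2, h3⟩ := setup_val (A := A) B (hBA B hB hz) f hf
    exact ⟨_, hAmem g, _, hAmem h, h1, h2, h3⟩
  · intro f hf
    obtain ⟨a, rfl⟩ := setup_int (A := A) f (fun B hB => hf B (fun k => by
      rw [IsScalarTower.algebraMap_apply K A F]; exact hB _) (hB z))
    exact hAmem a

end setup

theorem lift_XRing (K : Type) [Field K] (c : K) (q qb t e : ℕ) :
    CvRel (algebraMap K (XRing K c q qb t e) c) q qb e t (Ideal.Quotient.mk _ (X 0))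
      (Ideal.Quotient.mk _ (X 1)) (Ideal.Quotient.mk _ (X 2)) ∧
    Algebra.adjoin K {(Ideal.Quotient.mk _ (X 0) : XRing K c q qb t e), (Ideal.Quotient.mk _ (X 1)),
      (Ideal.Quotient.mk _ (X 2))} = ⊤ ∧
    ∀ (B : Type) [CommRing B] [Algebra K B] (x1 y1 z1 : B),
      CvRel (algebraMap K B c) q qb e t x1 y1 z1 →
      ∃ φ : XRing K c q qb t e →ₐ[K] B, φ (Ideal.Quotient.mk _ (X 0)) = x1 ∧
        φ (Ideal.Quotient.mk _ (X 1)) = y1 ∧ φ (Ideal.Quotient.mk _ (X 2)) = z1 := by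
  refine ⟨⟨?_, ?_⟩, ?_, ?_⟩
  · rw [← map_pow, ← map_pow, ← map_sub, Ideal.Quotient.eq]
    exact Ideal.subset_span (by simp)
  · rw [eq_comm]
    have : algebraMap K (XRing K c q qb t e) c = Ideal.Quotient.mk _ (C c) := rfl
    rw [this]
    simp only [← map_pow, ← map_mul, ← map_sum]
    rw [Ideal.Quotient.eq]
    exact Ideal.subset_span (by simp)
  · rw [eq_top_iff]
    intro a _
    obtain ⟨P, rfl⟩ := Ideal.Quotient.mk_surjective a
    have h : P ∈ Algebra.adjoin K (Set.range (X : Fin 3 → MvPolynomial (Fin 3) K)) := by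
      rw [adjoin_range_X]; trivial
    have h2 : Algebra.adjoin K (Set.range (X : Fin 3 → MvPolynomial (Fin 3) K)) ≤
        (Algebra.adjoin K {(Ideal.Quotient.mk _ (X 0) : XRing K c q qb t e), (Ideal.Quotient.mk _ (X 1)),
      (Ideal.Quotient.mk _ (X 2))}).comap (Ideal.Quotient.mkₐ K _) := by
      apply Algebra.adjoin_le
      rintro _ ⟨i, rfl⟩
      apply Algebra.subset_adjoin
      fin_cases i <;> simp
    exact h2 h
  · intro B _ _ x1 y1 z1 h
    refine ⟨Ideal.Quotient.liftₐ _ (aeval ![x1, y1, z1]) ?_, ?_, ?_, ?_⟩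
    · intro a ha
      have : XIdeal K c q qb t e ≤ RingHom.ker (aeval ![x1, y1, z1] : MvPolynomial (Fin 3) K →ₐ[K] B) := by
        rw [XIdeal, Ideal.span_le]
        rintro _ (rfl | rfl)
        · simp [RingHom.mem_ker, h.1]
        · simp [RingHom.mem_ker, h.2]
      exact this ha
    · exact (aeval_X _ _)
    · exact (aeval_X _ _)
    · exact (aeval_X _ _)

theorem arith_t {p a b q qb n m s : ℕ} (hp : p.Prime) (ha : 0 < a) (hq : q = p ^ a)
    (hb : 0 < b) (hba : b ∣ a) (hqb : qb = p ^ b)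
    (hn : 3 ≤ n) (hodd : Odd n) (hm : m * (q + 1) = q ^ n + 1)
    (hs : s ∣ m) (hs0 : 0 < s) :
    Odd (m / s) ∧ ¬ p ∣ m / s ∧
    (m / s ≠ 1 → ¬ (m / s) ∣ (p ^ b) ^ (a / b - 1) * ((p ^ b) ^ (a / b)) ^ 2 + 1) := by
  have htm : (m / s) ∣ m := Nat.div_dvd_of_dvd hs
  have hmq : m ∣ q ^ n + 1 := ⟨_, hm.symm⟩
  have hpq : p ∣ q := hq ▸ dvd_pow_self _ ha.ne'
  have hpt : ¬ p ∣ m / s := by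
    intro h
    have h1 := (h.trans htm).trans hmq
    have h2 : p ∣ q ^ n := dvd_pow hpq (by omega)
    exact hp.one_lt.ne' (Nat.dvd_one.1 ((Nat.dvd_add_right h2).1 h1))
  have hmodd : Odd m := by
    rcases Nat.even_or_odd q with he | ho
    · have : Odd (q ^ n + 1) := (he.pow_of_ne_zero (by omega)).add_one
      rw [← hm] at this
      exact (Nat.odd_mul.1 this).1
    · have h1 : (m : ℤ) = ∑ i ∈ Finset.range n, (-(q:ℤ)) ^ i := by
        have := geom_sum_mul (-(q:ℤ)) n
        rw [hodd.neg_pow] at this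
        have hm' : (m : ℤ) * (q + 1) = q ^ n + 1 := by exact_mod_cast hm
        have h0 : ((q:ℤ) + 1) ≠ 0 := by positivity
        apply mul_right_cancel₀ h0
        linear_combination hm' + this
      have h2 : ((m : ℤ) : ZMod 2) = ((n : ℕ) : ZMod 2) := by
        rw [h1]
        push_cast
        have : (q : ZMod 2) = 1 := ZMod.natCast_eq_one_iff_odd.2 ho
        rw [this]
        have : (-1 : ZMod 2) = 1 := by decide
        simp [this]
      rw [ZMod.natCast_eq_one_iff_odd.2 hodd] at h2
      exact ZMod.natCast_eq_one_iff_odd.1 (by exact_mod_cast h2)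
  have htodd : Odd (m / s) := by
    obtain ⟨k, hk⟩ := htm
    rw [hk] at hmodd
    exact (Nat.odd_mul.1 hmodd).1
  refine ⟨htodd, hpt, ?_⟩
  intro ht1 hdiv
  set t := m / s
  obtain ⟨e, he⟩ := hba
  have hae : a / b = e := by rw [he]; exact Nat.mul_div_cancel_left _ hb
  have he0 : 0 < e := by
    rcases Nat.eq_zero_or_pos e with h | h
    · simp [h] at he; omega
    · exact h
  have hA : ((p ^ b : ℕ) : ZMod t) ^ (e * n) = -1 := by
    have : t ∣ q ^ n + 1 := htm.trans hmq
    have h := (ZMod.natCast_eq_zero_iff _ _).2 this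
    rw [hq, he] at h
    push_cast at h ⊢
    rw [← pow_mul] at h
    rw [← pow_mul, ← mul_assoc]
    exact eq_neg_of_add_eq_zero_left h
  have hB : ((p ^ b : ℕ) : ZMod t) ^ (3 * e - 1) = -1 := by
    have h := (ZMod.natCast_eq_zero_iff _ _).2 hdiv
    rw [hae] at h
    push_cast at h ⊢
    have h3 : ((p : ZMod t) ^ b) ^ (3 * e - 1) = ((p : ZMod t) ^ b) ^ (e - 1) * (((p : ZMod t) ^ b) ^ e) ^ 2 := by
      rw [← pow_mul _ e 2, ← pow_add]; congr 1; omega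
    rw [h3]
    exact eq_neg_of_add_eq_zero_left h
  have h1 : (-1 : ZMod t) ^ (3 * e - 1) = (-1) ^ (e * n) := by
    rw [← hA, ← pow_mul, mul_comm, pow_mul, hB, hA]
  have h2 : (1 : ZMod t) = -1 := by
    rcases Nat.even_or_odd e with hev | hod
    · rw [Odd.neg_one_pow (by obtain ⟨k, hk⟩ := hev; exact ⟨3 * k - 1, by omega⟩),
        Even.neg_one_pow (hev.mul_right n)] at h1
      exact h1.symm
    · rw [Even.neg_one_pow (by obtain ⟨k, hk⟩ := hod; exact ⟨3 * k + 1, by omega⟩),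
        Odd.neg_one_pow (hod.mul hodd)] at h1
      exact h1
  have h3 : ((2 : ℕ) : ZMod t) = 0 := by
    push_cast
    linear_combination h2
  have h4 := (ZMod.natCast_eq_zero_iff _ _).1 h3
  rcases (Nat.dvd_prime Nat.prime_two).1 h4 with h | h
  · exact ht1 h
  · rw [h] at htodd; exact absurd htodd (by decide)

theorem exists_Cv (p a b q qb n m s : ℕ) (hp : p.Prime) (ha : 0 < a) (hq : q = p ^ a)
    (hb : 0 < b) (hba : b ∣ a) (hqb : qb = p ^ b)
    (hn : 3 ≤ n) (hodd : Odd n) (hm : m * (q + 1) = q ^ n + 1)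
    (hs : s ∣ m) (hs0 : 0 < s)
    (K : Type) [Field K] [IsAlgClosed K] [CharP K p]
    (c : K) (hc : c ^ (q - 1) = -1)
    [hI : (XIdeal K c q qb (m / s) (a / b)).IsPrime]
    (hcond : b < a ∨ ¬(q ^ 2 ∣ (m / s - 1))) :
    ∃ S : Cv p K (XField K c q qb (m / s) (a / b)), S.b = b ∧ S.e = a / b ∧ S.t = m / s := by
  haveI : Fact p.Prime := ⟨hp⟩
  obtain ⟨hA1, hA2, hA3⟩ := arith_t hp ha hq hb hba hqb hn hodd hm hs hs0
  have he0 : 0 < a / b := Nat.div_pos (Nat.le_of_dvd ha hba) hb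
  have hqe : q = (p ^ b) ^ (a / b) := by rw [hq, ← pow_mul, Nat.mul_div_cancel' hba]
  have hq2 : 2 ≤ q := by
    rw [hq]; exact hp.two_le.trans (Nat.le_self_pow ha.ne' p)
  have hqb2 : 2 ≤ qb := by
    rw [hqb]; exact hp.two_le.trans (Nat.le_self_pow hb.ne' p)
  have hpq : p ∣ q := hq ▸ dvd_pow_self _ ha.ne'
  have hpqb : p ∣ qb := hqb ▸ dvd_pow_self _ hb.ne'
  obtain ⟨hrel, hgen, hlift⟩ := lift_XRing K c q qb (m / s) (a / b)
  have hc0 : c ≠ 0 := by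
    rintro rfl
    rw [zero_pow (by omega)] at hc
    exact one_ne_zero (neg_eq_zero.1 hc.symm)
  have hcq : c ^ q = - c := by
    have : c ^ q = c ^ (q - 1) * c := by rw [← pow_succ]; congr 1; omega
    rw [this, hc]; ring
  subst hqb
  have hcd : a / b = 1 → ¬ ((p ^ b) ^ (a / b)) ^ 2 ∣ m / s - 1 := by
    intro h1
    rw [← hqe]
    rcases hcond with h | h
    · exfalso
      have := Nat.div_mul_cancel hba
      rw [h1] at this; omega
    · exact h
  clear hq
  subst hqe
  exact mkCv (F := XField K c ((p ^ b) ^ (a / b)) (p ^ b) (m / s) (a / b)) hb he0 hA1 hA2 hA3 hcd c hcq hc0 hrel hgen hlift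

set_option linter.all false

noncomputable section
namespace Cv
section numbers
variable {p : ℕ} [hp : Fact p.Prime] {K F : Type} [Field K] [Field F] [Algebra K F] (S : Cv p K F)

def qb : ℕ := p ^ S.b
def N : ℕ := S.qb ^ (S.e - 1)
def q : ℕ := S.qb ^ S.e
def M : ℕ := S.N * S.q ^ 2

theorem two_le_qb : 2 ≤ S.qb := hp.out.two_le.trans (Nat.le_self_pow S.hb.ne' p)
theorem q_eq : S.q = S.N * S.qb := by
  unfold q N; rw [← pow_succ]; congr 1; have := S.he; omega
theorem N_pos : 0 < S.N := pow_pos (by have := S.two_le_qb; omega) _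
theorem qb_le_q : S.qb ≤ S.q := by rw [q_eq]; have := S.N_pos; nlinarith
theorem N_lt_q : S.N < S.q := by rw [q_eq]; have := S.N_pos; have := S.two_le_qb; nlinarith
theorem two_le_q : 2 ≤ S.q := S.two_le_qb.trans S.qb_le_q
theorem q2_gt : S.q < S.q ^ 2 := by have := S.two_le_q; nlinarith
theorem q1_lt : S.q + 1 < S.q ^ 2 := by have := S.two_le_q; nlinarith
theorem M_pos : 0 < S.M := Nat.mul_pos S.N_pos (pow_pos (by have := S.two_le_q; omega) _)
theorem p_dvd_qb : p ∣ S.qb := dvd_pow_self _ S.hb.ne'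
theorem p_dvd_q : p ∣ S.q := dvd_pow S.p_dvd_qb S.he.ne'
theorem t_pos : 0 < S.t := S.hodd.pos
theorem N_powp : S.N = p ^ (S.b * (S.e - 1)) := by unfold N qb; rw [← pow_mul]
theorem q_powp : S.q = p ^ (S.b * S.e) := by unfold q qb; rw [← pow_mul]
theorem M_powp : S.M = p ^ (S.b * (S.e - 1) + S.b * S.e * 2) := by
  unfold M; rw [N_powp, q_powp, ← pow_mul, ← pow_add]
theorem cop_p_t : Nat.Coprime p S.t := (Nat.Prime.coprime_iff_not_dvd hp.out).2 S.hpt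
theorem cop_p_q1 : Nat.Coprime p (S.q + 1) := by
  rw [Nat.Prime.coprime_iff_not_dvd hp.out]
  intro h
  exact hp.out.one_lt.ne' (Nat.dvd_one.1 ((Nat.dvd_add_right S.p_dvd_q).1 h))
theorem N_eq_one_iff : S.N = 1 ↔ S.e = 1 := by
  have := S.he
  have h2 := S.two_le_qb
  constructor
  · intro h
    unfold N at h
    rcases (Nat.pow_eq_one.1 h) with h | h <;> omega
  · intro h; unfold N; rw [h]; simp
theorem p_dvd_N (h : S.N ≠ 1) : p ∣ S.N := by
  rw [Ne, N_eq_one_iff] at h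
  have := S.he
  exact dvd_pow S.p_dvd_qb (by omega)
theorem t_of_N (h : S.N = 1) : 3 ≤ S.t := by
  have h1 := S.hcond (S.N_eq_one_iff.1 h)
  have h2 := S.hodd
  have : S.t ≠ 1 := by intro h; rw [h] at h1; simp at h1
  obtain ⟨k, hk⟩ := h2
  omega

/-- weight of an exponent triple -/
def wt (m : ℕ × ℕ × ℕ) : ℕ := m.1 * (S.t * (S.q + 1)) + m.2.1 * (S.N * S.t) + m.2.2 * S.M

/-- reduced exponent triples -/
abbrev Idx := {m : ℕ × ℕ × ℕ // m.1 < S.N ∧ m.2.1 < S.q ^ 2}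

theorem wt_inj {m n : S.Idx} (h : S.wt m = S.wt n) : m = n := by
  obtain ⟨⟨i, j, l⟩, hi, hj⟩ := m
  obtain ⟨⟨i', j', l'⟩, hi', hj'⟩ := n
  simp only [wt, M] at h hi hj hi' hj'
  have hNc : Nat.Coprime S.N (S.t * (S.q + 1)) := by
    rw [N_powp]; exact Nat.Coprime.pow_left _ (S.cop_p_t.mul_right S.cop_p_q1)
  have hqc : Nat.Coprime (S.q ^ 2) S.t := by
    rw [q_powp]; exact Nat.Coprime.pow_left _ (Nat.Coprime.pow_left _ S.cop_p_t)
  have h1 : i * (S.t * (S.q + 1)) ≡ i' * (S.t * (S.q + 1)) [MOD S.N] := by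
    have e1 : i * (S.t * (S.q + 1)) ≡ i * (S.t * (S.q + 1)) + j * (S.N * S.t) + l * (S.N * S.q ^ 2) [MOD S.N] := by
      apply (Nat.modEq_iff_dvd' (by omega)).2
      exact ⟨j * S.t + l * S.q ^ 2, by rw [add_assoc, Nat.add_sub_cancel_left]; ring⟩
    have e2 : i' * (S.t * (S.q + 1)) ≡ i' * (S.t * (S.q + 1)) + j' * (S.N * S.t) + l' * (S.N * S.q ^ 2) [MOD S.N] := by
      apply (Nat.modEq_iff_dvd' (by omega)).2
      exact ⟨j' * S.t + l' * S.q ^ 2, by rw [add_assoc, Nat.add_sub_cancel_left]; ring⟩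
    exact e1.trans (h ▸ e2.symm)
  have h2 : i = i' := (Nat.ModEq.cancel_right_of_coprime hNc h1).eq_of_lt_of_lt hi hi'
  subst h2
  have h3 : j * S.t + l * S.q ^ 2 = j' * S.t + l' * S.q ^ 2 := by
    apply Nat.eq_of_mul_eq_mul_left S.N_pos
    have : j * (S.N * S.t) + l * (S.N * S.q ^ 2) = j' * (S.N * S.t) + l' * (S.N * S.q ^ 2) := by omega
    linarith
  have h4 : j * S.t ≡ j' * S.t [MOD S.q ^ 2] := by
    have e1 : j * S.t ≡ j * S.t + l * S.q ^ 2 [MOD S.q ^ 2] := by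
      apply (Nat.modEq_iff_dvd' (by omega)).2
      exact ⟨l, by rw [Nat.add_sub_cancel_left]; ring⟩
    have e2 : j' * S.t ≡ j' * S.t + l' * S.q ^ 2 [MOD S.q ^ 2] := by
      apply (Nat.modEq_iff_dvd' (by omega)).2
      exact ⟨l', by rw [Nat.add_sub_cancel_left]; ring⟩
    exact e1.trans (h3 ▸ e2.symm)
  have h5 : j = j' := (Nat.ModEq.cancel_right_of_coprime hqc h4).eq_of_lt_of_lt hj hj'
  subst h5
  have h6 : l = l' := by
    apply Nat.eq_of_mul_eq_mul_right (pow_pos (by have := S.two_le_q; omega : 0 < S.q) 2)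
    omega
  subst h6
  rfl

end numbers

section span
variable {p : ℕ} [hp : Fact p.Prime] {K F : Type} [Field K] [Field F] [Algebra K F] (S : Cv p K F)

/-- affine coordinate ring -/
def A : Subalgebra K F := Algebra.adjoin K {S.x, S.y, S.z}

theorem x_mem : S.x ∈ S.A := Algebra.subset_adjoin (by simp)
theorem y_mem : S.y ∈ S.A := Algebra.subset_adjoin (by simp)
theorem z_mem : S.z ∈ S.A := Algebra.subset_adjoin (by simp)

theorem hzt : S.z ^ S.t = S.y ^ (S.q ^ 2) - S.y := S.hrel.1
theorem htr' : ∑ i ∈ Finset.range S.e, S.x ^ S.qb ^ i = algebraMap K F S.c * S.y ^ (S.q + 1) := S.hrel.2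
theorem hcq : S.c ^ S.q = - S.c := S.hc
theorem xN : S.x ^ S.N = algebraMap K F S.c * S.y ^ (S.q + 1) - ∑ i ∈ Finset.range (S.e - 1), S.x ^ S.qb ^ i := by
  rw [← htr']
  obtain ⟨k, hk⟩ : ∃ k, S.e = k + 1 := ⟨S.e - 1, by have := S.he; omega⟩
  unfold N
  rw [hk, Finset.sum_range_succ]; simp

def mono (m : ℕ × ℕ × ℕ) : F := S.x ^ m.1 * S.y ^ m.2.1 * S.z ^ m.2.2

theorem mono_mem (m) : S.mono m ∈ S.A :=
  S.A.mul_mem (S.A.mul_mem (S.A.pow_mem S.x_mem _) (S.A.pow_mem S.y_mem _)) (S.A.pow_mem S.z_mem _)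

def W : Submodule K F := Submodule.span K (Set.range fun m : S.Idx => S.mono m)

theorem monoW {i j l : ℕ} (hi : i < S.N) (hj : j < S.q ^ 2) : S.x ^ i * S.y ^ j * S.z ^ l ∈ S.W :=
  Submodule.subset_span ⟨⟨(i, j, l), hi, hj⟩, rfl⟩

theorem W_ind {g : F} (h : ∀ i j l, i < S.N → j < S.q ^ 2 → g * (S.x ^ i * S.y ^ j * S.z ^ l) ∈ S.W)
    {f : F} (hf : f ∈ S.W) : g * f ∈ S.W := by
  have : S.W ≤ S.W.comap (LinearMap.mulLeft K g) := by
    conv_lhs => rw [W]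
    rw [Submodule.span_le]
    rintro _ ⟨⟨⟨i, j, l⟩, hi, hj⟩, rfl⟩
    exact h i j l hi hj
  exact this hf

theorem W_z {f : F} (hf : f ∈ S.W) : S.z * f ∈ S.W := by
  refine S.W_ind ?_ hf
  intro i j l hi hj
  have : S.z * (S.x ^ i * S.y ^ j * S.z ^ l) = S.x ^ i * S.y ^ j * S.z ^ (l+1) := by ring
  rw [this]; exact S.monoW hi hj

theorem W_y {f : F} (hf : f ∈ S.W) : S.y * f ∈ S.W := by
  refine S.W_ind ?_ hf
  intro i j l hi hj
  by_cases h : j + 1 < S.q ^ 2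
  · have : S.y * (S.x ^ i * S.y ^ j * S.z ^ l) = S.x ^ i * S.y ^ (j+1) * S.z ^ l := by ring
    rw [this]; exact S.monoW hi h
  · have h2 : j + 1 = S.q ^ 2 := by omega
    have : S.y * (S.x ^ i * S.y ^ j * S.z ^ l) = S.x ^ i * S.y ^ 1 * S.z ^ l + S.x ^ i * S.y ^ 0 * S.z ^ (l + S.t) := by
      have h3 : S.y ^ (j+1) = S.y + S.z ^ S.t := by rw [h2, S.hzt]; ring
      rw [pow_succ] at h3
      rw [pow_add]
      linear_combination (S.x ^ i * S.z ^ l) * h3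
    rw [this]
    have h1 := S.q2_gt
    have := S.two_le_q
    exact S.W.add_mem (S.monoW hi (by omega)) (S.monoW hi (by omega))

theorem W_yn (n : ℕ) {f : F} (hf : f ∈ S.W) : S.y ^ n * f ∈ S.W := by
  induction n with
  | zero => simpa using hf
  | succ n ih => rw [pow_succ', mul_assoc]; exact S.W_y ih

theorem W_x {f : F} (hf : f ∈ S.W) : S.x * f ∈ S.W := by
  refine S.W_ind ?_ hf
  intro i j l hi hj
  by_cases h : i + 1 < S.N
  · have : S.x * (S.x ^ i * S.y ^ j * S.z ^ l) = S.x ^ (i+1) * S.y ^ j * S.z ^ l := by ring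
    rw [this]; exact S.monoW h hj
  · have h2 : i + 1 = S.N := by omega
    have : S.x * (S.x ^ i * S.y ^ j * S.z ^ l) = S.c • (S.y ^ (S.q + 1) * (S.x ^ 0 * S.y ^ j * S.z ^ l))
        - ∑ i ∈ Finset.range (S.e - 1), S.x ^ S.qb ^ i * S.y ^ j * S.z ^ l := by
      rw [← Finset.sum_mul, ← Finset.sum_mul, Algebra.smul_def]
      have h3 := S.xN
      rw [← h2, pow_succ] at h3
      linear_combination (S.y ^ j * S.z ^ l) * h3
    rw [this]
    refine S.W.sub_mem (S.W.smul_mem _ (S.W_yn _ (S.monoW S.N_pos hj))) (S.W.sum_mem fun k hk => ?_)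
    refine S.monoW ?_ hj
    exact Nat.pow_lt_pow_right (by have := S.two_le_qb; omega) (Finset.mem_range.1 hk)

theorem A_le_W {f : F} (hf : f ∈ S.A) : f ∈ S.W := by
  have h1 : (1 : F) ∈ S.W := by
    have := S.monoW (i := 0) (j := 0) (l := 0) S.N_pos (by have := S.two_le_q; positivity)
    simpa using this
  have : ∀ g ∈ S.A, ∀ f ∈ S.W, g * f ∈ S.W := by
    intro g hg
    induction hg using Algebra.adjoin_induction with
    | mem g hg =>
      intro f hf
      rcases hg with rfl | rfl | rfl
      · exact S.W_x hf
      · exact S.W_y hf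
      · exact S.W_z hf
    | algebraMap r => intro f hf; rw [← Algebra.smul_def]; exact S.W.smul_mem _ hf
    | add a b _ _ ha hb => intro f hf; rw [add_mul]; exact S.W.add_mem (ha f hf) (hb f hf)
    | mul a b _ _ ha hb => intro f hf; rw [mul_assoc]; exact ha _ (hb f hf)
  simpa using this f hf 1 h1

def lc (a : S.Idx →₀ K) : F := Finsupp.linearCombination K (fun m : S.Idx => S.mono m) a

theorem lc_eq (a : S.Idx →₀ K) : S.lc a = ∑ m ∈ a.support, algebraMap K F (a m) * S.mono m := by
  unfold lc
  rw [Finsupp.linearCombination_apply, Finsupp.sum]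
  exact Finset.sum_congr rfl fun m _ => Algebra.smul_def _ _

theorem lc_mem (a : S.Idx →₀ K) : S.lc a ∈ S.A := by
  rw [lc_eq]
  exact S.A.sum_mem fun m _ => S.A.mul_mem (S.A.algebraMap_mem _) (S.mono_mem _)

theorem exists_lc {f : F} (hf : f ∈ S.A) : ∃ a, f = S.lc a := by
  have := S.A_le_W hf
  rw [W, Finsupp.mem_span_range_iff_exists_finsupp] at this
  obtain ⟨a, ha⟩ := this
  exact ⟨a, ha.symm⟩

end span

section inf
variable {p : ℕ} [hp : Fact p.Prime] {K F : Type} [Field K] [Field F] [Algebra K F] (S : Cv p K F)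

theorem exists_inf : ∃ V : ValuationSubring F, (∀ k : K, algebraMap K F k ∈ V) ∧ S.z ∉ V := by
  have hz0 : S.z ≠ 0 := fun h => S.htr (h ▸ isAlgebraic_zero)
  have htri : Transcendental K (S.z⁻¹) := by
    intro h; have := h.inv; rw [inv_inv] at this; exact S.htr this
  let R : Subalgebra K F := Algebra.adjoin K {S.z⁻¹}
  have hzR : S.z⁻¹ ∈ R := Algebra.subset_adjoin rfl
  let I : Ideal R.toSubring := Ideal.span {⟨S.z⁻¹, hzR⟩}
  have hI : I ≠ ⊤ := by
    intro h
    have h1 : (1 : R.toSubring) ∈ I := by rw [h]; trivial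
    obtain ⟨w, hw⟩ := Ideal.mem_span_singleton.1 h1
    have hwR : (w : F) ∈ R := w.2
    obtain ⟨P, hP⟩ := Algebra.adjoin_mem_exists_aeval K (S.z⁻¹) hwR
    have h2 : (1 : F) = S.z⁻¹ * w := congrArg Subtype.val hw
    have h3 := transcendental_iff.1 htri (1 - Polynomial.X * P) (by simp [hP, ← h2])
    have h4 := congrArg (Polynomial.eval 0) h3
    simp at h4
  obtain ⟨V, hV1, hV2⟩ := Ideal.image_subset_nonunits_valuationSubring I hI
  refine ⟨V, fun k => hV1 (R.algebraMap_mem k), ?_⟩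
  intro hz
  have h5 : S.z⁻¹ ∈ V.nonunits := hV2 ⟨⟨S.z⁻¹, hzR⟩, Ideal.subset_span rfl, rfl⟩
  rw [ValuationSubring.mem_nonunits_iff] at h5
  rw [← V.valuation_le_one_iff] at hz
  have h6 : V.valuation S.z * V.valuation S.z⁻¹ = 1 := by rw [← map_mul, mul_inv_cancel₀ hz0, map_one]
  have : V.valuation S.z * V.valuation S.z⁻¹ < 1 := (mul_le_of_le_one_left' hz).trans_lt h5
  exact this.ne h6

variable {V : ValuationSubring F} (hK : ∀ k : K, algebraMap K F k ∈ V) (hz : S.z ∉ V)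

theorem val_const {V : ValuationSubring F} (hK : ∀ k : K, algebraMap K F k ∈ V) {k : K} (hk : k ≠ 0) :
    V.valuation (algebraMap K F k) = 1 := by
  apply le_antisymm ((V.valuation_le_one_iff _).2 (hK k))
  have h1 := (V.valuation_le_one_iff _).2 (hK k⁻¹)
  have h2 : V.valuation (algebraMap K F k) * V.valuation (algebraMap K F k⁻¹) = 1 := by
    rw [← map_mul, ← map_mul, mul_inv_cancel₀ hk, map_one, map_one]
  by_contra hlt
  push Not at hlt
  exact (mul_lt_one_of_lt_of_le hlt h1).ne h2

theorem val_z (hz : S.z ∉ V) : 1 < V.valuation S.z := by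
  rw [← V.valuation_le_one_iff] at hz; exact not_le.1 hz

theorem val_y (hz : S.z ∉ V) : 1 < V.valuation S.y ∧ V.valuation S.y ^ (S.q ^ 2) = V.valuation S.z ^ S.t := by
  have h1 := S.val_z hz
  have h0 : V.valuation S.z ^ S.t = V.valuation (S.y ^ (S.q ^ 2) - S.y) := by rw [← map_pow, S.hzt]
  have hgt : 1 < V.valuation S.z ^ S.t := one_lt_pow₀ h1 S.t_pos.ne'
  have hy : 1 < V.valuation S.y := by
    by_contra hle
    push Not at hle
    have : V.valuation (S.y ^ (S.q ^ 2) - S.y) ≤ 1 := by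
      refine (V.valuation.map_sub _ _).trans (max_le ?_ hle)
      rw [map_pow]; exact pow_le_one₀ zero_le' hle
    rw [h0] at hgt
    exact absurd hgt (not_lt.2 this)
  refine ⟨hy, ?_⟩
  rw [h0, Valuation.map_sub_eq_of_lt_left, map_pow]
  rw [map_pow]
  exact lt_self_pow₀ hy (by have := S.two_le_q; have := S.q2_gt; omega)

theorem val_x (hK : ∀ k : K, algebraMap K F k ∈ V) (hz : S.z ∉ V) :
    1 < V.valuation S.x ∧ V.valuation S.x ^ S.N = V.valuation S.y ^ (S.q + 1) := by
  obtain ⟨hy, -⟩ := S.val_y hz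
  have h0 : V.valuation (∑ i ∈ Finset.range S.e, S.x ^ S.qb ^ i) = V.valuation S.y ^ (S.q + 1) := by
    rw [S.htr', map_mul, val_const hK S.hc0, one_mul, map_pow]
  have hgt : 1 < V.valuation S.y ^ (S.q+1) := one_lt_pow₀ hy (by omega)
  have hx : 1 < V.valuation S.x := by
    by_contra hle
    push Not at hle
    have : V.valuation (∑ i ∈ Finset.range S.e, S.x ^ S.qb ^ i) ≤ 1 := by
      apply V.valuation.map_sum_le
      intro i _
      rw [map_pow]; exact pow_le_one₀ zero_le' hle
    rw [h0] at this
    exact absurd hgt (not_lt.2 this)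
  refine ⟨hx, ?_⟩
  rw [← h0]
  obtain ⟨k, hk⟩ : ∃ k, S.e = k + 1 := ⟨S.e - 1, by have := S.he; omega⟩
  unfold N
  rw [hk, Finset.sum_range_succ, Valuation.map_add_eq_of_lt_right, map_pow]
  · simp
  · rw [map_pow]
    apply V.valuation.map_sum_lt (pow_ne_zero _ (by rintro h; rw [h] at hx; simp at hx))
    intro i hi
    rw [map_pow]
    exact pow_lt_pow_right₀ hx (Nat.pow_lt_pow_right (by have := S.two_le_qb; omega) (Finset.mem_range.1 hi))

theorem val_mono (hK : ∀ k : K, algebraMap K F k ∈ V) (hz : S.z ∉ V) (m : ℕ × ℕ × ℕ) :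
    V.valuation (S.mono m) ^ S.M = V.valuation S.z ^ S.wt m := by
  obtain ⟨-, hy⟩ := S.val_y hz
  obtain ⟨-, hx⟩ := S.val_x hK hz
  have hyM : V.valuation S.y ^ S.M = V.valuation S.z ^ (S.N * S.t) := by
    unfold M; rw [mul_comm, pow_mul, hy, ← pow_mul, mul_comm]
  have hxM : V.valuation S.x ^ S.M = V.valuation S.z ^ (S.t * (S.q + 1)) := by
    unfold M; rw [pow_mul, hx, ← pow_mul, mul_comm, pow_mul, hy, ← pow_mul]
  unfold mono wt
  simp only [map_mul, map_pow, mul_pow, pow_add]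
  rw [pow_right_comm, hxM, pow_right_comm _ m.2.1, hyM]
  simp only [← pow_mul]
  rw [mul_comm m.1, mul_comm m.2.1]

theorem val_lc (hK : ∀ k : K, algebraMap K F k ∈ V) (hz : S.z ∉ V) {a : S.Idx →₀ K} (ha : a ≠ 0) :
    ∃ m ∈ a.support, (∀ n ∈ a.support, S.wt n ≤ S.wt m) ∧
      V.valuation (S.lc a) ^ S.M = V.valuation S.z ^ S.wt m := by
  classical
  have hz1 := S.val_z hz
  have hne : a.support.Nonempty := Finsupp.support_nonempty_iff.2 ha
  obtain ⟨m, hm, hmax⟩ := Finset.exists_max_image a.support (fun m : S.Idx => S.wt m) hne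
  refine ⟨m, hm, hmax, ?_⟩
  rw [← S.val_mono hK hz m]
  congr 1
  have hlt : ∀ n ∈ a.support.erase m, V.valuation (algebraMap K F (a n) * S.mono n) < V.valuation (S.mono m) := by
    intro n hn
    rw [Finset.mem_erase] at hn
    rw [map_mul, val_const hK (Finsupp.mem_support_iff.1 hn.2), one_mul]
    have hw : S.wt n < S.wt m := lt_of_le_of_ne (hmax n hn.2) fun h => hn.1 (S.wt_inj h)
    have := pow_lt_pow_right₀ hz1 hw
    rw [← S.val_mono hK hz, ← S.val_mono hK hz] at this
    exact lt_of_pow_lt_pow_left₀ _ zero_le' this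
  have hm0 : V.valuation (S.mono m) ≠ 0 := by
    intro h
    have := S.val_mono hK hz m
    rw [h, zero_pow S.M_pos.ne'] at this
    exact pow_ne_zero _ (zero_lt_one.trans hz1).ne' this.symm
  rw [lc_eq, ← Finset.add_sum_erase _ _ hm, Valuation.map_add_eq_of_lt_left, map_mul,
    val_const hK (Finsupp.mem_support_iff.1 hm), one_mul]
  rw [map_mul, val_const hK (Finsupp.mem_support_iff.1 hm), one_mul]
  exact V.valuation.map_sum_lt hm0 hlt

end inf
end Cv
end

set_option linter.all false
noncomputable section
namespace Cv
section deg
variable {p : ℕ} [hp : Fact p.Prime] {K F : Type} [Field K] [Field F] [Algebra K F] (S : Cv p K F)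

/-- the place at infinity -/
def Vinf : ValuationSubring F := Classical.choose S.exists_inf
theorem Vinf_K (k : K) : algebraMap K F k ∈ S.Vinf := (Classical.choose_spec S.exists_inf).1 k
theorem Vinf_z : S.z ∉ S.Vinf := (Classical.choose_spec S.exists_inf).2

/-- degree at infinity at most d -/
def dL (f : F) (d : ℤ) : Prop := S.Vinf.valuation f ^ S.M ≤ S.Vinf.valuation S.z ^ d
/-- degree at infinity exactly d -/
def dE (f : F) (d : ℤ) : Prop := S.Vinf.valuation f ^ S.M = S.Vinf.valuation S.z ^ d

theorem vz1 : 1 < S.Vinf.valuation S.z := S.val_z S.Vinf_z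
theorem vz0 : S.Vinf.valuation S.z ≠ 0 := (zero_lt_one.trans S.vz1).ne'

variable {S}
theorem dE.L {f : F} {d : ℤ} (h : S.dE f d) : S.dL f d := le_of_eq h
theorem dL.mono {f : F} {d e : ℤ} (h : S.dL f d) (hde : d ≤ e) : S.dL f e :=
  le_trans h ((zpow_le_zpow_iff_right₀ S.vz1).2 hde)
theorem dE.le {f : F} {d e : ℤ} (h : S.dE f d) (h' : S.dL f e) : d ≤ e := by
  unfold dE at h; unfold dL at h'
  rw [h] at h'
  exact (zpow_le_zpow_iff_right₀ S.vz1).1 h'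
theorem dE.unique {f : F} {d e : ℤ} (h : S.dE f d) (h' : S.dE f e) : d = e :=
  le_antisymm (h.le h'.L) (h'.le h.L)
theorem dL.mul {f g : F} {d e : ℤ} (h : S.dL f d) (h' : S.dL g e) : S.dL (f * g) (d + e) := by
  unfold dL at *
  rw [map_mul, mul_pow, zpow_add₀ S.vz0]
  exact mul_le_mul' h h'
theorem dE.mul {f g : F} {d e : ℤ} (h : S.dE f d) (h' : S.dE g e) : S.dE (f * g) (d + e) := by
  unfold dE at *
  rw [map_mul, mul_pow, zpow_add₀ S.vz0, h, h']
theorem dE.inv {f : F} {d : ℤ} (h : S.dE f d) : S.dE (f⁻¹) (-d) := by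
  unfold dE at *
  rw [map_inv₀, inv_pow, h, zpow_neg]
theorem dE.div {f g : F} {d e : ℤ} (h : S.dE f d) (h' : S.dE g e) : S.dE (f / g) (d - e) := by
  rw [div_eq_mul_inv, sub_eq_add_neg]; exact h.mul h'.inv
theorem dL.add {f g : F} {d : ℤ} (h : S.dL f d) (h' : S.dL g d) : S.dL (f + g) d := by
  unfold dL at *
  rcases max_choice (S.Vinf.valuation f) (S.Vinf.valuation g) with hm | hm
  · exact (pow_le_pow_left₀ zero_le' ((S.Vinf.valuation.map_add f g).trans_eq hm) _).trans h
  · exact (pow_le_pow_left₀ zero_le' ((S.Vinf.valuation.map_add f g).trans_eq hm) _).trans h'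
theorem dL.neg {f : F} {d : ℤ} (h : S.dL f d) : S.dL (-f) d := by
  unfold dL at *; rwa [Valuation.map_neg]
theorem dE.neg {f : F} {d : ℤ} (h : S.dE f d) : S.dE (-f) d := by
  unfold dE at *; rwa [Valuation.map_neg]
theorem dL.sub {f g : F} {d : ℤ} (h : S.dL f d) (h' : S.dL g d) : S.dL (f - g) d := by
  rw [sub_eq_add_neg]; exact h.add h'.neg
variable (S)
theorem dL_zero (d : ℤ) : S.dL 0 d := by
  unfold dL; rw [map_zero, zero_pow S.M_pos.ne']; exact zero_le'
theorem dE_const {k : K} (hk : k ≠ 0) : S.dE (algebraMap K F k) 0 := by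
  unfold dE; rw [val_const S.Vinf_K hk]; simp
theorem dL_const (k : K) : S.dL (algebraMap K F k) 0 := by
  by_cases hk : k = 0
  · rw [hk, map_zero]; exact S.dL_zero 0
  · exact (S.dE_const hk).L
theorem dE_one : S.dE 1 0 := by unfold dE; simp
variable {S}
theorem dE.pow {f : F} {d : ℤ} (h : S.dE f d) (n : ℕ) : S.dE (f ^ n) (n * d) := by
  unfold dE at *
  rw [map_pow, pow_right_comm, h, mul_comm, zpow_mul, zpow_natCast]
theorem dE.zpow {f : F} {d : ℤ} (h : S.dE f d) (n : ℤ) : S.dE (f ^ n) (n * d) := by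
  unfold dE at *
  rw [map_zpow₀, ← zpow_natCast, ← zpow_mul, mul_comm, zpow_mul, zpow_natCast, h, mul_comm, zpow_mul]
theorem dL.pow {f : F} {d : ℤ} (h : S.dL f d) (n : ℕ) : S.dL (f ^ n) (n * d) := by
  induction n with
  | zero => simpa using S.dE_one.L
  | succ n ih => rw [pow_succ]; convert ih.mul h using 1; push_cast; ring
theorem dE.ne_zero {f : F} {d : ℤ} (h : S.dE f d) : f ≠ 0 := by
  rintro rfl
  unfold dE at h
  rw [map_zero, zero_pow S.M_pos.ne'] at h
  exact zpow_ne_zero _ S.vz0 h.symm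
theorem dE.add {f g : F} {d e : ℤ} (h : S.dE f d) (h' : S.dL g e) (hlt : e < d) : S.dE (f + g) d := by
  unfold dE
  rw [Valuation.map_add_eq_of_lt_left]
  · exact h
  · have : S.Vinf.valuation g ^ S.M < S.Vinf.valuation f ^ S.M := by
      unfold dE at h; rw [h]
      exact lt_of_le_of_lt h' ((zpow_lt_zpow_iff_right₀ S.vz1).2 hlt)
    exact lt_of_pow_lt_pow_left₀ _ zero_le' this
theorem dL.const_mul {f : F} {d : ℤ} (h : S.dL f d) (k : K) : S.dL (algebraMap K F k * f) d := by
  simpa using (S.dL_const k).mul h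
theorem dL.sum {ι : Type*} {s : Finset ι} {f : ι → F} {d : ℤ} (h : ∀ i ∈ s, S.dL (f i) d) :
    S.dL (∑ i ∈ s, f i) d := by
  classical
  induction s using Finset.induction_on with
  | empty => exact S.dL_zero d
  | insert a s ha ih =>
    rw [Finset.sum_insert ha]
    exact (h a (by simp)).add (ih fun i hi => h i (by simp [hi]))
variable (S)
theorem dE_mono (m : ℕ × ℕ × ℕ) : S.dE (S.mono m) (S.wt m) := by
  unfold dE; rw [zpow_natCast]; exact S.val_mono S.Vinf_K S.Vinf_z m
theorem dE_z : S.dE S.z S.M := by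
  have := S.dE_mono (0, 0, 1); simpa [mono, wt] using this
theorem dE_y : S.dE S.y (S.N * S.t) := by
  have := S.dE_mono (0, 1, 0); simpa [mono, wt] using this
theorem dE_x : S.dE S.x (S.t * (S.q + 1)) := by
  have := S.dE_mono (1, 0, 0); simpa [mono, wt] using this

theorem lc_zero : S.lc 0 = 0 := by unfold lc; simp

theorem dE_lc {a : S.Idx →₀ K} (ha : a ≠ 0) :
    ∃ m ∈ a.support, (∀ n ∈ a.support, S.wt n ≤ S.wt m) ∧ S.dE (S.lc a) (S.wt m) := by
  obtain ⟨m, h1, h2, h3⟩ := S.val_lc S.Vinf_K S.Vinf_z ha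
  exact ⟨m, h1, h2, by unfold dE; rw [zpow_natCast]; exact h3⟩

theorem dL_lc {a : S.Idx →₀ K} {d : ℤ} : S.dL (S.lc a) d ↔ ∀ m ∈ a.support, (S.wt m : ℤ) ≤ d := by
  constructor
  · intro h m hm
    have ha : a ≠ 0 := by rintro rfl; simp at hm
    obtain ⟨n, hn, hmax, hE⟩ := S.dE_lc ha
    exact le_trans (by exact_mod_cast hmax m hm) (hE.le h)
  · intro h
    rw [lc_eq]
    exact dL.sum fun m hm => ((S.dE_mono m).L.mono (h m hm)).const_mul _

theorem dE_A {f : F} (hf : f ∈ S.A) (h0 : f ≠ 0) : ∃ m : S.Idx, S.dE f (S.wt m) := by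
  obtain ⟨a, rfl⟩ := S.exists_lc hf
  have ha : a ≠ 0 := by rintro rfl; exact h0 S.lc_zero
  obtain ⟨m, -, -, h⟩ := S.dE_lc ha
  exact ⟨m, h⟩

theorem frac (f : F) : ∃ g ∈ S.A, ∃ h ∈ S.A, h ≠ 0 ∧ f = g / h := S.hfrac f

theorem exists_dE {f : F} (h0 : f ≠ 0) : ∃ d, S.dE f d := by
  obtain ⟨g, hg, h, hh, hh0, rfl⟩ := S.frac f
  have hg0 : g ≠ 0 := by rintro rfl; simp at h0
  obtain ⟨m, hm⟩ := S.dE_A hg hg0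
  obtain ⟨n, hn⟩ := S.dE_A hh hh0
  exact ⟨_, hm.div hn⟩

theorem mem_Vinf {f : F} : f ∈ S.Vinf ↔ S.dL f 0 := by
  unfold dL
  rw [zpow_zero, pow_le_one_iff_of_nonneg zero_le' S.M_pos.ne', ValuationSubring.valuation_le_one_iff]

/-- If not `dL f d` then exact degree is larger. -/
theorem not_dL {f : F} {d : ℤ} (h : ¬ S.dL f d) : ∃ e, d < e ∧ S.dE f e := by
  have h0 : f ≠ 0 := by rintro rfl; exact h (S.dL_zero d)
  obtain ⟨e, he⟩ := S.exists_dE h0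
  refine ⟨e, ?_, he⟩
  by_contra hle
  exact h (he.L.mono (not_lt.1 hle))

theorem eq_Vinf {V : ValuationSubring F} (hK : ∀ k : K, algebraMap K F k ∈ V) (hz : S.z ∉ V) : V = S.Vinf := by
  have key : ∀ {V : ValuationSubring F} (hK : ∀ k : K, algebraMap K F k ∈ V) (hz : S.z ∉ V)
      (a b : S.Idx →₀ K), a ≠ 0 → b ≠ 0 →
      (S.lc a / S.lc b ∈ V ↔ ∀ n ∈ a.support, ∃ m ∈ b.support, S.wt n ≤ S.wt m) := by
    intro V hK hz a b ha hb
    obtain ⟨n, hn1, hn2, hn3⟩ := S.val_lc hK hz ha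
    obtain ⟨m, hm1, hm2, hm3⟩ := S.val_lc hK hz hb
    have hz1 := S.val_z hz
    have hm0 : V.valuation (S.lc b) ≠ 0 := by
      intro h
      rw [h, zero_pow S.M_pos.ne'] at hm3
      exact pow_ne_zero _ (zero_lt_one.trans hz1).ne' hm3.symm
    rw [← V.valuation_le_one_iff, map_div₀, div_le_one₀ (zero_lt_iff.2 hm0),
      ← pow_le_pow_iff_left₀ zero_le' zero_le' S.M_pos.ne', hn3, hm3, pow_le_pow_iff_right₀ hz1]
    constructor
    · intro h k hk
      exact ⟨m, hm1, (hn2 k hk).trans h⟩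
    · intro h
      obtain ⟨k, hk, hk2⟩ := h n hn1
      exact hk2.trans (hm2 k hk)
  ext f
  obtain ⟨g, hg, h, hh, hh0, rfl⟩ := S.frac f
  obtain ⟨a, rfl⟩ := S.exists_lc hg
  obtain ⟨b, rfl⟩ := S.exists_lc hh
  have hb : b ≠ 0 := by rintro rfl; exact hh0 S.lc_zero
  by_cases ha : a = 0
  · rw [ha, lc_zero, zero_div]; exact ⟨fun _ => S.Vinf.zero_mem, fun _ => V.zero_mem⟩
  rw [key hK hz a b ha hb, key S.Vinf_K S.Vinf_z a b ha hb]

theorem residue {f : F} (hf : S.dL f 0) : ∃ k : K, S.dL (f - algebraMap K F k) (-1) := by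
  by_cases h1 : S.dL f (-1)
  · exact ⟨0, by simpa using h1⟩
  obtain ⟨d, hd, hE⟩ := S.not_dL h1
  have : d = 0 := le_antisymm (hE.le hf) (by omega)
  subst this
  obtain ⟨g, hg, h, hh, hh0, rfl⟩ := S.frac f
  obtain ⟨a, rfl⟩ := S.exists_lc hg
  obtain ⟨b, rfl⟩ := S.exists_lc hh
  have hb : b ≠ 0 := by rintro rfl; exact hh0 S.lc_zero
  have ha : a ≠ 0 := by rintro rfl; rw [lc_zero, zero_div] at hE; exact hE.ne_zero rfl
  obtain ⟨m, hm1, hm2, hm3⟩ := S.dE_lc ha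
  obtain ⟨n, hn1, hn2, hn3⟩ := S.dE_lc hb
  have hmn : (S.wt m : ℤ) - S.wt n = 0 := (hm3.div hn3).unique hE
  have hmn' : m = n := S.wt_inj (by omega)
  subst hmn'
  have hbm := Finsupp.mem_support_iff.1 hn1
  refine ⟨a m / b m, ?_⟩
  have h2 : S.lc a / S.lc b - algebraMap K F (a m / b m) = S.lc (a - (a m / b m) • b) / S.lc b := by
    rw [eq_div_iff hh0, sub_mul, div_mul_cancel₀ _ hh0]
    unfold lc
    rw [map_sub, map_smul, Algebra.smul_def]
  rw [h2, div_eq_mul_inv]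
  have h3 : S.dL (S.lc (a - (a m / b m) • b)) (S.wt m - 1) := by
    rw [dL_lc]
    intro k hk
    rw [Finsupp.mem_support_iff] at hk
    have hkm : k ≠ m := by
      rintro rfl
      apply hk
      simp [div_mul_cancel₀ _ hbm]
    have hle : S.wt k ≤ S.wt m := by
      by_cases hak : k ∈ a.support
      · exact hm2 k hak
      · by_cases hbk : k ∈ b.support
        · exact hn2 k hbk
        · exfalso; apply hk
          simp [Finsupp.notMem_support_iff.1 hak, Finsupp.notMem_support_iff.1 hbk]
    have : S.wt k ≠ S.wt m := fun h => hkm (S.wt_inj h)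
    omega
  convert h3.mul hn3.inv.L using 1
  ring

/-- Twice the genus minus one. -/
def G : ℤ := S.M * (S.t - 1) - S.N * S.t + (S.N - 1) * (S.t * (S.q + 1))

theorem gap {f : F} (hf : f ∈ S.A) (h : S.dE f S.G) : False := by
  obtain ⟨⟨⟨i, j, l⟩, hi, hj⟩, hm⟩ := S.dE_A hf h.ne_zero
  have h1 := hm.unique h
  simp only [wt, G, M] at h1 hi hj
  push_cast at h1
  have hNc : IsCoprime (S.N : ℤ) ((S.t * (S.q + 1) : ℕ) : ℤ) := by
    rw [Nat.isCoprime_iff_coprime, N_powp]; exact Nat.Coprime.pow_left _ (S.cop_p_t.mul_right S.cop_p_q1)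
  have hqc : IsCoprime ((S.q ^ 2 : ℕ) : ℤ) (S.t : ℤ) := by
    rw [Nat.isCoprime_iff_coprime, q_powp]; exact Nat.Coprime.pow_left _ (Nat.Coprime.pow_left _ S.cop_p_t)
  have h2 : (S.N : ℤ) ∣ S.N - 1 - i := by
    apply hNc.dvd_of_dvd_mul_right
    refine ⟨j * S.t + l * S.q ^ 2 - S.q ^ 2 * (S.t - 1) + S.t, ?_⟩
    push_cast
    linear_combination - h1
  have h3 : (i : ℤ) = S.N - 1 := by
    have := Int.eq_zero_of_dvd_of_nonneg_of_lt (by omega) (by omega) h2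
    omega
  rw [h3] at h1
  have hN0 : (S.N : ℤ) ≠ 0 := by have := S.N_pos; positivity
  have h4 : (j + 1) * (S.t : ℤ) = S.q ^ 2 * (S.t - 1 - l) := by
    apply mul_left_cancel₀ hN0
    linear_combination h1
  have h5 : ((S.q ^ 2 : ℕ) : ℤ) ∣ j + 1 := by
    apply hqc.dvd_of_dvd_mul_right
    exact ⟨_, by push_cast; exact h4⟩
  have h6 : S.q ^ 2 ∣ j + 1 := by exact_mod_cast h5
  have h7 : j + 1 = S.q ^ 2 := le_antisymm hj (Nat.le_of_dvd (by omega) h6)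
  have h8 : (j : ℤ) + 1 = S.q ^ 2 := by exact_mod_cast h7
  rw [h8] at h4
  have hq0 : ((S.q : ℤ) ^ 2) ≠ 0 := by have := S.two_le_q; positivity
  have := mul_left_cancel₀ hq0 h4
  omega

end deg

section der
variable {p : ℕ} [hp : Fact p.Prime] {K F : Type} [Field K] [Field F] [Algebra K F] [CharP F p] (S : Cv p K F)

theorem Dy : S.D S.y = - (S.t * S.z ^ (S.t - 1)) := by
  have := (der_rel (p := p) S.D S.he S.p_dvd_q S.p_dvd_qb S.hrel).1
  rw [this, S.hDz]; simp
theorem Dx : S.D S.x = algebraMap K F S.c * (S.y ^ S.q * S.D S.y) :=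
  (der_rel (p := p) S.D S.he S.p_dvd_q S.p_dvd_qb S.hrel).2

theorem dE_natCast {n : ℕ} (h : ¬ p ∣ n) : S.dE (n : F) 0 := by
  have : (n : F) = algebraMap K F (n : K) := by simp
  rw [this]
  apply S.dE_const
  intro h0
  rw [h0, map_zero, CharP.cast_eq_zero_iff F p] at this
  exact h this
theorem dE_intCast {n : ℤ} (h : ¬ (p : ℤ) ∣ n) : S.dE (n : F) 0 := by
  have : (n : F) = algebraMap K F (n : K) := by simp
  rw [this]
  apply S.dE_const
  intro h0
  rw [h0, map_zero, CharP.intCast_eq_zero_iff F p] at this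
  exact h this
theorem dL_intCast (n : ℤ) : S.dL (n : F) 0 := by
  have : (n : F) = algebraMap K F (n : K) := by simp
  rw [this]; exact S.dL_const _

theorem dE_Dy : S.dE (S.D S.y) (S.M * (S.t - 1)) := by
  rw [Dy]
  apply dE.neg
  convert (S.dE_natCast S.hpt).mul (S.dE_z.pow (S.t - 1)) using 1
  have := S.t_pos
  push_cast [Nat.cast_sub (show 1 ≤ S.t from this)]
  ring
theorem dE_Dyy : S.dE (S.D S.y / S.y) (S.M * (S.t - 1) - S.N * S.t) := S.dE_Dy.div S.dE_y
theorem dE_Dxx : S.dE (S.D S.x / S.x) S.G := by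
  rw [Dx]
  convert ((S.dE_const S.hc0).mul ((S.dE_y.pow S.q).mul S.dE_Dy)).div S.dE_x using 1
  unfold G; ring
theorem dE_zi : S.dE (S.z⁻¹) (- S.M) := S.dE_z.inv
theorem G_y : (S.M : ℤ) * (S.t - 1) - S.N * S.t ≤ S.G := by
  unfold G
  have := S.N_pos
  have : (0 : ℤ) ≤ (S.N - 1) * (S.t * (S.q + 1)) := mul_nonneg (by omega) (by positivity)
  omega
theorem G_y' (h : S.N ≠ 1) : (S.M : ℤ) * (S.t - 1) - S.N * S.t < S.G := by
  unfold G
  have := S.N_pos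
  have := S.t_pos
  have : (0 : ℤ) < (S.N - 1) * (S.t * (S.q + 1)) := mul_pos (by omega) (by positivity)
  omega
theorem G_z : - (S.M : ℤ) < S.G := by
  refine lt_of_lt_of_le ?_ S.G_y
  have h1 : (0:ℤ) < S.N := by have := S.N_pos; positivity
  have h2 : (0:ℤ) < S.t := by have := S.t_pos; positivity
  have h3 : (1:ℤ) < S.q ^ 2 := by have := S.two_le_q; have := S.q2_gt; exact_mod_cast (by omega)
  unfold M
  push_cast
  have : 0 < (S.N : ℤ) * S.t * (S.q ^ 2 - 1) := mul_pos (mul_pos h1 h2) (by linarith)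
  nlinarith

theorem x0 : S.x ≠ 0 := S.dE_x.ne_zero
theorem y0 : S.y ≠ 0 := S.dE_y.ne_zero
theorem z0 : S.z ≠ 0 := S.dE_z.ne_zero

theorem D_laurent (i j l : ℤ) : S.D (S.x ^ i * S.y ^ j * S.z ^ l) =
    (S.x ^ i * S.y ^ j * S.z ^ l) * (i * (S.D S.x / S.x) + j * (S.D S.y / S.y) + l * S.z⁻¹) := by
  have hx := S.x0
  have hy := S.y0
  have hz := S.z0
  simp only [Derivation.leibniz, Derivation.leibniz_zpow, smul_eq_mul, zsmul_eq_mul, S.hDz]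
  rw [zpow_sub_one₀ hx, zpow_sub_one₀ hy, zpow_sub_one₀ hz]
  field_simp
  ring

theorem dL_log (i j l : ℤ) :
    S.dL (i * (S.D S.x / S.x) + j * (S.D S.y / S.y) + l * S.z⁻¹) S.G := by
  have h1 := (S.dL_intCast i).mul S.dE_Dxx.L
  have h2 := (S.dL_intCast j).mul (S.dE_Dyy.L.mono S.G_y)
  have h3 := (S.dL_intCast l).mul (S.dE_zi.L.mono S.G_z.le)
  rw [zero_add] at h1 h2 h3
  exact (h1.add h2).add h3

theorem dL_D {f : F} {d : ℤ} (hf : S.dL f d) : S.dL (S.D f) (d + S.G) := by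
  have hA : ∀ {f : F} {d : ℤ}, f ∈ S.A → S.dL f d → S.dL (S.D f) (d + S.G) := by
    intro f d hfA hf
    obtain ⟨a, rfl⟩ := S.exists_lc hfA
    rw [dL_lc] at hf
    rw [lc_eq, map_sum]
    refine dL.sum fun m hm => ?_
    rw [Derivation.leibniz, Derivation.map_algebraMap, smul_zero, add_zero, smul_eq_mul]
    apply dL.const_mul
    have h1 : S.mono m = S.x ^ (m.1.1 : ℤ) * S.y ^ (m.1.2.1 : ℤ) * S.z ^ (m.1.2.2 : ℤ) := by
      unfold mono; simp
    rw [h1, D_laurent, ← h1]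
    exact ((S.dE_mono m).L.mono (hf m hm)).mul (S.dL_log _ _ _)
  by_cases hf0 : f = 0
  · rw [hf0, map_zero]; exact S.dL_zero _
  obtain ⟨d', hd'⟩ := S.exists_dE hf0
  have hdd := hd'.le hf
  refine dL.mono ?_ (add_le_add_left hdd _)
  obtain ⟨g, hg, h, hh, hh0, rfl⟩ := S.frac f
  have hg0 : g ≠ 0 := by rintro rfl; simp at hf0
  obtain ⟨m, hm⟩ := S.dE_A hg hg0
  obtain ⟨n, hn⟩ := S.dE_A hh hh0
  have he := (hm.div hn).unique hd'
  rw [Derivation.leibniz_div, smul_eq_mul, smul_eq_mul, smul_eq_mul]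
  have e1 := hn.L.mul (hA hg hm.L)
  have e2 := hm.L.mul (hA hh hn.L)
  have e3 := e1.sub (e2.mono (le_of_eq (by ring) : _ ≤ (S.wt n : ℤ) + (S.wt m + S.G)))
  exact ((hn.inv.pow 2).L.mul e3).mono (le_of_eq (by push_cast; linear_combination he))

theorem exists_tau : ∃ τ : F, S.dE τ (-1) ∧ S.dE (S.D τ) (S.G - 1) ∧ ∃ i j l : ℤ,
    τ = S.x ^ i * S.y ^ j * S.z ^ l := by
  have hNc : IsCoprime (S.N : ℤ) ((S.t * (S.q + 1) : ℕ) : ℤ) := by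
    rw [Nat.isCoprime_iff_coprime, N_powp]; exact Nat.Coprime.pow_left _ (S.cop_p_t.mul_right S.cop_p_q1)
  have hqc : IsCoprime ((S.q ^ 2 : ℕ) : ℤ) (S.t : ℤ) := by
    rw [Nat.isCoprime_iff_coprime, q_powp]; exact Nat.Coprime.pow_left _ (Nat.Coprime.pow_left _ S.cop_p_t)
  obtain ⟨A, B, hAB⟩ := hqc
  have hpp : ¬ (p : ℤ) ∣ -1 := by
    intro h
    have := (Int.dvd_neg).1 h
    have h2 : p ∣ 1 := by exact_mod_cast this
    exact hp.out.one_lt.ne' (Nat.dvd_one.1 h2)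
  have hdeg : ∀ i j l : ℤ, S.dE (S.x ^ i * S.y ^ j * S.z ^ l)
      (i * (S.t * (S.q + 1)) + j * (S.N * S.t) + l * S.M) := fun i j l =>
    ((S.dE_x.zpow i).mul (S.dE_y.zpow j)).mul (S.dE_z.zpow l)
  by_cases hN : S.N = 1
  · refine ⟨S.x ^ (0:ℤ) * S.y ^ (-B) * S.z ^ (-A), ?_, ?_, _, _, _, rfl⟩
    · convert hdeg 0 (-B) (-A) using 1
      unfold M; rw [hN]; push_cast at hAB ⊢; linear_combination hAB
    · rw [D_laurent]
      have h1 : S.dE (S.x ^ (0:ℤ) * S.y ^ (-B) * S.z ^ (-A)) (-1) := by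
        convert hdeg 0 (-B) (-A) using 1
        unfold M; rw [hN]; push_cast at hAB ⊢; linear_combination hAB
      have hB : ¬ (p : ℤ) ∣ -B := by
        intro h
        have h2 : (p : ℤ) ∣ ((S.q ^ 2 : ℕ) : ℤ) := by exact_mod_cast dvd_pow S.p_dvd_q two_ne_zero
        have h3 : (p:ℤ) ∣ -1 := by
          rw [← hAB]
          exact (dvd_neg).2 (dvd_add (h2.mul_left _) (((dvd_neg).1 h).mul_right _))
        exact hpp h3
      have h2 := (S.dE_intCast hB).mul S.dE_Dyy
      have h3 : S.G = 0 + (S.M * (S.t - 1) - S.N * S.t) := by unfold G; rw [hN]; push_cast; ring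
      rw [← h3] at h2
      have h4 := (S.dL_intCast (-A)).mul S.dE_zi.L
      have h5 := h1.mul (h2.add h4 (by have := S.G_z; omega))
      rw [show -1 + S.G = S.G - 1 by ring] at h5
      convert h5 using 2
      simp
  · obtain ⟨u, w, huw⟩ := hNc
    refine ⟨S.x ^ (-w) * S.y ^ (-(u * B)) * S.z ^ (-(u * A)), ?_, ?_, _, _, _, rfl⟩
    · convert hdeg (-w) (-(u * B)) (-(u * A)) using 1
      unfold M; push_cast at hAB huw ⊢; linear_combination huw + u * S.N * hAB
    · rw [D_laurent]
      have h1 : S.dE (S.x ^ (-w) * S.y ^ (-(u * B)) * S.z ^ (-(u * A))) (-1) := by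
        convert hdeg (-w) (-(u * B)) (-(u * A)) using 1
        unfold M; push_cast at hAB huw ⊢; linear_combination huw + u * S.N * hAB
      have hB : ¬ (p : ℤ) ∣ -w := by
        intro h
        have h2 : (p : ℤ) ∣ (S.N : ℤ) := by exact_mod_cast S.p_dvd_N hN
        have h3 : (p:ℤ) ∣ -1 := by
          rw [← huw]
          exact (dvd_neg).2 (dvd_add (h2.mul_left _) (((dvd_neg).1 h).mul_right _))
        exact hpp h3
      have h2 := (S.dE_intCast hB).mul S.dE_Dxx
      rw [zero_add] at h2
      have h3 := (S.dL_intCast (-(u * B))).mul S.dE_Dyy.L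
      have h4 := (S.dL_intCast (-(u * A))).mul S.dE_zi.L
      have h5 := h1.mul ((h2.add h3 (by have := S.G_y' hN; omega)).add h4 (by have := S.G_z; omega))
      rw [show -1 + S.G = S.G - 1 by ring] at h5
      exact h5

end der
end Cv
end

set_option linter.all false
noncomputable section
namespace Cv
section places
variable {p : ℕ} [hp : Fact p.Prime] {K F : Type} [Field K] [Field F] [Algebra K F] (S : Cv p K F)

theorem alg_ind {P : F → Prop} (hK : ∀ k : K, P (algebraMap K F k)) (hx : P S.x) (hy : P S.y) (hz : P S.z)
    (ha : ∀ f g, P f → P g → P (f + g)) (hm : ∀ f g, P f → P g → P (f * g)) {f : F} (hf : f ∈ S.A) : P f := by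
  unfold A at hf
  induction hf using Algebra.adjoin_induction with
  | mem f h =>
    simp only [Set.mem_insert_iff, Set.mem_singleton_iff] at h
    rcases h with rfl | rfl | rfl
    · exact hx
    · exact hy
    · exact hz
  | algebraMap k => exact hK k
  | add f g _ _ h1 h2 => exact ha _ _ h1 h2
  | mul f g _ _ h1 h2 => exact hm _ _ h1 h2

/-- affine valuation rings -/
structure Aff (B : ValuationSubring F) : Prop where
  hK : ∀ k : K, algebraMap K F k ∈ B
  hz : S.z ∈ B

theorem mem_of_monic {B : ValuationSubring F} {f v : F} (hv : v ∈ B) (P : Polynomial B) (hP : P.Monic)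
    (h : P.eval₂ (algebraMap B F) f = 0) : f ∈ B := by
  have : IsIntegral B f := ⟨P, hP, h⟩
  rw [IsIntegrallyClosed.isIntegral_iff] at this
  obtain ⟨y, rfl⟩ := this
  exact y.2

variable {S}
theorem Aff.hy {B} (h : S.Aff B) : S.y ∈ B := by
  refine mem_of_monic h.hz (Polynomial.X ^ (S.q ^ 2) - (Polynomial.X + Polynomial.C ((⟨S.z, h.hz⟩ : B) ^ S.t))) ?_ ?_
  · apply Polynomial.monic_X_pow_sub
    rw [Polynomial.degree_X_add_C]
    have := S.q2_gt; have := S.two_le_q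
    exact_mod_cast (by omega : 1 < S.q ^ 2)
  · simp only [Polynomial.eval₂_sub, Polynomial.eval₂_add, Polynomial.eval₂_pow, Polynomial.eval₂_X, Polynomial.eval₂_C, map_pow]
    show S.y ^ S.q ^ 2 - (S.y + S.z ^ S.t) = 0
    rw [S.hzt]; ring
theorem Aff.hx {B} (h : S.Aff B) : S.x ∈ B := by
  have hv : algebraMap K F S.c * S.y ^ (S.q + 1) ∈ B := B.mul_mem _ _ (h.hK _) (pow_mem h.hy _)
  refine mem_of_monic h.hz _ (TrP_monic S.qb S.e S.two_le_qb S.he (⟨_, hv⟩ : B)).1 ?_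
  simp only [Polynomial.eval₂_sub, Polynomial.eval₂_finset_sum, Polynomial.eval₂_pow, Polynomial.eval₂_X, Polynomial.eval₂_C, map_pow]
  show ∑ i ∈ Finset.range S.e, S.x ^ S.qb ^ i - algebraMap K F S.c * S.y ^ (S.q + 1) = 0
  rw [S.htr']; ring
theorem Aff.A {B} (h : S.Aff B) {f : F} (hf : f ∈ S.A) : f ∈ B :=
  S.alg_ind h.hK h.hx h.hy h.hz (fun _ _ => B.add_mem _ _) (fun _ _ => B.mul_mem _ _) hf
variable (S)
theorem mem_A {f : F} (h : ∀ B, S.Aff B → f ∈ B) : f ∈ S.A := S.hIntg f fun B h1 h2 => h B ⟨h1, h2⟩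

theorem aff_or {V : ValuationSubring F} (hK : ∀ k : K, algebraMap K F k ∈ V) : S.Aff V ∨ V = S.Vinf := by
  by_cases hz : S.z ∈ V
  · exact .inl ⟨hK, hz⟩
  · exact .inr (S.eq_Vinf hK hz)

variable [CharP F p]

theorem der_unique (E : Derivation K F F) (f : F) : E f = E S.z * S.D f := by
  let E' : Derivation K F F := E - E S.z • S.D
  have hE : ∀ f, E' f = E f - E S.z * S.D f := fun f => by simp [E']
  have hz : E' S.z = 0 := by rw [hE, S.hDz]; ring
  have h1 := der_rel (p := p) E' S.he S.p_dvd_q S.p_dvd_qb S.hrel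
  have hy : E' S.y = 0 := by rw [h1.1, hz]; simp
  have hx : E' S.x = 0 := by rw [h1.2, hy]; simp
  have hA : ∀ g ∈ S.A, E' g = 0 := fun g hg => by
    refine S.alg_ind (P := fun g => E' g = 0) ?_ hx hy hz ?_ ?_ hg
    · intro k; exact E'.map_algebraMap k
    · intro f g hf hg; rw [map_add, hf, hg, add_zero]
    · intro f g hf hg; rw [Derivation.leibniz, hf, hg]; simp
  have : E' f = 0 := by
    obtain ⟨g, hg, h, hh, hh0, rfl⟩ := S.frac f
    rw [Derivation.leibniz_div, hA g hg, hA h hh]; simp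
  rw [hE] at this
  exact sub_eq_zero.1 this

/-- pullback derivation -/
def pullD (σ : F ≃ₐ[K] F) : Derivation K F F :=
  Derivation.mk' (σ.symm.toLinearMap ∘ₗ S.D.toLinearMap ∘ₗ σ.toLinearMap) (fun a b => by simp)

theorem D_sig (σ : F ≃ₐ[K] F) (f : F) : S.D (σ f) = S.D (σ S.z) * σ (S.D f) := by
  have h := S.der_unique (S.pullD σ) f
  have h2 : ∀ g, S.pullD σ g = σ.symm (S.D (σ g)) := fun g => rfl
  rw [h2, h2] at h
  have := congrArg σ h
  simpa using this

theorem u_inv (σ : F ≃ₐ[K] F) : S.D (σ S.z) * σ (S.D (σ.symm S.z)) = 1 := by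
  rw [← D_sig]; simp [S.hDz]
theorem u_ne (σ : F ≃ₐ[K] F) : S.D (σ S.z) ≠ 0 := fun h => by
  have := S.u_inv σ; rw [h] at this; simp at this

theorem D_A {f : F} (hf : f ∈ S.A) : S.D f ∈ S.A := by
  have hy : S.D S.y ∈ S.A := by
    rw [S.Dy]; exact S.A.neg_mem (S.A.mul_mem (natCast_mem S.A _) (S.A.pow_mem S.z_mem _))
  refine (S.alg_ind (P := fun g => g ∈ S.A ∧ S.D g ∈ S.A) ?_ ⟨S.x_mem, ?_⟩ ⟨S.y_mem, hy⟩ ⟨S.z_mem, ?_⟩ ?_ ?_ hf).2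
  · intro k; rw [Derivation.map_algebraMap]; exact ⟨S.A.algebraMap_mem k, S.A.zero_mem⟩
  · rw [S.Dx]; exact S.A.mul_mem (S.A.algebraMap_mem _) (S.A.mul_mem (S.A.pow_mem S.y_mem _) hy)
  · rw [S.hDz]; exact S.A.one_mem
  · rintro f g ⟨h1, h2⟩ ⟨h3, h4⟩; rw [map_add]; exact ⟨S.A.add_mem h1 h3, S.A.add_mem h2 h4⟩
  · rintro f g ⟨h1, h2⟩ ⟨h3, h4⟩; rw [Derivation.leibniz]
    exact ⟨S.A.mul_mem h1 h3, S.A.add_mem (S.A.mul_mem h1 h4) (S.A.mul_mem h3 h2)⟩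

theorem D_B {B} (hB : S.Aff B) {f : F} (hf : f ∈ B) : S.D f ∈ B := by
  obtain ⟨g, hg, h, hh, hi, h0, rfl⟩ := S.hval B hB.hK hB.hz f hf
  have : S.D (g / h) = h⁻¹ * h⁻¹ * (h * S.D g - g * S.D h) := by
    rw [Derivation.leibniz_div]; simp only [smul_eq_mul]; field_simp
  rw [this]
  have e1 := hB.A hg
  have e2 := hB.A hh
  exact B.mul_mem _ _ (B.mul_mem _ _ hi hi) (B.sub_mem (B.mul_mem _ _ e2 (hB.A (S.D_A hg))) (B.mul_mem _ _ e1 (hB.A (S.D_A hh))))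

/-- local parameter at infinity -/
def tau : F := Classical.choose S.exists_tau
theorem tau_dE : S.dE S.tau (-1) := (Classical.choose_spec S.exists_tau).1
theorem tau_D : S.dE (S.D S.tau) (S.G - 1) := (Classical.choose_spec S.exists_tau).2.1
theorem tau_mono : ∃ i j l : ℤ, S.tau = S.x ^ i * S.y ^ j * S.z ^ l := (Classical.choose_spec S.exists_tau).2.2

def kap : F := S.tau ^ (S.G - 1)
theorem kap_dE : S.dE S.kap (-(S.G - 1)) := by
  have := S.tau_dE.zpow (S.G - 1); unfold kap; convert this using 1; ring

theorem dL_D0 {f : F} (hf : S.dL f 0) : S.dL (S.D f) (S.G - 1) := by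
  obtain ⟨k, hk⟩ := S.residue hf
  have := S.dL_D hk
  rw [map_sub, Derivation.map_algebraMap, sub_zero] at this
  exact this.mono (by omega)

/-- standard places with their differential normaliser -/
def Std (P : ValuationSubring F) (κ : F) : Prop := (S.Aff P ∧ κ = 1) ∨ (P = S.Vinf ∧ κ = S.kap)

theorem exists_std {V : ValuationSubring F} (hK : ∀ k : K, algebraMap K F k ∈ V) : ∃ κ, S.Std V κ := by
  rcases S.aff_or hK with h | h
  · exact ⟨1, .inl ⟨h, rfl⟩⟩
  · exact ⟨S.kap, .inr ⟨h, rfl⟩⟩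

variable {S}
theorem Std.hK {P : ValuationSubring F} {κ : F} (h : S.Std P κ) (k : K) : algebraMap K F k ∈ P := by
  rcases h with ⟨h, -⟩ | ⟨rfl, -⟩
  · exact h.hK k
  · exact S.Vinf_K k
theorem Std.D {P : ValuationSubring F} {κ : F} (h : S.Std P κ) {f : F} (hf : f ∈ P) : κ * S.D f ∈ P := by
  rcases h with ⟨h, rfl⟩ | ⟨rfl, rfl⟩
  · rw [one_mul]; exact S.D_B h hf
  · rw [S.mem_Vinf] at *
    convert S.kap_dE.L.mul (S.dL_D0 hf) using 1; ring
theorem Std.unif {P : ValuationSubring F} {κ : F} (h : S.Std P κ) :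
    ∃ τ ∈ P, κ * S.D τ ≠ 0 ∧ (κ * S.D τ)⁻¹ ∈ P := by
  rcases h with ⟨h, rfl⟩ | ⟨rfl, rfl⟩
  · exact ⟨S.z, h.hz, by simp [S.hDz], by simp [S.hDz, P.one_mem]⟩
  · have := S.kap_dE.mul S.tau_D
    refine ⟨S.tau, ?_, this.ne_zero, ?_⟩
    · rw [S.mem_Vinf]; exact S.tau_dE.L.mono (by omega)
    · rw [S.mem_Vinf]; convert this.inv.L using 1; ring
variable (S)

theorem ratio_mem (σ : F ≃ₐ[K] F) {P Q : ValuationSubring F} (hPQ : ∀ f, f ∈ Q ↔ σ f ∈ P) {κ κ' : F}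
    (hP : S.Std P κ) (hQ : S.Std Q κ') : κ * S.D (σ S.z) / σ κ' ∈ P := by
  obtain ⟨τ, hτ, h0, hi⟩ := hQ.unif
  have h1 := hP.D ((hPQ τ).1 hτ)
  rw [D_sig] at h1
  have h2 := (hPQ _).1 hi
  have h3 := P.mul_mem _ _ h1 h2
  convert h3 using 1
  have hk : κ' ≠ 0 := left_ne_zero_of_mul h0
  have hd : S.D τ ≠ 0 := right_ne_zero_of_mul h0
  have hk' : σ κ' ≠ 0 := by simpa using hk
  have hd' : σ (S.D τ) ≠ 0 := by simpa using hd
  rw [map_inv₀, map_mul]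
  field_simp

/-- the finite dimensional space of regular differentials -/
def V : Submodule K F where
  carrier := {f | f ∈ S.A ∧ S.dL f (S.G - 1)}
  add_mem' h1 h2 := ⟨S.A.add_mem h1.1 h2.1, h1.2.add h2.2⟩
  zero_mem' := ⟨S.A.zero_mem, S.dL_zero _⟩
  smul_mem' k f h := by
    refine ⟨S.A.smul_mem h.1 k, ?_⟩
    rw [Algebra.smul_def]; exact h.2.const_mul k

theorem mem_V {f : F} : f ∈ S.V ↔ f ∈ S.A ∧ S.dL f (S.G - 1) := Iff.rfl

theorem V_iff {f : F} : f ∈ S.V ↔ ∀ P κ, S.Std P κ → κ * f ∈ P := by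
  rw [mem_V]
  constructor
  · rintro ⟨h1, h2⟩ P κ (⟨h, rfl⟩ | ⟨rfl, rfl⟩)
    · rw [one_mul]; exact h.A h1
    · rw [S.mem_Vinf]; convert S.kap_dE.L.mul h2 using 1; ring
  · intro h
    constructor
    · apply S.mem_A
      intro B hB
      simpa using h B 1 (.inl ⟨hB, rfl⟩)
    · have := h _ _ (.inr ⟨rfl, rfl⟩)
      rw [S.mem_Vinf] at this
      have h2 := S.kap_dE.inv.L.mul this
      rw [inv_mul_cancel_left₀ S.kap_dE.ne_zero] at h2
      exact h2.mono (by omega)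

theorem V_sig (σ : F ≃ₐ[K] F) {f : F} (hf : f ∈ S.V) : S.D (σ S.z) * σ f ∈ S.V := by
  rw [V_iff] at *
  intro P κ hP
  let Q : ValuationSubring F := P.comap (σ : F →+* F)
  have hPQ : ∀ f, f ∈ Q ↔ σ f ∈ P := fun f => Iff.rfl
  have hQK : ∀ k : K, algebraMap K F k ∈ Q := fun k => by rw [hPQ]; simpa using hP.hK k
  obtain ⟨κ', hQ⟩ := S.exists_std hQK
  have h1 := S.ratio_mem σ hPQ hP hQ
  have h2 := (hPQ _).1 (hf Q κ' hQ)
  have h3 := P.mul_mem _ _ h1 h2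
  convert h3 using 1
  obtain ⟨τ, hτ, h0, hi⟩ := hQ.unif
  have hk : κ' ≠ 0 := left_ne_zero_of_mul h0
  have hk' : σ κ' ≠ 0 := by simpa using hk
  rw [map_mul]
  field_simp

end places
end Cv
end

set_option linter.all false
noncomputable section
namespace Cv
section cartier
variable {p : ℕ} [hp : Fact p.Prime] {K F : Type} [Field K] [IsAlgClosed K] [Field F] [Algebra K F] (S : Cv p K F)
variable [CharP F p]

theorem cK {F K : Type} {p : ℕ} [Field K] [Field F] [Algebra K F] [CharP F p] : CharP K p :=
  (RingHom.charP_iff (algebraMap K F) (algebraMap K F).injective p).2 inferInstance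

/-- p-th power times power of z -/
def pzM : Submonoid F where
  carrier := {f | ∃ g : F, ∃ i : ℕ, f = g ^ p * S.z ^ i}
  one_mem' := ⟨1, 0, by simp⟩
  mul_mem' := by
    rintro _ _ ⟨g, i, rfl⟩ ⟨h, j, rfl⟩
    exact ⟨g * h, i + j, by ring⟩

def pzR : Subsemiring F := S.pzM.subsemiringClosure

theorem pzR_pz (g : F) (i : ℕ) : g ^ p * S.z ^ i ∈ S.pzR := by
  unfold pzR
  rw [Submonoid.subsemiringClosure_eq_closure]
  exact Subsemiring.subset_closure ⟨g, i, rfl⟩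
theorem pzR_p (g : F) : g ^ p ∈ S.pzR := by simpa using S.pzR_pz g 0
theorem pzR_pn (g : F) {n : ℕ} (h : p ∣ n) : g ^ n ∈ S.pzR := by
  obtain ⟨k, rfl⟩ := h
  rw [mul_comm, pow_mul]; exact S.pzR_p _
theorem pzR_neg {f : F} (hf : f ∈ S.pzR) : - f ∈ S.pzR := by
  have : - f = (-1) ^ p * f := by
    have := map_neg (frobenius F p) (1 : F)
    rw [frobenius_def, frobenius_def] at this
    rw [this]; simp
  rw [this]; exact S.pzR.mul_mem (S.pzR_p _) hf

theorem pzR_top (f : F) : f ∈ S.pzR := by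
  have hK : ∀ k : K, algebraMap K F k ∈ S.pzR := by
    intro k
    obtain ⟨l, rfl⟩ := IsAlgClosed.exists_pow_nat_eq k hp.out.pos
    rw [map_pow]; exact S.pzR_p _
  have hz : S.z ∈ S.pzR := by simpa using S.pzR_pz 1 1
  have hy : S.y ∈ S.pzR := by
    have : S.y = S.y ^ (S.q ^ 2) + - S.z ^ S.t := by rw [S.hzt]; ring
    rw [this]
    exact S.pzR.add_mem (S.pzR_pn _ (dvd_pow S.p_dvd_q two_ne_zero)) (S.pzR_neg (S.pzR.pow_mem hz _))
  have hx : S.x ∈ S.pzR := by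
    have h := S.htr'
    obtain ⟨k, hk⟩ : ∃ k, S.e = k + 1 := ⟨S.e - 1, by have := S.he; omega⟩
    rw [hk, Finset.sum_range_succ'] at h
    have : S.x = algebraMap K F S.c * S.y ^ (S.q + 1) + - ∑ i ∈ Finset.range k, S.x ^ S.qb ^ (i + 1) := by
      rw [← h]; simp
    rw [this]
    refine S.pzR.add_mem (S.pzR.mul_mem (hK _) (S.pzR.pow_mem hy _)) (S.pzR_neg (S.pzR.sum_mem fun i _ => ?_))
    exact S.pzR_pn _ (dvd_pow S.p_dvd_qb (by omega))
  have hA : ∀ f ∈ S.A, f ∈ S.pzR := fun f hf =>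
    S.alg_ind hK hx hy hz (fun _ _ => S.pzR.add_mem) (fun _ _ => S.pzR.mul_mem) hf
  obtain ⟨g, hg, h, hh, h0, rfl⟩ := S.frac f
  have : g / h = (h⁻¹) ^ p * (g * h ^ (p - 1)) := by
    have : h ^ p = h ^ (p - 1) * h := by rw [← pow_succ]; congr 1; have := hp.out.pos; omega
    rw [inv_pow, this]; field_simp
  rw [this]
  exact S.pzR.mul_mem (S.pzR_p _) (S.pzR.mul_mem (hA g hg) (S.pzR.pow_mem (hA h hh) _))

theorem pz_ind {P : F → Prop} (hz : ∀ g i, i < p → P (g ^ p * S.z ^ i)) (ha : ∀ a b, P a → P b → P (a + b)) (f : F) : P f := by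
  have hf := S.pzR_top f
  have : f ∈ AddSubmonoid.closure (S.pzM : Set F) := hf
  have h0 : P 0 := by have := hz 0 0 hp.out.pos; simpa [hp.out.ne_zero] using this
  induction this using AddSubmonoid.closure_induction with
  | mem f h =>
    obtain ⟨g, i, rfl⟩ := h
    have : g ^ p * S.z ^ i = (g * S.z ^ (i / p)) ^ p * S.z ^ (i % p) := by
      conv_lhs => rw [← Nat.div_add_mod i p]
      rw [pow_add, mul_pow, ← pow_mul, mul_comm (i / p) p]; ring
    rw [this]
    exact hz _ _ (Nat.mod_lt _ hp.out.pos)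
  | zero => exact h0
  | add a b _ _ h1 h2 => exact ha a b (h1 (S.pzR_top _)) (h2 (S.pzR_top _))

theorem D_pmul (g f : F) : S.D (g ^ p * f) = g ^ p * S.D f := by
  rw [Derivation.leibniz, der_pow_zero (p := p) S.D g dvd_rfl]; simp
theorem Di_pmul (k : ℕ) (g f : F) : S.D^[k] (g ^ p * f) = g ^ p * S.D^[k] f := by
  induction k generalizing f with
  | zero => rfl
  | succ k ih => rw [Function.iterate_succ_apply, Function.iterate_succ_apply, D_pmul, ih]
theorem Di_add (k : ℕ) (g f : F) : S.D^[k] (g + f) = S.D^[k] g + S.D^[k] f := iterate_map_add _ _ _ _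
theorem Di_z (k i : ℕ) : S.D^[k] (S.z ^ i) = (i.descFactorial k : F) * S.z ^ (i - k) := by
  induction k with
  | zero => simp
  | succ k ih =>
    rw [Function.iterate_succ_apply', ih, Nat.descFactorial_succ, Derivation.leibniz, Derivation.map_natCast, Derivation.leibniz_pow, S.hDz]
    simp only [smul_eq_mul, nsmul_eq_mul, mul_one, mul_zero, add_zero, Nat.cast_mul]
    rw [Nat.sub_sub]; ring

theorem Dp (f : F) : S.D (S.D^[p - 1] f) = 0 := by
  rw [← Function.iterate_succ_apply' S.D, show (p - 1).succ = p from by have := hp.out.pos; omega]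
  refine S.pz_ind (P := fun f => S.D^[p] f = 0) ?_ ?_ f
  · intro g i hi
    rw [Di_pmul, Di_z, Nat.descFactorial_of_lt hi]; simp
  · intro a b ha hb; rw [Di_add, ha, hb, add_zero]

theorem wilson : ((p - 1).factorial : F) = -1 := by
  have := ZMod.wilsons_lemma p
  have h := congrArg (ZMod.castHom (dvd_refl p) F) this
  rw [map_natCast, map_neg, map_one] at h
  exact h

theorem rep (f : F) : ∃ w g, f = w ^ p * S.z ^ (p - 1) + S.D g := by
  refine S.pz_ind (P := fun f => ∃ w g, f = w ^ p * S.z ^ (p - 1) + S.D g) ?_ ?_ f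
  · intro g i hi
    by_cases h : i = p - 1
    · exact ⟨g, 0, by rw [h]; simp⟩
    · refine ⟨0, g ^ p * (S.z ^ (i + 1) * algebraMap K F ((i + 1 : ℕ) : K)⁻¹), ?_⟩
      have hne : ((i + 1 : ℕ) : F) ≠ 0 := by
        rw [Ne, CharP.cast_eq_zero_iff F p]
        intro hd; have := Nat.le_of_dvd (by omega) hd; omega
      rw [D_pmul, Derivation.leibniz, Derivation.map_algebraMap, Derivation.leibniz_pow, S.hDz, zero_pow hp.out.ne_zero]
      simp only [smul_eq_mul, nsmul_eq_mul, mul_one, mul_zero, zero_mul, zero_add, map_inv₀, map_natCast]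
      rw [show i + 1 - 1 = i from rfl]
      field_simp
  · rintro a b ⟨w, g, rfl⟩ ⟨w', g', rfl⟩
    exact ⟨w + w', g + g', by rw [add_pow_char, map_add]; ring⟩

theorem Di_rep (w g : F) : S.D^[p - 1] (w ^ p * S.z ^ (p - 1) + S.D g) = - w ^ p := by
  rw [Di_add, Di_pmul, Di_z, Nat.descFactorial_self, wilson (p := p), ← Function.iterate_succ_apply S.D, Function.iterate_succ_apply', Dp]
  simp

theorem exists_Ca (f : F) : ∃ w, S.D^[p - 1] f = - w ^ p := by
  obtain ⟨w, g, rfl⟩ := S.rep f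
  exact ⟨w, S.Di_rep w g⟩

/-- Cartier operator -/
def Ca (f : F) : F := Classical.choose (S.exists_Ca f)
theorem Ca_spec (f : F) : S.D^[p - 1] f = - (S.Ca f) ^ p := Classical.choose_spec (S.exists_Ca f)
theorem Ca_uniq {f w : F} (h : S.D^[p - 1] f = - w ^ p) : S.Ca f = w := by
  rw [Ca_spec, neg_inj] at h
  exact frobenius_inj F p h
theorem Ca_rep (w g : F) : S.Ca (w ^ p * S.z ^ (p - 1) + S.D g) = w := S.Ca_uniq (S.Di_rep w g)
theorem Ca_add (f g : F) : S.Ca (f + g) = S.Ca f + S.Ca g := by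
  apply Ca_uniq; rw [Di_add, Ca_spec, Ca_spec, add_pow_char]; ring
theorem Ca_pmul (g f : F) : S.Ca (g ^ p * f) = g * S.Ca f := by
  apply Ca_uniq; rw [Di_pmul, Ca_spec, mul_pow]; ring
theorem Ca_D (f : F) : S.Ca (S.D f) = 0 := by
  have := S.Ca_rep 0 f; simpa [hp.out.ne_zero] using this
theorem Ca_zero : S.Ca 0 = 0 := by have := S.Ca_D 0; simpa using this

theorem Ca_log_add {a b : F} (ha : S.Ca (a ^ (p - 1) * S.D a) = S.D a) (hb : S.Ca (b ^ (p - 1) * S.D b) = S.D b) :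
    S.Ca ((a + b) ^ (p - 1) * S.D (a + b)) = S.D (a + b) := by
  have hp1 := hp.out.one_lt
  obtain ⟨r, hr⟩ : ∃ r, p = r + 1 := ⟨p - 1, by omega⟩
  have hr1 : p - 1 = r := by omega
  have key : (a + b) ^ (p - 1) * S.D (a + b) = a ^ (p - 1) * S.D a + b ^ (p - 1) * S.D b +
      S.D (∑ k ∈ Finset.range r, ((p.choose (k + 1) / p : ℕ) : F) * (a ^ (k + 1) * b ^ (r - k))) := by
    rw [map_sum]
    have hterm : ∀ k ∈ Finset.range r, S.D (((p.choose (k + 1) / p : ℕ) : F) * (a ^ (k + 1) * b ^ (r - k))) =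
        (r.choose k : F) * (a ^ k * b ^ (r - k)) * S.D a + (r.choose (k + 1) : F) * (a ^ (k + 1) * b ^ (r - (k + 1))) * S.D b := by
      intro k hk
      rw [Finset.mem_range] at hk
      have hd : p ∣ p.choose (k + 1) := hp.out.dvd_choose_self (by omega) (by omega)
      have e1 : p.choose (k + 1) / p * (k + 1) = r.choose k := by
        have h := Nat.add_one_mul_choose_eq r k
        rw [← hr] at h
        apply Nat.eq_of_mul_eq_mul_left hp.out.pos
        rw [h, ← mul_assoc, Nat.mul_div_cancel' hd]
      have e2 : p.choose (k + 1) / p * (r - k) = r.choose (k + 1) := by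
        have h := Nat.choose_mul_succ_eq r (k + 1)
        rw [← hr] at h
        apply Nat.eq_of_mul_eq_mul_left hp.out.pos
        rw [← mul_assoc, Nat.mul_div_cancel' hd, show r - k = p - (k + 1) from by omega, ← h, mul_comm]
      rw [← e1, ← e2, Derivation.leibniz, Derivation.map_natCast, Derivation.leibniz, Derivation.leibniz_pow, Derivation.leibniz_pow]
      simp only [smul_eq_mul, nsmul_eq_mul, mul_zero, add_zero, Nat.cast_mul]
      rw [show k + 1 - 1 = k from rfl, show r - k - 1 = r - (k + 1) from by omega]
      ring
    rw [Finset.sum_congr rfl hterm, Finset.sum_add_distrib, ← Finset.sum_mul, ← Finset.sum_mul, hr1, map_add]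
    have f1 : (a + b) ^ r = ∑ k ∈ Finset.range r, (r.choose k : F) * (a ^ k * b ^ (r - k)) + a ^ r := by
      rw [add_pow, Finset.sum_range_succ]
      congr 1
      · exact Finset.sum_congr rfl fun k _ => by ring
      · simp
    have f2 : (a + b) ^ r = ∑ k ∈ Finset.range r, (r.choose (k + 1) : F) * (a ^ (k + 1) * b ^ (r - (k + 1))) + b ^ r := by
      rw [add_pow, Finset.sum_range_succ']
      congr 1
      · exact Finset.sum_congr rfl fun k _ => by ring
      · simp
    rw [mul_add]
    conv_lhs => rw [f1]
    conv_lhs => arg 2; rw [← f1, f2]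
    ring
  rw [key, Ca_add, Ca_add, Ca_D, ha, hb, map_add, add_zero]

theorem Ca_log_mul {a b : F} (ha : S.Ca (a ^ (p - 1) * S.D a) = S.D a) (hb : S.Ca (b ^ (p - 1) * S.D b) = S.D b) :
    S.Ca ((a * b) ^ (p - 1) * S.D (a * b)) = S.D (a * b) := by
  have h1 : ∀ a : F, a ^ p = a ^ (p - 1) * a := fun a => by
    rw [← pow_succ]; congr 1; have := hp.out.pos; omega
  have : (a * b) ^ (p - 1) * S.D (a * b) = a ^ p * (b ^ (p - 1) * S.D b) + b ^ p * (a ^ (p - 1) * S.D a) := by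
    rw [Derivation.leibniz, h1, h1, mul_pow]; simp only [smul_eq_mul]; ring
  rw [this, Ca_add, Ca_pmul, Ca_pmul, ha, hb, Derivation.leibniz]; simp

theorem Ca_log (w : F) : S.Ca (w ^ (p - 1) * S.D w) = S.D w := by
  have hp1 := hp.out.one_lt
  refine S.pz_ind (P := fun w => S.Ca (w ^ (p - 1) * S.D w) = S.D w) ?_ (fun a b => S.Ca_log_add) w
  intro g i _
  apply S.Ca_log_mul
  · rw [der_pow_zero (p := p) S.D g dvd_rfl, mul_zero, Ca_zero]
  · induction i with
    | zero => simp [Ca_zero]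
    | succ i ih =>
      rw [pow_succ]; apply S.Ca_log_mul
      · exact ih (by omega)
      · rw [S.hDz, mul_one]
        have := S.Ca_rep 1 0
        simpa using this

theorem Ca_sig (σ : F ≃ₐ[K] F) (f : F) : S.Ca (S.D (σ S.z) * σ f) = S.D (σ S.z) * σ (S.Ca f) := by
  obtain ⟨w, g, rfl⟩ := S.rep f
  rw [Ca_rep]
  have : S.D (σ S.z) * σ (w ^ p * S.z ^ (p - 1) + S.D g) =
      (σ w) ^ p * ((σ S.z) ^ (p - 1) * S.D (σ S.z)) + S.D (σ g) := by
    rw [S.D_sig σ g]; simp only [map_add, map_mul, map_pow]; ring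
  rw [this, Ca_add, Ca_D, Ca_pmul, Ca_log]; ring

theorem mem_of_pow {B : ValuationSubring F} {f : F} {n : ℕ} (hn : n ≠ 0) (h : f ^ n ∈ B) : f ∈ B := by
  rw [← ValuationSubring.valuation_le_one_iff, map_pow, pow_le_one_iff_of_nonneg zero_le' hn] at h
  exact (B.valuation_le_one_iff _).1 h

theorem Ca_B {B} (hB : S.Aff B) {f : F} (hf : f ∈ B) : S.Ca f ∈ B := by
  have : ∀ k, S.D^[k] f ∈ B := fun k => by
    induction k with
    | zero => exact hf
    | succ k ih => rw [Function.iterate_succ_apply']; exact S.D_B hB ih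
  have h := this (p - 1)
  rw [Ca_spec] at h
  exact mem_of_pow hp.out.ne_zero ((neg_mem_iff).1 h)

theorem Ca_dL {f : F} (hf : S.dL f (S.G - 1)) : S.dL (S.Ca f) (S.G - 1) := by
  by_contra hc
  obtain ⟨e, he, hE⟩ := S.not_dL hc
  have h1 : ∀ k : ℕ, S.dL (S.D^[k] f) (S.G - 1 + k * S.G) := fun k => by
    induction k with
    | zero => simpa using hf
    | succ k ih => rw [Function.iterate_succ_apply']; exact (S.dL_D ih).mono (by push_cast; linarith)
  have h2 := h1 (p - 1)
  rw [Ca_spec] at h2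
  have h3 := (hE.pow p).neg.le h2
  have hp1 := hp.out.pos
  push_cast [Nat.cast_sub (show 1 ≤ p from hp1)] at h3
  have : S.G ≤ e := by omega
  have : (p : ℤ) * S.G ≤ p * e := by gcongr
  linarith

/-- iterated Cartier operator -/
def La (k : ℕ) (f : F) : F := S.Ca^[k] f
theorem La_add (k) (f g : F) : S.La k (f + g) = S.La k f + S.La k g := by
  unfold La
  induction k generalizing f g with
  | zero => rfl
  | succ k ih => simp only [Function.iterate_succ_apply, Ca_add, ih]
theorem La_zero (k) : S.La k 0 = 0 := by
  have := S.La_add k 0 0; simpa using this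
theorem La_sum (k) {ι : Type*} (s : Finset ι) (f : ι → F) : S.La k (∑ i ∈ s, f i) = ∑ i ∈ s, S.La k (f i) := by
  classical
  induction s using Finset.induction_on with
  | empty => simp [La_zero]
  | insert a s ha ih => rw [Finset.sum_insert ha, Finset.sum_insert ha, La_add, ih]
theorem La_pmul (k) (g f : F) : S.La k (g ^ p ^ k * f) = g * S.La k f := by
  unfold La
  induction k generalizing f with
  | zero => simp
  | succ k ih => rw [Function.iterate_succ_apply, Function.iterate_succ_apply, pow_succ, pow_mul, Ca_pmul, ih]
theorem La_K (k) (a : K) (f : F) : ∃ b : K, b ^ p ^ k = a ∧ S.La k (algebraMap K F a * f) = algebraMap K F b * S.La k f := by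
  obtain ⟨l, rfl⟩ := IsAlgClosed.exists_pow_nat_eq a (pow_pos hp.out.pos k)
  exact ⟨l, rfl, by rw [map_pow, La_pmul]⟩
theorem La_sig (k) (σ : F ≃ₐ[K] F) (f : F) : S.La k (S.D (σ S.z) * σ f) = S.D (σ S.z) * σ (S.La k f) := by
  unfold La
  induction k generalizing f with
  | zero => rfl
  | succ k ih => rw [Function.iterate_succ_apply, Function.iterate_succ_apply, Ca_sig, ih]
theorem La_B (k) {B} (hB : S.Aff B) {f : F} (hf : f ∈ B) : S.La k f ∈ B := by
  unfold La
  induction k generalizing f with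
  | zero => exact hf
  | succ k ih => rw [Function.iterate_succ_apply]; exact ih (S.Ca_B hB hf)
theorem La_A (k) {f : F} (hf : f ∈ S.A) : S.La k f ∈ S.A := S.mem_A fun B hB => S.La_B k hB (hB.A hf)
theorem La_dL (k) {f : F} (hf : S.dL f (S.G - 1)) : S.dL (S.La k f) (S.G - 1) := by
  unfold La
  induction k generalizing f with
  | zero => exact hf
  | succ k ih => rw [Function.iterate_succ_apply]; exact ih (S.Ca_dL hf)
theorem La_z (k) : S.La k (S.z ^ (p ^ k - 1)) = 1 := by
  unfold La
  induction k with
  | zero => simp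
  | succ k ih =>
    have : S.z ^ (p ^ (k+1) - 1) = (S.z ^ (p ^ k - 1)) ^ p * S.z ^ (p - 1) := by
      rw [← pow_mul, ← pow_add]; congr 1
      have h1 : 1 ≤ p ^ k := Nat.one_le_pow _ _ hp.out.pos
      have h2 := hp.out.pos
      rw [pow_succ, Nat.sub_mul]
      have : 1 * p ≤ p ^ k * p := Nat.mul_le_mul_right _ h1
      omega
    rw [Function.iterate_succ_apply, this]
    have h := S.Ca_rep (S.z ^ (p ^ k - 1)) 0
    rw [map_zero, add_zero] at h
    rw [h, ih]

end cartier
end Cv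
end

set_option linter.all false
noncomputable section
namespace Cv
section auts
variable {p : ℕ} [hp : Fact p.Prime] {K F : Type} [Field K] [Field F] [Algebra K F] (S : Cv p K F)

theorem ext3 {φ ψ : F →ₐ[K] F} (hx : φ S.x = ψ S.x) (hy : φ S.y = ψ S.y) (hz : φ S.z = ψ S.z) : φ = ψ := by
  have hA : ∀ g ∈ S.A, φ g = ψ g := fun g hg => by
    refine S.alg_ind (P := fun g => φ g = ψ g) (by simp) hx hy hz ?_ ?_ hg
    · intro f g h1 h2; rw [map_add, map_add, h1, h2]
    · intro f g h1 h2; rw [map_mul, map_mul, h1, h2]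
  ext f
  obtain ⟨g, hg, h, hh, h0, rfl⟩ := S.frac f
  rw [map_div₀, map_div₀, hA g hg, hA h hh]

theorem ext3' {φ ψ : F ≃ₐ[K] F} (hx : φ S.x = ψ S.x) (hy : φ S.y = ψ S.y) (hz : φ S.z = ψ S.z) : φ = ψ := by
  have := S.ext3 (φ := (φ : F →ₐ[K] F)) (ψ := (ψ : F →ₐ[K] F)) hx hy hz
  ext f
  exact congrArg (fun φ : F →ₐ[K] F => φ f) this

theorem surj3 (φ : F →ₐ[K] F) (hx : S.x ∈ φ.fieldRange) (hy : S.y ∈ φ.fieldRange) (hz : S.z ∈ φ.fieldRange) :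
    Function.Surjective φ := by
  have hA : ∀ g ∈ S.A, g ∈ φ.fieldRange := fun g hg =>
    S.alg_ind (fun k => φ.fieldRange.algebraMap_mem k) hx hy hz (fun _ _ => φ.fieldRange.add_mem) (fun _ _ => φ.fieldRange.mul_mem) hg
  intro f
  obtain ⟨g, hg, h, hh, h0, rfl⟩ := S.frac f
  exact φ.fieldRange.div_mem (hA g hg) (hA h hh)

theorem mkEquiv {x1 y1 z1 : F} (h : CvRel (algebraMap K F S.c) S.q S.qb S.e S.t x1 y1 z1) (ht : Transcendental K z1)
    (hs : ∀ E : IntermediateField K F, x1 ∈ E → y1 ∈ E → z1 ∈ E → S.x ∈ E ∧ S.y ∈ E ∧ S.z ∈ E) :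
    ∃ σ : F ≃ₐ[K] F, σ S.x = x1 ∧ σ S.y = y1 ∧ σ S.z = z1 := by
  obtain ⟨φ, hx, hy, hz⟩ := S.hhom x1 y1 z1 h ht
  obtain ⟨h1, h2, h3⟩ := hs φ.fieldRange ⟨_, hx⟩ ⟨_, hy⟩ ⟨_, hz⟩
  exact ⟨AlgEquiv.ofBijective φ ⟨φ.injective, S.surj3 φ h1 h2 h3⟩, hx, hy, hz⟩

/-- trace polynomial -/
def Tr {R : Type} [CommRing R] (f : R) : R := ∑ i ∈ Finset.range S.e, f ^ S.qb ^ i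

theorem add_qb {R : Type} [CommRing R] [CharP R p] (f g : R) (i : ℕ) : (f + g) ^ S.qb ^ i = f ^ S.qb ^ i + g ^ S.qb ^ i := by
  unfold qb; rw [← pow_mul]; exact add_pow_char_pow f g _ _
theorem sub_qb {R : Type} [CommRing R] [CharP R p] (f g : R) (i : ℕ) : (f - g) ^ S.qb ^ i = f ^ S.qb ^ i - g ^ S.qb ^ i := by
  unfold qb; rw [← pow_mul]; exact sub_pow_char_pow f g _
theorem add_q {R : Type} [CommRing R] [CharP R p] (f g : R) : (f + g) ^ S.q = f ^ S.q + g ^ S.q := S.add_qb f g S.e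
theorem sub_q {R : Type} [CommRing R] [CharP R p] (f g : R) : (f - g) ^ S.q = f ^ S.q - g ^ S.q := S.sub_qb f g S.e
theorem add_q2 {R : Type} [CommRing R] [CharP R p] (f g : R) : (f + g) ^ S.q ^ 2 = f ^ S.q ^ 2 + g ^ S.q ^ 2 := by
  rw [pow_two, pow_mul, pow_mul, pow_mul, add_q, add_q]
theorem sub_q2 {R : Type} [CommRing R] [CharP R p] (f g : R) : (f - g) ^ S.q ^ 2 = f ^ S.q ^ 2 - g ^ S.q ^ 2 := by
  rw [pow_two, pow_mul, pow_mul, pow_mul, sub_q, sub_q]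
theorem Tr_add {R : Type} [CommRing R] [CharP R p] (f g : R) : S.Tr (f + g) = S.Tr f + S.Tr g := by
  unfold Tr; rw [← Finset.sum_add_distrib]; exact Finset.sum_congr rfl fun i _ => S.add_qb f g i
theorem Tr_sub {R : Type} [CommRing R] [CharP R p] (f g : R) : S.Tr (f - g) = S.Tr f - S.Tr g := by
  unfold Tr; rw [← Finset.sum_sub_distrib]; exact Finset.sum_congr rfl fun i _ => S.sub_qb f g i
theorem Tr_tele {R : Type} [CommRing R] [CharP R p] (f : R) : S.Tr (f - f ^ S.qb) = f - f ^ S.q := by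
  have : ∀ n, ∑ i ∈ Finset.range n, (f - f ^ S.qb) ^ S.qb ^ i = f - f ^ S.qb ^ n := by
    intro n
    induction n with
    | zero => simp
    | succ n ih => rw [Finset.sum_range_succ, ih, sub_qb, ← pow_mul, ← pow_succ']; ring
  exact this S.e
theorem Tr_map (k : K) : S.Tr (algebraMap K F k) = algebraMap K F (S.Tr k) := by
  unfold Tr; simp
theorem Tr_x : S.Tr S.x = algebraMap K F S.c * S.y ^ (S.q + 1) := S.htr'
theorem Tr_smul {R : Type} [CommRing R] {a : R} (ha : a ^ S.qb = a) (f : R) : S.Tr (a * f) = a * S.Tr f := by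
  have : ∀ i, a ^ S.qb ^ i = a := fun i => by
    induction i with
    | zero => simp
    | succ i ih => rw [pow_succ, pow_mul, ih, ha]
  unfold Tr; rw [Finset.mul_sum]; exact Finset.sum_congr rfl fun i _ => by rw [mul_pow, this]

variable [CharP F p]

theorem exists_s {γ b : K} (hγ : γ ^ S.q ^ 2 = γ) (hb : S.Tr b = S.c * γ ^ (S.q + 1)) :
    ∃ σ : F ≃ₐ[K] F, σ S.x = S.x + (algebraMap K F (S.c * γ ^ S.q) * S.y - (algebraMap K F (S.c * γ ^ S.q) * S.y) ^ S.qb) + algebraMap K F b ∧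
      σ S.y = S.y + algebraMap K F γ ∧ σ S.z = S.z := by
  refine S.mkEquiv ⟨?_, ?_⟩ S.htr ?_
  · rw [S.hzt, add_q2, ← map_pow, hγ]; ring
  · change S.Tr _ = _
    rw [Tr_add, Tr_add, Tr_tele, Tr_x, Tr_map, hb]
    have h1 : (algebraMap K F (S.c * γ ^ S.q) * S.y) ^ S.q = - (algebraMap K F (S.c * γ) * S.y ^ S.q) := by
      rw [mul_pow, ← map_pow, mul_pow, S.hcq, ← pow_mul, ← pow_two, hγ]; simp
    rw [h1, pow_succ (S.y + _), add_q, pow_succ, pow_succ]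
    simp only [map_mul, map_pow]; ring
  · intro E hx hy hz
    have hy' : S.y ∈ E := by simpa using E.sub_mem hy (E.algebraMap_mem γ)
    refine ⟨?_, hy', hz⟩
    have h := E.sub_mem (E.sub_mem hx (E.algebraMap_mem b)) (E.sub_mem (E.mul_mem (E.algebraMap_mem (S.c * γ ^ S.q)) hy') (pow_mem (E.mul_mem (E.algebraMap_mem (S.c * γ ^ S.q)) hy') S.qb))
    convert h using 1; ring

theorem qb_sub_dvd : S.qb - 1 ∣ S.q - 1 := by unfold q; simpa using Nat.sub_dvd_pow_sub_pow S.qb 1 S.e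

/-- order of the complement -/
def Co : ℕ := (S.q + 1) * ((S.qb - 1) * S.t)

theorem Co_pos : 0 < S.Co := by
  unfold Co; have := S.two_le_qb; have := S.t_pos; 
  have : 0 < S.qb - 1 := by omega
  positivity

theorem Co_facts {δ : K} (hδ : δ ^ S.Co = 1) : (δ ^ S.t) ^ S.q ^ 2 = δ ^ S.t ∧ (δ ^ (S.t * (S.q + 1))) ^ S.qb = δ ^ (S.t * (S.q + 1)) := by
  have h2 := S.two_le_qb
  have h3 := S.two_le_q
  constructor
  · obtain ⟨k, hk⟩ := S.qb_sub_dvd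
    have : S.q ^ 2 = (S.q + 1) * (S.q - 1) + 1 := by
      obtain ⟨r, hr⟩ : ∃ r, S.q = r + 1 := ⟨S.q - 1, by omega⟩
      rw [hr, Nat.add_sub_cancel]; ring
    rw [this, ← pow_mul, hk, show S.t * ((S.q + 1) * ((S.qb - 1) * k) + 1) = S.Co * k + S.t by unfold Co; ring, pow_add, pow_mul, hδ]; simp
  · rw [← pow_mul]
    obtain ⟨r, hr⟩ : ∃ r, S.qb = r + 1 := ⟨S.qb - 1, by omega⟩
    rw [show S.t * (S.q + 1) * S.qb = S.Co + S.t * (S.q + 1) by unfold Co; rw [hr, Nat.add_sub_cancel]; ring, pow_add, hδ, one_mul]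

theorem exists_c {δ : K} (hδ : δ ^ S.Co = 1) :
    ∃ σ : F ≃ₐ[K] F, σ S.x = algebraMap K F (δ ^ (S.t * (S.q + 1))) * S.x ∧
      σ S.y = algebraMap K F (δ ^ S.t) * S.y ∧ σ S.z = algebraMap K F δ * S.z := by
  obtain ⟨h1, h2⟩ := S.Co_facts hδ
  have h0 : δ ≠ 0 := by rintro rfl; rw [zero_pow S.Co_pos.ne'] at hδ; exact zero_ne_one hδ
  have hdiv : ∀ (E : IntermediateField K F) (k : K) (f : F), k ≠ 0 → algebraMap K F k * f ∈ E → f ∈ E := by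
    intro E k f hk h
    have h2 := E.mul_mem (E.algebraMap_mem k⁻¹) h
    rwa [map_inv₀, inv_mul_cancel_left₀ (by simpa using hk)] at h2
  refine S.mkEquiv ⟨?_, ?_⟩ ?_ ?_
  · rw [mul_pow, mul_pow, S.hzt, ← map_pow, ← map_pow, h1]; ring
  · change S.Tr _ = _
    rw [Tr_smul, Tr_x, mul_pow, pow_mul δ]
    · simp only [map_pow]; ring
    · rw [← map_pow, h2]
  · intro h
    have := (isAlgebraic_algebraMap (A := F) δ⁻¹).mul h
    rw [map_inv₀, inv_mul_cancel_left₀ (by simpa using h0)] at this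
    exact S.htr this
  · intro E hx hy hz
    exact ⟨hdiv E _ _ (pow_ne_zero _ h0) hx, hdiv E _ _ (pow_ne_zero _ h0) hy, hdiv E _ _ h0 hz⟩

/-- the too-many-roots tool -/
theorem tool {n : ℕ} (w : F) (Γ : Finset K) (hΓ : n ≤ Γ.card) (P : Polynomial F) (hP : P.degree < n)
    (h : ∀ γ ∈ Γ, ∃ σ : F →+* F, (∀ i, σ (P.coeff i) = P.coeff i) ∧ σ w = w + algebraMap K F γ)
    (h0 : P.eval w = 0) : P = 0 := by
  classical
  apply Polynomial.eq_zero_of_degree_lt_of_eval_finset_eq_zero (Γ.image fun γ => w + algebraMap K F γ)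
  · rw [Finset.card_image_of_injective]
    · exact lt_of_lt_of_le hP (by exact_mod_cast hΓ)
    · intro a b hab; simpa using hab
  · intro v hv
    obtain ⟨γ, hγ, rfl⟩ := Finset.mem_image.1 hv
    obtain ⟨σ, h1, h2⟩ := h γ hγ
    have hPσ : P.map σ = P := by ext i; rw [Polynomial.coeff_map, h1]
    rw [← h2, ← hPσ, Polynomial.eval_map, Polynomial.eval₂_hom, h0, map_zero]

/-- subalgebra K[z] -/
def Az : Subalgebra K F := Algebra.adjoin K {S.z}
def Ayz : Subalgebra K F := Algebra.adjoin K {S.y, S.z}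
theorem Az_z : S.z ∈ S.Az := Algebra.subset_adjoin (by simp)
theorem Ayz_z : S.z ∈ S.Ayz := Algebra.subset_adjoin (by simp)
theorem Ayz_y : S.y ∈ S.Ayz := Algebra.subset_adjoin (by simp)
theorem fix_Az {σ : F →ₐ[K] F} (h : σ S.z = S.z) {f : F} (hf : f ∈ S.Az) : σ f = f := by
  unfold Az at hf
  induction hf using Algebra.adjoin_induction with
  | mem f h' => rw [Set.mem_singleton_iff] at h'; rw [h', h]
  | algebraMap k => simp
  | add f g _ _ h1 h2 => rw [map_add, h1, h2]
  | mul f g _ _ h1 h2 => rw [map_mul, h1, h2]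
theorem fix_Ayz {σ : F →ₐ[K] F} (h1 : σ S.y = S.y) (h2 : σ S.z = S.z) {f : F} (hf : f ∈ S.Ayz) : σ f = f := by
  unfold Ayz at hf
  induction hf using Algebra.adjoin_induction with
  | mem f h' =>
    simp only [Set.mem_insert_iff, Set.mem_singleton_iff] at h'
    rcases h' with rfl | rfl
    · exact h1
    · exact h2
  | algebraMap k => simp
  | add f g _ _ h1 h2 => rw [map_add, h1, h2]
  | mul f g _ _ h1 h2 => rw [map_mul, h1, h2]
theorem Az_poly {f : F} (hf : f ∈ S.Az) : ∃ R : Polynomial K, f = Polynomial.aeval S.z R := by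
  unfold Az at hf
  obtain ⟨R, hR⟩ := Algebra.adjoin_mem_exists_aeval _ _ hf
  exact ⟨R, hR.symm⟩

variable [IsAlgClosed K]

theorem card_TrRoots (v : K) : ∃ Γ : Finset K, Γ.card = S.N ∧ ∀ a, a ∈ Γ ↔ S.Tr a = v := by
  classical
  have : CharP K p := cK (F := F)
  set P : Polynomial K := ∑ i ∈ Finset.range S.e, Polynomial.X ^ S.qb ^ i - Polynomial.C v with hPdef
  obtain ⟨hm, hd⟩ : P.Monic ∧ P.natDegree = S.N := TrP_monic S.qb S.e S.two_le_qb S.he v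
  have hder : P.derivative = 1 := by
    obtain ⟨k, hk⟩ : ∃ k, S.e = k + 1 := ⟨S.e - 1, by have := S.he; omega⟩
    rw [hPdef, hk, Finset.sum_range_succ']
    simp only [pow_zero, pow_one, Polynomial.derivative_sub, Polynomial.derivative_add, Polynomial.derivative_sum, Polynomial.derivative_X_pow, Polynomial.derivative_X, Polynomial.derivative_C]
    rw [Finset.sum_eq_zero]; · simp
    intro i _
    have : ((S.qb ^ (i+1) : ℕ) : K) = 0 := by
      rw [CharP.cast_eq_zero_iff K p]; exact dvd_pow S.p_dvd_qb (by omega)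
    rw [this]; simp
  have hsep : P.Separable := by
    rw [Polynomial.separable_def, hder]; exact isCoprime_one_right
  refine ⟨P.roots.toFinset, ?_, ?_⟩
  · rw [Multiset.toFinset_card_of_nodup (Polynomial.nodup_roots hsep), ← hd]
    exact (IsAlgClosed.splits P).natDegree_eq_card_roots.symm
  · intro a
    rw [Multiset.mem_toFinset, Polynomial.mem_roots hm.ne_zero, Polynomial.IsRoot.def, hPdef]
    simp only [Polynomial.eval_sub, Polynomial.eval_finset_sum, Polynomial.eval_pow, Polynomial.eval_X, Polynomial.eval_C]
    rw [sub_eq_zero]; rfl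

theorem card_q2Roots : ∃ Γ : Finset K, Γ.card = S.q ^ 2 ∧ ∀ a, a ∈ Γ ↔ a ^ S.q ^ 2 = a := by
  classical
  have : CharP K p := cK (F := F)
  have h1 : 1 < S.q ^ 2 := by have := S.q2_gt; have := S.two_le_q; omega
  have hc : ((S.q ^ 2 : ℕ) : K) = 0 := by rw [CharP.cast_eq_zero_iff K p]; exact dvd_pow S.p_dvd_q two_ne_zero
  set P : Polynomial K := Polynomial.X ^ (S.q ^ 2) - Polynomial.X with hPdef
  have hd : P.natDegree = S.q ^ 2 := FiniteField.X_pow_card_sub_X_natDegree_eq K h1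
  have h0 : P ≠ 0 := FiniteField.X_pow_card_sub_X_ne_zero K h1
  have hsep : P.Separable := by
    rw [Polynomial.separable_def, hPdef]
    simp only [Polynomial.derivative_sub, Polynomial.derivative_X_pow, Polynomial.derivative_X]
    rw [hc]
    simp only [map_zero, zero_mul, zero_sub]
    exact ⟨0, -1, by simp⟩
  refine ⟨P.roots.toFinset, ?_, ?_⟩
  · rw [Multiset.toFinset_card_of_nodup (Polynomial.nodup_roots hsep), ← hd]
    exact (IsAlgClosed.splits P).natDegree_eq_card_roots.symm
  · intro a
    rw [Multiset.mem_toFinset, Polynomial.mem_roots h0, Polynomial.IsRoot.def, hPdef]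
    simp only [Polynomial.eval_sub, Polynomial.eval_pow, Polynomial.eval_X]
    rw [sub_eq_zero]

theorem T1 (P : Polynomial F) (hP : P.degree < S.N) (hc : ∀ i, P.coeff i ∈ S.Ayz) (h0 : P.eval S.x = 0) : P = 0 := by
  obtain ⟨Γ, h1, h2⟩ := S.card_TrRoots 0
  refine tool S.x Γ h1.ge P hP ?_ h0
  intro γ hγ
  obtain ⟨σ, hx, hy, hz⟩ := S.exists_s (γ := 0) (b := γ) (zero_pow (pow_ne_zero _ (by have := S.two_le_q; omega)))
    (by rw [(h2 γ).1 hγ]; simp)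
  have hq : S.q ≠ 0 := by have := S.two_le_q; omega
  have hqb : S.qb ≠ 0 := by have := S.two_le_qb; omega
  refine ⟨σ, fun i => S.fix_Ayz (σ := (σ : F →ₐ[K] F)) (by simpa using hy) hz (hc i), ?_⟩
  simpa [hq, hqb] using hx

theorem exists_b (γ : K) : ∃ b : K, S.Tr b = S.c * γ ^ (S.q + 1) := by
  obtain ⟨Γ, h1, h2⟩ := S.card_TrRoots (S.c * γ ^ (S.q + 1))
  have : Γ.Nonempty := by rw [← Finset.card_pos, h1]; exact S.N_pos
  obtain ⟨b, hb⟩ := this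
  exact ⟨b, (h2 b).1 hb⟩

theorem T2 (P : Polynomial F) (hP : P.degree < (S.q ^ 2 : ℕ)) (hc : ∀ i, P.coeff i ∈ S.Az) (h0 : P.eval S.y = 0) : P = 0 := by
  obtain ⟨Γ, h1, h2⟩ := S.card_q2Roots
  refine tool S.y Γ h1.ge P hP ?_ h0
  intro γ hγ
  obtain ⟨b, hb⟩ := S.exists_b γ
  obtain ⟨σ, hx, hy, hz⟩ := S.exists_s ((h2 γ).1 hγ) hb
  exact ⟨σ, fun i => S.fix_Az (σ := (σ : F →ₐ[K] F)) hz (hc i), hy⟩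

end auts
end Cv
end

set_option linter.all false
noncomputable section
namespace Cv
section infl
variable {p : ℕ} [hp : Fact p.Prime] {K F : Type} [Field K] [Field F] [Algebra K F] (S : Cv p K F)

/-- f is a nonzero constant up to order d at infinity -/
def U (d : ℤ) (f : F) : Prop := ∃ α : K, α ≠ 0 ∧ S.dL (f - algebraMap K F α) (-d)

variable {S}
theorem U.dE {d : ℤ} (hd : 0 < d) {f : F} (h : S.U d f) : S.dE f 0 := by
  obtain ⟨α, h0, h⟩ := h
  have := (S.dE_const h0).add h (by omega)
  simpa using this
theorem U.mul {d : ℤ} (hd : 0 < d) {f g : F} (hf : S.U d f) (hg : S.U d g) : S.U d (f * g) := by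
  have hgE := hg.dE hd
  obtain ⟨α, h0, h⟩ := hf
  obtain ⟨β, h0', h'⟩ := hg
  refine ⟨α * β, mul_ne_zero h0 h0', ?_⟩
  have := (h.mul hgE.L)
  rw [add_zero] at this
  have h2 := this.add (h'.const_mul α)
  convert h2 using 1
  rw [map_mul]; ring
theorem U.inv {d : ℤ} (hd : 0 < d) {f : F} (hf : S.U d f) : S.U d f⁻¹ := by
  have hE := hf.dE hd
  obtain ⟨α, h0, h⟩ := hf
  refine ⟨α⁻¹, inv_ne_zero h0, ?_⟩
  have h2 := (h.mul hE.inv.L).neg.const_mul α⁻¹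
  rw [neg_zero, add_zero] at h2
  convert h2 using 1
  have hf0 := hE.ne_zero
  have : algebraMap K F α ≠ 0 := by simpa using h0
  rw [map_inv₀]; field_simp; ring
theorem U.pow {d : ℤ} (hd : 0 < d) {f : F} (hf : S.U d f) (n : ℕ) : S.U d (f ^ n) := by
  induction n with
  | zero => exact ⟨1, one_ne_zero, by simpa using S.dL_zero _⟩
  | succ n ih => rw [pow_succ]; exact ih.mul hd hf
theorem U.zpow {d : ℤ} (hd : 0 < d) {f : F} (hf : S.U d f) (n : ℤ) : S.U d (f ^ n) := by
  cases n with
  | ofNat n => simpa using hf.pow hd n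
  | negSucc n => rw [zpow_negSucc]; exact (hf.pow hd _).inv hd
theorem U.mono {d e : ℤ} {f : F} (hf : S.U d f) (h : e ≤ d) : S.U e f := by
  obtain ⟨α, h0, h'⟩ := hf
  exact ⟨α, h0, h'.mono (by omega)⟩
variable (S) [CharP F p]
variable {S} in
theorem U.q2 {d : ℤ} {f : F} (hf : S.U d f) : S.U (S.q ^ 2 * d) (f ^ S.q ^ 2) := by
  obtain ⟨α, h0, h'⟩ := hf
  refine ⟨α ^ S.q ^ 2, pow_ne_zero _ h0, ?_⟩
  rw [map_pow, ← sub_q2]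
  convert h'.pow (S.q ^ 2) using 1
  push_cast; ring

theorem U_x : S.U S.N (S.x ^ S.N / S.y ^ (S.q + 1)) := by
  refine ⟨S.c, S.hc0, ?_⟩
  have hy := S.y0
  have : S.x ^ S.N / S.y ^ (S.q + 1) - algebraMap K F S.c = - ∑ i ∈ Finset.range (S.e - 1), S.x ^ S.qb ^ i / S.y ^ (S.q + 1) := by
    rw [S.xN, ← Finset.sum_div]; field_simp; ring
  rw [this]
  apply dL.neg
  apply dL.sum
  intro i hi
  rw [Finset.mem_range] at hi
  refine ((S.dE_x.pow _).div (S.dE_y.pow _)).L.mono ?_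
  have h2 := S.two_le_qb
  have h1 : 2 * S.qb ^ i ≤ S.N := by
    calc 2 * S.qb ^ i ≤ S.qb * S.qb ^ i := by gcongr
      _ = S.qb ^ (i + 1) := (pow_succ' _ _).symm
      _ ≤ S.N := Nat.pow_le_pow_right (by omega) (by omega)
  have h3 : (2 : ℤ) ≤ S.t * (S.q + 1) := by
    have := S.t_pos; have := S.two_le_q
    have : 2 ≤ S.t * (S.q + 1) := by nlinarith
    exact_mod_cast this
  have h1' : (2 : ℤ) * S.qb ^ i ≤ S.N := by exact_mod_cast h1
  push_cast
  nlinarith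

theorem U_y : S.U (S.N * (S.q ^ 2 - 1) * S.t) (S.y ^ S.q ^ 2 / S.z ^ S.t) := by
  refine ⟨1, one_ne_zero, ?_⟩
  have hz := S.z0
  have : S.y ^ S.q ^ 2 / S.z ^ S.t - algebraMap K F 1 = S.y / S.z ^ S.t := by
    have : S.y ^ S.q ^ 2 = S.z ^ S.t + S.y := by rw [S.hzt]; ring
    rw [this, map_one]; field_simp; ring
  rw [this]
  refine (S.dE_y.div (S.dE_z.pow _)).L.mono ?_
  unfold M; push_cast; apply le_of_eq; ring

theorem tau_exp : ∃ i j l : ℤ, S.tau = S.x ^ i * S.y ^ j * S.z ^ l ∧ i * (S.t * (S.q + 1)) + j * (S.N * S.t) + l * S.M = -1 := by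
  obtain ⟨i, j, l, h⟩ := S.tau_mono
  refine ⟨i, j, l, h, ?_⟩
  have h1 := S.tau_dE
  rw [h] at h1
  have h2 := ((S.dE_x.zpow i).mul (S.dE_y.zpow j)).mul (S.dE_z.zpow l)
  exact h2.unique h1

theorem L1 (ht : S.t ≠ 1) : ∃ α : K, α ≠ 0 ∧ S.dL ((S.tau⁻¹) ^ S.M - algebraMap K F α * S.z) 0 := by
  have hM : (0 : ℤ) < S.M := by exact_mod_cast S.M_pos
  have hx := S.x0
  have hy := S.y0
  have hz := S.z0
  obtain ⟨i, j, l, h, he⟩ := S.tau_exp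
  have ux := S.U_x.q2
  have uy : S.U S.M (S.y ^ S.q ^ 2 / S.z ^ S.t) := by
    refine S.U_y.mono ?_
    have h1 : 2 ≤ S.t := by have := S.t_pos; omega
    have h2 := S.q1_lt
    have h3 := S.two_le_q
    have h4 : (2:ℤ) ≤ S.t := by exact_mod_cast h1
    have h5 : (S.q:ℤ) + 1 < S.q ^ 2 := by exact_mod_cast h2
    have h6 : (2:ℤ) ≤ S.q := by exact_mod_cast h3
    have h7 : (0:ℤ) < S.N := by exact_mod_cast S.N_pos
    unfold M; push_cast
    rw [mul_assoc]
    apply mul_le_mul_of_nonneg_left _ h7.le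
    nlinarith
  replace ux : S.U S.M ((S.x ^ S.N / S.y ^ (S.q + 1)) ^ S.q ^ 2) := by
    convert ux using 1; unfold M; push_cast; ring
  have hU : S.U S.M ((S.tau⁻¹) ^ S.M / S.z) := by
    have e : (S.tau⁻¹) ^ S.M / S.z = ((S.x ^ S.N / S.y ^ (S.q + 1)) ^ S.q ^ 2) ^ (-i) * (S.y ^ S.q ^ 2 / S.z ^ S.t) ^ (-(i * (S.q + 1) + j * S.N)) := by
      have hzz : S.z = S.z ^ (-(i * (S.t * (S.q + 1)) + j * (S.N * S.t) + l * S.M)) := by rw [he]; simp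
      conv_lhs => rw [hzz]
      rw [h]
      simp only [← zpow_natCast, div_eq_mul_inv, mul_zpow, ← zpow_mul, mul_inv, ← zpow_neg, inv_zpow']
      have a1 : ∀ a b c : ℤ, ∀ a' b' c' : ℤ, a = a' → b = b' → c = c' → S.x ^ a * S.y ^ b * S.z ^ c = S.x ^ a' * S.y ^ b' * S.z ^ c' := by
        rintro a b c _ _ _ rfl rfl rfl; rfl
      have a2 : ∀ a b c d : ℤ, S.x ^ a * S.y ^ b * S.z ^ c * S.z ^ d = S.x ^ a * S.y ^ b * S.z ^ (c + d) := by
        intro a b c d; rw [zpow_add₀ hz]; ring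
      have a3 : ∀ a b c d : ℤ, S.x ^ a * S.y ^ b * (S.y ^ c * S.z ^ d) = S.x ^ a * S.y ^ (b + c) * S.z ^ d := by
        intro a b c d; rw [zpow_add₀ hy]; ring
      rw [a2, a3]
      apply a1
      · unfold M; push_cast; ring
      · unfold M; push_cast; ring
      · unfold M; push_cast; ring
    rw [e]
    exact (ux.zpow hM _).mul hM (uy.zpow hM _)
  obtain ⟨α, h0, hα⟩ := hU
  refine ⟨α, h0, ?_⟩
  have := hα.mul S.dE_z.L
  rw [sub_mul, div_mul_cancel₀ _ hz] at this
  exact this.mono (by omega)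

theorem L2 (ht : S.t = 1) : ∃ α : K, α ≠ 0 ∧ S.dL ((S.tau⁻¹) ^ S.N - algebraMap K F α * S.y) 0 := by
  have hN : (0 : ℤ) < S.N := by exact_mod_cast S.N_pos
  have hx := S.x0
  have hy := S.y0
  have hz := S.z0
  obtain ⟨i, j, l, h, he⟩ := S.tau_exp
  have ux := S.U_x
  have uy : S.U S.N (S.y ^ S.q ^ 2 / S.z) := by
    have := S.U_y
    rw [ht, pow_one] at this
    refine this.mono ?_
    have h2 := S.q1_lt
    have h3 := S.two_le_q
    have h5 : (S.q:ℤ) + 1 < S.q ^ 2 := by exact_mod_cast h2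
    have h6 : (2:ℤ) ≤ S.q := by exact_mod_cast h3
    push_cast
    nlinarith
  have hU : S.U S.N ((S.tau⁻¹) ^ S.N / S.y) := by
    have e : (S.tau⁻¹) ^ S.N / S.y = (S.x ^ S.N / S.y ^ (S.q + 1)) ^ (-i) * (S.y ^ S.q ^ 2 / S.z) ^ (l * S.N) := by
      rw [ht] at he
      have hzz : S.y = S.y ^ (-(i * ((1:ℕ) * (S.q + 1)) + j * (S.N * (1:ℕ)) + l * S.M)) := by rw [he]; simp
      conv_lhs => arg 2; rw [hzz]
      rw [h]
      simp only [← zpow_natCast, div_eq_mul_inv, mul_zpow, ← zpow_mul, mul_inv, ← zpow_neg, inv_zpow']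
      have a1 : ∀ a b c : ℤ, ∀ a' b' c' : ℤ, a = a' → b = b' → c = c' → S.x ^ a * S.y ^ b * S.z ^ c = S.x ^ a' * S.y ^ b' * S.z ^ c' := by
        rintro a b c _ _ _ rfl rfl rfl; rfl
      have a2 : ∀ a b c d : ℤ, S.x ^ a * S.y ^ b * S.z ^ c * S.y ^ d = S.x ^ a * S.y ^ (b + d) * S.z ^ c := by
        intro a b c d; rw [zpow_add₀ hy]; ring
      have a3 : ∀ a b c d : ℤ, S.x ^ a * S.y ^ b * (S.y ^ c * S.z ^ d) = S.x ^ a * S.y ^ (b + c) * S.z ^ d := by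
        intro a b c d; rw [zpow_add₀ hy]; ring
      rw [a2, a3]
      apply a1
      · ring
      · unfold M; push_cast; ring
      · ring
    rw [e]
    exact (ux.zpow hN _).mul hN (uy.zpow hN _)
  obtain ⟨α, h0, hα⟩ := hU
  refine ⟨α, h0, ?_⟩
  have := hα.mul S.dE_y.L
  rw [sub_mul, div_mul_cancel₀ _ hy, ht] at this
  exact this.mono (by push_cast; omega)

variable [IsAlgClosed K]

theorem Kprop {k : ℕ} {h : F} {α : K} (hh : h ∈ S.A) (hL : S.dL ((S.tau⁻¹) ^ (p ^ k) - algebraMap K F α * h) 0)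
    {f : F} (hf : f ∈ S.V) : S.dL (S.La k f) (S.G - 2) := by
  by_contra hc
  obtain ⟨d, hd, hE⟩ := S.not_dL hc
  have hd2 := hE.le (S.La_dL k hf.2)
  have hd3 : d = S.G - 1 := by omega
  subst hd3
  have h1 := S.tau_dE.inv.mul hE
  rw [← La_pmul] at h1
  have h2 : (S.tau⁻¹) ^ (p ^ k) * f = algebraMap K F α * (h * f) + ((S.tau⁻¹) ^ (p ^ k) - algebraMap K F α * h) * f := by ring
  rw [h2, La_add] at h1
  have h3 := S.La_dL k ((hL.mul hf.2).mono (show (0 : ℤ) + (S.G - 1) ≤ S.G - 1 by omega))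
  obtain ⟨β, -, hβ⟩ := S.La_K k α (h * f)
  rw [hβ] at h1
  have h4 := h1.add h3.neg (by omega)
  rw [add_neg_cancel_right] at h4
  refine S.gap (S.A.mul_mem (S.A.algebraMap_mem β) (S.La_A k (S.A.mul_mem hh hf.1))) ?_
  convert h4 using 1; ring

/-- there is an iterated Cartier operator of the required kind -/
theorem exists_k : ∃ k : ℕ, (S.t = 1 → p ^ k = S.N) ∧ (S.t ≠ 1 → p ^ k = S.M) ∧ ∀ f ∈ S.V, S.dL (S.La k f) (S.G - 2) := by
  by_cases ht : S.t = 1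
  · obtain ⟨α, -, h⟩ := S.L2 ht
    refine ⟨_, fun _ => S.N_powp.symm, fun h => absurd ht h, fun f hf => S.Kprop S.y_mem (α := α) ?_ hf⟩
    rwa [← S.N_powp]
  · obtain ⟨α, -, h⟩ := S.L1 ht
    refine ⟨_, fun h => absurd h ht, fun _ => S.M_powp.symm, fun f hf => S.Kprop S.z_mem (α := α) ?_ hf⟩
    rwa [← S.M_powp]

/-- the pulled back place at infinity -/
def Bs (σ : F ≃ₐ[K] F) : ValuationSubring F := S.Vinf.comap (σ : F →+* F)
theorem mem_Bs {σ : F ≃ₐ[K] F} {f : F} : f ∈ S.Bs σ ↔ σ f ∈ S.Vinf := Iff.rfl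

theorem key9 {k : ℕ} (hk : ∀ f ∈ S.V, S.dL (S.La k f) (S.G - 2)) (σ : F ≃ₐ[K] F) (hB : S.Aff (S.Bs σ)) {f : F} (hf : f ∈ S.V) :
    (S.Bs σ).valuation (S.La k f) < 1 := by
  have h1 := hk _ (S.V_sig σ hf)
  rw [La_sig] at h1
  have h2 := S.ratio_mem σ.symm (P := S.Bs σ) (Q := S.Vinf) (fun f => by rw [mem_Bs]; simp) (.inl ⟨hB, rfl⟩) (.inr ⟨rfl, rfl⟩)
  rw [mem_Bs, S.mem_Vinf, one_mul, map_div₀, AlgEquiv.apply_symm_apply] at h2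
  have hu := S.u_inv σ
  have h3 := (h2.mul h1).mul S.kap_dE.L
  have hk0 := S.kap_dE.ne_zero
  have e : σ (S.D (σ.symm S.z)) / S.kap * (S.D (σ S.z) * σ (S.La k f)) * S.kap = σ (S.La k f) := by
    field_simp
    calc _ = S.D (σ S.z) * σ (S.D (σ.symm S.z)) * σ (S.La k f) := by ring
      _ = _ := by rw [hu, one_mul]
  rw [e] at h3
  replace h3 : S.dL (σ (S.La k f)) (-1) := h3.mono (by omega)
  by_contra hc
  rw [not_lt] at hc
  have hne : S.La k f ≠ 0 := by
    intro h; rw [h, map_zero] at hc; exact absurd hc (by simp)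
  have h4 : (S.La k f)⁻¹ ∈ S.Bs σ := by
    rw [← ValuationSubring.valuation_le_one_iff, map_inv₀]
    exact inv_le_one_of_one_le₀ hc
  rw [mem_Bs, S.mem_Vinf, map_inv₀] at h4
  have h5 := h3.mul h4
  rw [mul_inv_cancel₀ (by simpa using hne)] at h5
  have := S.dE_one.le h5
  omega

theorem no_t1 (ht : S.t = 1) (σ : F ≃ₐ[K] F) (hB : S.Aff (S.Bs σ)) : False := by
  obtain ⟨k, hk, -, hL⟩ := S.exists_k
  have hk := hk ht
  have hN : S.N ≠ 1 := fun h => by have := S.t_of_N h; omega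
  have hDy : S.D S.y = -1 := by rw [S.Dy, ht]; simp
  have hCy : S.Ca (S.y ^ (p - 1)) = 1 := by
    have h1 := S.Ca_log S.y
    have h2 := S.Ca_add (S.y ^ (p - 1) * S.D S.y) (S.y ^ (p - 1))
    rw [h1, hDy] at h2
    have : S.y ^ (p - 1) * -1 + S.y ^ (p - 1) = 0 := by ring
    rw [this, Ca_zero] at h2
    linear_combination -h2
  have hLa : ∀ k, S.La k (S.y ^ (p ^ k - 1)) = 1 := by
    intro k
    unfold La
    induction k with
    | zero => simp
    | succ k ih =>
      have : S.y ^ (p ^ (k+1) - 1) = (S.y ^ (p ^ k - 1)) ^ p * S.y ^ (p - 1) := by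
        rw [← pow_mul, ← pow_add]; congr 1
        have h1 : 1 ≤ p ^ k := Nat.one_le_pow _ _ hp.out.pos
        have h2 := hp.out.pos
        rw [pow_succ, Nat.sub_mul]
        have : 1 * p ≤ p ^ k * p := Nat.mul_le_mul_right _ h1
        omega
      rw [Function.iterate_succ_apply, this, Ca_pmul, hCy, mul_one, ih]
  have hV : S.y ^ (S.N - 1) ∈ S.V := by
    refine ⟨S.A.pow_mem S.y_mem _, (S.dE_y.pow _).L.mono ?_⟩
    have h1 := S.N_pos
    have h2 := S.two_le_qb
    have h3 := S.q_eq
    rw [ht]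
    unfold G M
    rw [ht]
    have h4 : (S.q : ℤ) = S.N * S.qb := by exact_mod_cast h3
    have h5 : (2 : ℤ) ≤ S.N := by exact_mod_cast (show 2 ≤ S.N by omega)
    have h6 : (2 : ℤ) ≤ S.qb := by exact_mod_cast h2
    push_cast [Nat.cast_sub (show 1 ≤ S.N from h1)]
    have h7 : (S.N : ℤ) * 1 ≤ S.N * (S.qb - 1) := by gcongr; omega
    have h8 : (2:ℤ) ≤ S.q - S.N := by rw [h4]; linarith
    have h9 : (1 : ℤ) * 2 ≤ (S.N - 1) * (S.q - S.N) := by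
      apply mul_le_mul <;> omega
    nlinarith
  have := S.key9 hL σ hB hV
  rw [← hk, hLa, map_one] at this
  exact lt_irrefl _ this

end infl
end Cv
end

set_option linter.all false
noncomputable section
namespace Cv
section origin
variable {p : ℕ} [hp : Fact p.Prime] {K F : Type} [Field K] [Field F] [Algebra K F] (S : Cv p K F)

theorem vlt_iff {B : ValuationSubring F} {f : F} : B.valuation f < 1 ↔ f = 0 ∨ f⁻¹ ∉ B := by
  rw [← B.valuation_le_one_iff, map_inv₀, not_le]
  by_cases h : f = 0
  · simp [h]
  · have hv : 0 < B.valuation f := zero_lt_iff.2 (by simpa using h)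
    rw [one_lt_inv₀ hv]; simp [h]
theorem vlt_comap {B : ValuationSubring F} {f : F} (s : F ≃ₐ[K] F) :
    (B.comap (s : F →+* F)).valuation f < 1 ↔ B.valuation (s f) < 1 := by
  rw [vlt_iff, vlt_iff, ValuationSubring.mem_comap]; simp

theorem vlt_add {B : ValuationSubring F} {f g : F} (hf : B.valuation f < 1) (hg : B.valuation g < 1) : B.valuation (f + g) < 1 :=
  Valuation.map_add_lt _ hf hg
theorem vlt_mul {B : ValuationSubring F} {f g : F} (hf : B.valuation f < 1) (hg : g ∈ B) : B.valuation (f * g) < 1 := by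
  rw [map_mul]; exact lt_of_le_of_lt (mul_le_of_le_one_right' ((B.valuation_le_one_iff g).2 hg)) hf
theorem vlt_pow {B : ValuationSubring F} {f : F} (hf : B.valuation f < 1) {n : ℕ} (hn : n ≠ 0) : B.valuation (f ^ n) < 1 := by
  rw [map_pow]; exact pow_lt_one₀ zero_le' hf hn
theorem vlt_mem {B : ValuationSubring F} {f : F} (hf : B.valuation f < 1) : f ∈ B := (B.valuation_le_one_iff f).1 hf.le
theorem one_add_v {B : ValuationSubring F} {f : F} (hf : B.valuation f < 1) : B.valuation (1 + f) = 1 :=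
  Valuation.map_one_add_of_lt _ hf

theorem prime_root [IsAlgClosed K] {B : ValuationSubring F} {w : F} {P : Polynomial K} (hP : P.Monic)
    (h : B.valuation (Polynomial.aeval w P) < 1) : ∃ γ, P.IsRoot γ ∧ B.valuation (w - algebraMap K F γ) < 1 := by
  by_contra hc
  push Not at hc
  have e := (IsAlgClosed.splits P).eq_prod_roots
  rw [hP.leadingCoeff, map_one, one_mul] at e
  rw [e, map_multiset_prod, map_multiset_prod, Multiset.map_map, Multiset.map_map] at h
  refine absurd h (not_lt.2 (Multiset.one_le_prod_of_one_le ?_))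
  intro v hv
  obtain ⟨γ, hγ, rfl⟩ := Multiset.mem_map.1 hv
  have := hc γ (Polynomial.isRoot_of_mem_roots hγ)
  simpa using this

/-- germs at the origin: constant times `1 + z r` -/
def H (B : ValuationSubring F) (f : F) : Prop := ∃ κ : K, κ ≠ 0 ∧ ∃ r ∈ B, f = algebraMap K F κ * (1 + S.z * r)
variable {S}
theorem H.mul {B : ValuationSubring F} (hz : S.z ∈ B) {f g : F} (hf : S.H B f) (hg : S.H B g) : S.H B (f * g) := by
  obtain ⟨κ, h0, r, hr, rfl⟩ := hf
  obtain ⟨κ', h0', r', hr', rfl⟩ := hg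
  refine ⟨κ * κ', mul_ne_zero h0 h0', r + r' + S.z * (r * r'), ?_, ?_⟩
  · exact B.add_mem _ _ (B.add_mem _ _ hr hr') (B.mul_mem _ _ hz (B.mul_mem _ _ hr hr'))
  · rw [map_mul]; ring
theorem H.pow {B : ValuationSubring F} (hz : S.z ∈ B) {f : F} (hf : S.H B f) (n : ℕ) : S.H B (f ^ n) := by
  induction n with
  | zero => exact ⟨1, one_ne_zero, 0, B.zero_mem, by simp⟩
  | succ n ih => rw [pow_succ]; exact ih.mul hz hf
theorem H.inv {B : ValuationSubring F} (hz : B.valuation S.z < 1) {f : F} (hf : S.H B f) : S.H B f⁻¹ := by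
  obtain ⟨κ, h0, r, hr, rfl⟩ := hf
  have h1 := one_add_v (vlt_mul hz hr)
  have hne : 1 + S.z * r ≠ 0 := by intro h; rw [h, map_zero] at h1; exact zero_ne_one h1
  refine ⟨κ⁻¹, inv_ne_zero h0, - r * (1 + S.z * r)⁻¹, B.mul_mem _ _ (B.neg_mem _ hr) ?_, ?_⟩
  · rw [← B.valuation_le_one_iff, map_inv₀, h1, inv_one]
  · have : algebraMap K F κ ≠ 0 := by simpa using h0
    rw [map_inv₀]; field_simp; ring
variable (S)
theorem H_one_add {B : ValuationSubring F} {w : F} (h : ∃ r ∈ B, w = S.z * r) : S.H B (1 + w) := by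
  obtain ⟨r, hr, rfl⟩ := h; exact ⟨1, one_ne_zero, r, hr, by simp⟩

theorem H_y {B : ValuationSubring F} (hB : S.Aff B) (hz : B.valuation S.z < 1) (hy : B.valuation S.y < 1) : S.H B (S.y / S.z ^ S.t) ∧ ∃ r ∈ B, S.y = S.z * r := by
  have hq : 2 ≤ S.q ^ 2 := by have := S.q1_lt; omega
  have h1 : S.y ^ S.q ^ 2 = S.y * S.y ^ (S.q ^ 2 - 1) := by rw [← pow_succ']; congr 1; omega
  have hv : B.valuation (1 + - S.y ^ (S.q ^ 2 - 1)) = 1 := one_add_v (by rw [Valuation.map_neg]; exact vlt_pow hy (by omega))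
  have hne : 1 + - S.y ^ (S.q ^ 2 - 1) ≠ 0 := by intro h; rw [h, map_zero] at hv; exact zero_ne_one hv
  have hi : (1 + - S.y ^ (S.q ^ 2 - 1))⁻¹ ∈ B := by rw [← B.valuation_le_one_iff, map_inv₀, hv, inv_one]
  have h2 : S.y = S.z ^ S.t * (- (1 + - S.y ^ (S.q ^ 2 - 1))⁻¹) := by
    rw [S.hzt, h1]; field_simp; ring
  have h3 : S.z ^ S.t = S.z * S.z ^ (S.t - 1) := by rw [← pow_succ']; congr 1; have := S.t_pos; omega
  have h4 : ∃ r ∈ B, S.y = S.z * r := ⟨S.z ^ (S.t - 1) * (- (1 + - S.y ^ (S.q ^ 2 - 1))⁻¹),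
    B.mul_mem _ _ (pow_mem hB.hz _) (B.neg_mem _ hi), by rw [← mul_assoc, ← h3]; exact h2⟩
  refine ⟨?_, h4⟩
  have h5 : S.y / S.z ^ S.t = - (1 + - S.y ^ (S.q ^ 2 - 1))⁻¹ := by
    have hz0 : S.z ≠ 0 := fun h => S.htr (h ▸ isAlgebraic_zero)
    conv_lhs => arg 1; rw [h2]
    field_simp
  rw [h5, neg_eq_neg_one_mul]
  refine H.mul hB.hz ⟨-1, by simp, 0, B.zero_mem, by simp⟩ (H.inv hz (S.H_one_add ?_))
  obtain ⟨r, hr, e⟩ := h4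
  refine ⟨- r * S.y ^ (S.q ^ 2 - 2), B.mul_mem _ _ (B.neg_mem _ hr) (pow_mem hB.hy _), ?_⟩
  have : S.y ^ (S.q ^ 2 - 1) = S.y * S.y ^ (S.q ^ 2 - 2) := by rw [← pow_succ']; congr 1; omega
  rw [this]; conv_lhs => arg 1; arg 1; rw [e]
  ring

theorem H_x {B : ValuationSubring F} (hB : S.Aff B) (hz : B.valuation S.z < 1) (hy : B.valuation S.y < 1) (hx : B.valuation S.x < 1) :
    S.H B (S.x / S.y ^ (S.q + 1)) := by
  have hqb := S.two_le_qb
  have hz0 : S.z ≠ 0 := fun h => S.htr (h ▸ isAlgebraic_zero)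
  have hy0 : S.y ≠ 0 := by
    intro h; have := S.hzt; rw [h, zero_pow (pow_ne_zero _ (by have := S.two_le_q; omega)), sub_zero] at this
    exact hz0 (pow_eq_zero_iff S.t_pos.ne' |>.1 this)
  obtain ⟨k, hk⟩ : ∃ k, S.e = k + 1 := ⟨S.e - 1, by have := S.he; omega⟩
  set w2 := ∑ i ∈ Finset.range k, S.x ^ (S.qb ^ (i + 1) - 1) with hw2
  have hpos : ∀ i, 2 ≤ S.qb ^ (i + 1) := fun i => hqb.trans (Nat.le_self_pow (by omega) _)
  have h1 : S.x * (1 + w2) = algebraMap K F S.c * S.y ^ (S.q + 1) := by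
    rw [← S.htr', hk, Finset.sum_range_succ', hw2, mul_add, Finset.mul_sum, add_comm]
    congr 1
    · refine Finset.sum_congr rfl fun i _ => ?_
      rw [← pow_succ']; congr 1; have := hpos i; omega
    · simp
  have hw : B.valuation w2 < 1 := by
    rw [hw2]
    apply Valuation.map_sum_lt _ one_ne_zero
    intro i _
    exact vlt_pow hx (by have := hpos i; omega)
  have hv := one_add_v hw
  have hne : 1 + w2 ≠ 0 := by intro h; rw [h, map_zero] at hv; exact zero_ne_one hv
  have hi : (1 + w2)⁻¹ ∈ B := by rw [← B.valuation_le_one_iff, map_inv₀, hv, inv_one]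
  have h2 : S.x = algebraMap K F S.c * S.y ^ (S.q + 1) * (1 + w2)⁻¹ := by rw [← h1]; field_simp
  have h5 : S.x / S.y ^ (S.q + 1) = algebraMap K F S.c * (1 + w2)⁻¹ := by
    conv_lhs => arg 1; rw [h2]
    field_simp
  obtain ⟨-, r, hr, e⟩ := S.H_y hB hz hy
  have h6 : ∃ r ∈ B, S.x = S.z * r := by
    refine ⟨r * (algebraMap K F S.c * S.y ^ S.q * (1 + w2)⁻¹), B.mul_mem _ _ hr (B.mul_mem _ _ (B.mul_mem _ _ (hB.hK _) (pow_mem hB.hy _)) hi), ?_⟩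
    rw [← mul_assoc, ← e]; conv_lhs => rw [h2, pow_succ]
    ring
  rw [h5]
  refine H.mul hB.hz ⟨S.c, S.hc0, 0, B.zero_mem, by simp⟩ (H.inv hz (S.H_one_add ?_))
  obtain ⟨r', hr', e'⟩ := h6
  refine ⟨∑ i ∈ Finset.range k, r' * S.x ^ (S.qb ^ (i + 1) - 2), B.sum_mem fun i _ => B.mul_mem _ _ hr' (pow_mem hB.hx _), ?_⟩
  rw [hw2, Finset.mul_sum]
  refine Finset.sum_congr rfl fun i _ => ?_
  rw [← mul_assoc, ← e', ← pow_succ']; congr 1; have := hpos i; omega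

variable [CharP F p]

theorem exists_f0 (ht : S.t ≠ 1) : ∃ i j l : ℕ, i * (S.t * (S.q + 1)) + j * S.t + l = S.M - 1 ∧ S.x ^ i * S.y ^ j * S.z ^ l ∈ S.V := by
  have hM := S.M_pos
  have ht0 := S.t_pos
  have ht2 : 3 ≤ S.t := by obtain ⟨r, hr⟩ := S.hodd; omega
  have htM : ¬ S.t ∣ S.M + 1 := S.htM ht
  have htM' : ¬ S.t ∣ S.M := by
    intro h; rw [S.M_powp] at h
    have := Nat.Coprime.eq_one_of_dvd (S.cop_p_t.symm.pow_right _) h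
    exact ht this
  set l := (S.M - 1) % S.t with hl
  set Q := (S.M - 1) / S.t with hQ
  have e1 : S.t * Q + l = S.M - 1 := Nat.div_add_mod _ _
  have hlt : l < S.t := Nat.mod_lt _ ht0
  have hl1 : l ≠ S.t - 1 := by
    intro h; apply htM'
    exact ⟨Q + 1, by rw [mul_add, mul_one]; omega⟩
  have hl2 : l ≠ S.t - 2 := by
    intro h; apply htM
    exact ⟨Q + 1, by rw [mul_add, mul_one]; omega⟩
  set i := Q / (S.q + 1) with hi
  set j := Q % (S.q + 1) with hj
  have e2 : (S.q + 1) * i + j = Q := Nat.div_add_mod _ _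
  have hjq : j < S.q + 1 := Nat.mod_lt _ (by omega)
  have e3 : i * (S.t * (S.q + 1)) + j * S.t + l = S.M - 1 := by rw [← e1, ← e2]; ring
  refine ⟨i, j, l, e3, S.A.mul_mem (S.A.mul_mem (S.A.pow_mem S.x_mem _) (S.A.pow_mem S.y_mem _)) (S.A.pow_mem S.z_mem _), ?_⟩
  refine (((S.dE_x.pow i).mul (S.dE_y.pow j)).mul (S.dE_z.pow l)).L.mono ?_
  have e4 : (i : ℤ) * (S.t * (S.q + 1)) + j * S.t + l = S.M - 1 := by
    have := congrArg (Nat.cast : ℕ → ℤ) e3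
    push_cast [Nat.cast_sub (show 1 ≤ S.M from hM)] at this
    exact this
  have hM4 : (4 : ℤ) ≤ S.M := by
    have h1 : 4 ≤ S.q ^ 2 := by have := S.two_le_q; nlinarith
    have : 4 ≤ S.M := by unfold M; have := S.N_pos; nlinarith
    exact_mod_cast this
  have hl3 : (l : ℤ) ≤ S.t - 3 := by omega
  have hj3 : (j : ℤ) ≤ S.q := by omega
  have hN : (1 : ℤ) ≤ S.N := by exact_mod_cast S.N_pos
  have ht3 : (0 : ℤ) ≤ S.t := by positivity
  have a1 : ((S.M : ℤ) - 1) * l ≤ (S.M - 1) * (S.t - 3) := mul_le_mul_of_nonneg_left hl3 (by omega)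
  have a2 : ((S.N : ℤ) - 1) * S.t * j ≤ (S.N - 1) * S.t * S.q := mul_le_mul_of_nonneg_left hj3 (mul_nonneg (by omega) ht3)
  unfold G
  nlinarith

variable [IsAlgClosed K]

theorem f0_unit {k : ℕ} (hk : p ^ k = S.M) {i j l : ℕ} (h : i * (S.t * (S.q + 1)) + j * S.t + l = S.M - 1)
    {B : ValuationSubring F} (hB : S.Aff B) (hz : B.valuation S.z < 1) (hy : B.valuation S.y < 1) (hx : B.valuation S.x < 1) :
    B.valuation (S.La k (S.x ^ i * S.y ^ j * S.z ^ l)) = 1 := by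
  have hz0 := S.z0
  have hy0 := S.y0
  have h1 := ((S.H_x hB hz hy hx).pow hB.hz i).mul hB.hz ((S.H_y hB hz hy).1.pow hB.hz ((S.q + 1) * i + j))
  obtain ⟨κ, hκ, r, hr, e⟩ := h1
  have e2 : S.x ^ i * S.y ^ j * S.z ^ l = algebraMap K F κ * (S.z ^ (p ^ k - 1) + S.z ^ p ^ k * r) := by
    have : S.z ^ p ^ k = S.z ^ (p ^ k - 1) * S.z := by
      rw [← pow_succ]; congr 1; have : 0 < p ^ k := pow_pos hp.out.pos k
      omega
    rw [this]
    calc S.x ^ i * S.y ^ j * S.z ^ l = (S.x / S.y ^ (S.q + 1)) ^ i * (S.y / S.z ^ S.t) ^ ((S.q + 1) * i + j) * S.z ^ (p ^ k - 1) := by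
          rw [hk, ← h, div_pow, div_pow, ← pow_mul, ← pow_mul, pow_add S.y, show i * (S.t * (S.q + 1)) + j * S.t + l = S.t * ((S.q + 1) * i + j) + l by ring, pow_add S.z]
          field_simp
      _ = _ := by rw [e]; ring
  rw [e2]
  obtain ⟨β, hβ, e3⟩ := S.La_K k κ (S.z ^ (p ^ k - 1) + S.z ^ p ^ k * r)
  have hβ0 : β ≠ 0 := by rintro rfl; rw [zero_pow (pow_ne_zero _ hp.out.ne_zero)] at hβ; exact hκ hβ.symm
  rw [e3, La_add, La_z, La_pmul, map_mul, val_const hB.hK hβ0, one_mul]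
  exact one_add_v (vlt_mul hz (S.La_B k hB hr))

theorem translate {B : ValuationSubring F} (hB : S.Aff B) (hz : B.valuation S.z < 1) :
    ∃ s : F ≃ₐ[K] F, s S.z = S.z ∧ B.valuation (s S.y) < 1 ∧ B.valuation (s S.x) < 1 := by
  have : CharP K p := cK (F := F)
  have hqq : S.q ^ 2 ≠ 0 := by have := S.q1_lt; omega
  obtain ⟨γ, hγ, hyv⟩ := prime_root (K := K) (B := B) (w := S.y) (P := Polynomial.X ^ S.q ^ 2 - Polynomial.X)
    (Polynomial.monic_X_pow_sub (by rw [Polynomial.degree_X]; exact_mod_cast (show 1 < S.q ^ 2 by have := S.q1_lt; omega)))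
    (by simp only [map_sub, map_pow, Polynomial.aeval_X]; rw [← S.hzt]; exact vlt_pow hz S.t_pos.ne')
  have hγ' : γ ^ S.q ^ 2 = γ := by simpa [Polynomial.IsRoot.def, sub_eq_zero] using hγ
  have hmγ : (-γ) ^ S.q ^ 2 = -γ := by
    have := S.sub_q2 0 γ
    rw [zero_pow hqq, zero_sub, zero_sub, hγ'] at this; exact this
  obtain ⟨b, hb⟩ := S.exists_b (-γ)
  obtain ⟨s, hsx, hsy, hsz⟩ := S.exists_s hmγ hb
  have hsyv : B.valuation (s S.y) < 1 := by
    rw [hsy, map_neg, ← sub_eq_add_neg]; exact hyv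
  have hTr : S.Tr (s S.x) = algebraMap K F S.c * (s S.y) ^ (S.q + 1) := by
    have := congrArg s S.Tr_x
    unfold Tr at *
    simpa using this
  obtain ⟨a, ha, hav⟩ := prime_root (K := K) (B := B) (w := s S.x) (TrP_monic S.qb S.e S.two_le_qb S.he (0 : K)).1
    (by
      have : Polynomial.aeval (s S.x) (∑ i ∈ Finset.range S.e, (Polynomial.X : Polynomial K) ^ S.qb ^ i - Polynomial.C 0) = S.Tr (s S.x) := by
        unfold Tr; simp
      rw [this, hTr, mul_comm]; exact vlt_mul (vlt_pow hsyv (by omega)) (hB.hK _))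
  have ha' : S.Tr a = 0 := by
    have : Polynomial.eval a (∑ i ∈ Finset.range S.e, (Polynomial.X : Polynomial K) ^ S.qb ^ i - Polynomial.C 0) = S.Tr a := by
      unfold Tr; simp [Polynomial.eval_finset_sum]
    rw [← this]; exact ha
  obtain ⟨s', hsx', hsy', hsz'⟩ := S.exists_s hmγ (b := b - a) (by rw [Tr_sub, ha', hb, sub_zero])
  refine ⟨s', hsz', by rw [hsy', ← hsy]; exact hsyv, ?_⟩
  have : s' S.x = s S.x - algebraMap K F a := by rw [hsx', hsx, map_sub]; ring
  rw [this]; exact hav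

theorem no_z {k : ℕ} (ht : S.t ≠ 1) (hk : p ^ k = S.M) (hL : ∀ f ∈ S.V, S.dL (S.La k f) (S.G - 2))
    (σ : F ≃ₐ[K] F) (hB : S.Aff (S.Bs σ)) (hz : (S.Bs σ).valuation S.z < 1) : False := by
  obtain ⟨s, hs, hy, hx⟩ := S.translate hB hz
  obtain ⟨i, j, l, h, hV⟩ := S.exists_f0 ht
  have hc : S.Bs (σ * s) = (S.Bs σ).comap (s : F →+* F) := rfl
  have hB' : S.Aff (S.Bs (σ * s)) := ⟨fun k => by rw [mem_Bs, AlgEquiv.commutes]; exact S.Vinf_K k, by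
    rw [mem_Bs, AlgEquiv.mul_apply, hs]; exact hB.hz⟩
  have h1 := S.key9 hL (σ * s) hB' hV
  rw [S.f0_unit hk h hB' (by rw [hc, vlt_comap, hs]; exact hz) (by rw [hc, vlt_comap]; exact hy) (by rw [hc, vlt_comap]; exact hx)] at h1
  exact lt_irrefl _ h1

end origin
end Cv
end

set_option linter.all false
noncomputable section
namespace Cv
section fin9
variable {p : ℕ} [hp : Fact p.Prime] {K F : Type} [Field K] [Field F] [Algebra K F] (S : Cv p K F)

theorem exists_O : ∃ B : ValuationSubring F, S.Aff B ∧ B.valuation S.z < 1 := by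
  let R : Subalgebra K F := Algebra.adjoin K {S.z}
  have hzR : S.z ∈ R := Algebra.subset_adjoin rfl
  let I : Ideal R.toSubring := Ideal.span {⟨S.z, hzR⟩}
  have hI : I ≠ ⊤ := by
    intro h
    have h1 : (1 : R.toSubring) ∈ I := by rw [h]; trivial
    obtain ⟨w, hw⟩ := Ideal.mem_span_singleton.1 h1
    have hwR : (w : F) ∈ R := w.2
    obtain ⟨P, hP⟩ := Algebra.adjoin_mem_exists_aeval K (S.z) hwR
    have h2 : (1 : F) = S.z * w := congrArg Subtype.val hw
    have h3 := transcendental_iff.1 S.htr (1 - Polynomial.X * P) (by simp [hP, ← h2])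
    have h4 := congrArg (Polynomial.eval 0) h3
    simp at h4
  obtain ⟨V, hV1, hV2⟩ := Ideal.image_subset_nonunits_valuationSubring I hI
  refine ⟨V, ⟨fun k => hV1 (R.algebraMap_mem k), hV1 hzR⟩, ?_⟩
  have h5 : S.z ∈ V.nonunits := hV2 ⟨⟨S.z, hzR⟩, Ideal.subset_span rfl, rfl⟩
  rwa [ValuationSubring.mem_nonunits_iff] at h5

/-- automorphisms moving functions only up to lower order -/
def Sm (σ : F ≃ₐ[K] F) : Prop := σ S.z = S.z ∧ S.dL (σ S.y - S.y) (S.N * S.t - 1) ∧ S.dL (σ S.x - S.x) (S.t * (S.q + 1) - 1)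

variable {S}
theorem Sm.mulP {σ : F ≃ₐ[K] F} {f g : F} {d e : ℤ} (hf : S.dL f d) (hf' : S.dL (σ f - f) (d - 1))
    (hg : S.dL g e) (hg' : S.dL (σ g - g) (e - 1)) : S.dL (σ (f * g) - f * g) (d + e - 1) := by
  have h1 : S.dL (σ g) e := by
    have := hg.add (hg'.mono (by omega : e - 1 ≤ e)); simpa using this
  have h2 := (hf'.mul h1).mono (by omega : d - 1 + e ≤ d + e - 1)
  have h3 := (hf.mul hg').mono (by omega : d + (e - 1) ≤ d + e - 1)
  have := h2.add h3
  convert this using 1; rw [map_mul]; ring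
theorem Sm.powP {σ : F ≃ₐ[K] F} {f : F} {d : ℤ} (hf : S.dL f d) (hf' : S.dL (σ f - f) (d - 1)) (n : ℕ) :
    S.dL (σ (f ^ n) - f ^ n) (n * d - 1) := by
  induction n with
  | zero => simpa using S.dL_zero _
  | succ n ih =>
    rw [pow_succ]
    have := Sm.mulP (hf.pow n) ih hf hf'
    convert this using 1; push_cast; ring
theorem Sm.mono {σ : F ≃ₐ[K] F} (h : S.Sm σ) (m : ℕ × ℕ × ℕ) : S.dL (σ (S.mono m) - S.mono m) (S.wt m - 1) := by
  obtain ⟨hz, hy, hx⟩ := h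
  have h1 := Sm.powP S.dE_x.L hx m.1
  have h2 := Sm.powP S.dE_y.L hy m.2.1
  have h3 := Sm.powP (σ := σ) S.dE_z.L (by rw [hz, sub_self]; exact S.dL_zero _) m.2.2
  have := Sm.mulP ((S.dE_x.L.pow m.1).mul (S.dE_y.L.pow m.2.1)) (Sm.mulP (S.dE_x.L.pow m.1) h1 (S.dE_y.L.pow m.2.1) h2) (S.dE_z.L.pow m.2.2) h3
  unfold Cv.mono wt
  convert this using 1; push_cast; ring

variable (S) [CharP F p] 

theorem Sm_of {γ b : K} {σ : F ≃ₐ[K] F} (hx : σ S.x = S.x + (algebraMap K F (S.c * γ ^ S.q) * S.y - (algebraMap K F (S.c * γ ^ S.q) * S.y) ^ S.qb) + algebraMap K F b)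
    (hy : σ S.y = S.y + algebraMap K F γ) (hz : σ S.z = S.z) : S.Sm σ := by
  have ht : (0 : ℤ) < S.t := by exact_mod_cast S.t_pos
  have hN : (0 : ℤ) < S.N := by exact_mod_cast S.N_pos
  have hNt : (0 : ℤ) < S.N * S.t := by positivity
  have hq : (0 : ℤ) ≤ S.q := by positivity
  have hqe : (S.q : ℤ) = S.N * S.qb := by exact_mod_cast S.q_eq
  have hqb : (1 : ℤ) ≤ S.qb := by have := S.two_le_qb; exact_mod_cast (by omega : 1 ≤ S.qb)
  refine ⟨hz, ?_, ?_⟩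
  · rw [hy, add_sub_cancel_left]; exact (S.dL_const γ).mono (by omega)
  · rw [hx]
    have h1 := (S.dE_y.L.const_mul (S.c * γ ^ S.q))
    have h2 := h1.pow S.qb
    have h3 := ((h1.mono (?_ : _ ≤ (S.t * (S.q + 1) - 1 : ℤ))).sub (h2.mono (?_ : _ ≤ (S.t * (S.q + 1) - 1 : ℤ)))).add ((S.dL_const b).mono (?_ : _ ≤ (S.t * (S.q + 1) - 1 : ℤ)))
    · convert h3 using 1; ring
    all_goals rw [hqe]; nlinarith [mul_le_mul_of_nonneg_left hqb hNt.le]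

variable [IsAlgClosed K]

/-- elements of A fixed by all translations lie in K[z] -/
theorem fix_mem_Az {g : F} (hg : g ∈ S.A) (hfix : ∀ σ, S.Sm σ → σ g = g) : g ∈ S.Az := by
  classical
  obtain ⟨a, ha⟩ := S.exists_lc hg
  rw [S.lc_eq] at ha
  have hq : S.q ≠ 0 := by have := S.two_le_q; omega
  have hqb : S.qb ≠ 0 := by have := S.two_le_qb; omega
  -- first step
  have h1 : g = ∑ m ∈ a.support.filter (fun m => m.1.1 = 0), algebraMap K F (a m) * (S.y ^ m.1.2.1 * S.z ^ m.1.2.2) := by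
    let P : Polynomial F := ∑ m ∈ a.support, Polynomial.C (algebraMap K F (a m) * (S.y ^ m.1.2.1 * S.z ^ m.1.2.2)) * Polynomial.X ^ m.1.1
    have hcf : ∀ i, P.coeff i = ∑ m ∈ a.support.filter (fun m => m.1.1 = i), algebraMap K F (a m) * (S.y ^ m.1.2.1 * S.z ^ m.1.2.2) := by
      intro i
      simp only [P, Polynomial.finset_sum_coeff, Polynomial.coeff_C_mul, Polynomial.coeff_X_pow]
      rw [Finset.sum_filter]
      apply Finset.sum_congr rfl; intro m _
      by_cases h : m.1.1 = i
      · simp [h]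
      · simp [h, Ne.symm h]
    have hc : ∀ i, P.coeff i ∈ S.Ayz := by
      intro i; rw [hcf]
      exact Subalgebra.sum_mem _ fun m _ => mul_mem (Subalgebra.algebraMap_mem _ _) (mul_mem (pow_mem S.Ayz_y _) (pow_mem S.Ayz_z _))
    have hdeg : P.degree < S.N := by
      apply lt_of_le_of_lt (Polynomial.degree_sum_le _ _)
      rw [Finset.sup_lt_iff (by simpa using S.N_pos.bot_lt)]
      intro m hm
      exact lt_of_le_of_lt (Polynomial.degree_C_mul_X_pow_le _ _) (by exact_mod_cast m.2.1)
    obtain ⟨Γ, h1, h2⟩ := S.card_TrRoots 0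
    have hP := tool S.x Γ h1.ge (P - Polynomial.C g) (lt_of_le_of_lt (Polynomial.degree_sub_le _ _) (max_lt hdeg
      (lt_of_le_of_lt Polynomial.degree_C_le (by exact_mod_cast S.N_pos)))) (by
      intro γ hγ
      obtain ⟨σ, hx, hy, hz⟩ := S.exists_s (γ := 0) (b := γ) (zero_pow (pow_ne_zero _ hq))
        (by rw [(h2 γ).1 hγ]; simp)
      have hfx := hfix σ (S.Sm_of hx hy hz)
      refine ⟨σ, fun i => ?_, by simpa [hq, hqb] using hx⟩
      have h3 := S.fix_Ayz (σ := (σ : F →ₐ[K] F)) (by simpa using hy) hz (hc i)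
      have h3' : σ (P.coeff i) = P.coeff i := h3
      rw [Polynomial.coeff_sub, map_sub, Polynomial.coeff_C]
      change σ (P.coeff i) - σ (if i = 0 then g else 0) = _
      rw [h3']
      split_ifs
      · rw [hfx]
      · rw [map_zero]) (by
      rw [Polynomial.eval_sub, Polynomial.eval_C, sub_eq_zero, ha]
      simp only [P, Polynomial.eval_finset_sum]
      apply Finset.sum_congr rfl; intro m _
      simp [Cv.mono]; ring)
    have := congrArg (fun P => Polynomial.coeff P 0) hP
    simp only [Polynomial.coeff_sub, Polynomial.coeff_C_zero, Polynomial.coeff_zero] at this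
    rw [sub_eq_zero, hcf] at this
    exact this.symm
  have h2 : g = ∑ m ∈ (a.support.filter (fun m => m.1.1 = 0)).filter (fun m => m.1.2.1 = 0), algebraMap K F (a m) * (S.z ^ m.1.2.2) := by
    let P : Polynomial F := ∑ m ∈ a.support.filter (fun m => m.1.1 = 0), Polynomial.C (algebraMap K F (a m) * (S.z ^ m.1.2.2)) * Polynomial.X ^ m.1.2.1
    have hcf : ∀ i, P.coeff i = ∑ m ∈ (a.support.filter (fun m => m.1.1 = 0)).filter (fun m => m.1.2.1 = i), algebraMap K F (a m) * (S.z ^ m.1.2.2) := by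
      intro i
      simp only [P, Polynomial.finset_sum_coeff, Polynomial.coeff_C_mul, Polynomial.coeff_X_pow]
      rw [Finset.sum_filter (fun m : S.Idx => m.1.2.1 = i)]
      apply Finset.sum_congr rfl; intro m _
      by_cases h : m.1.2.1 = i
      · simp [h]
      · simp [h, Ne.symm h]
    have hc : ∀ i, P.coeff i ∈ S.Az := by
      intro i; rw [hcf]
      exact Subalgebra.sum_mem _ fun m _ => mul_mem (Subalgebra.algebraMap_mem _ _) (pow_mem S.Az_z _)
    have hq2 : 0 < S.q ^ 2 := by positivity
    have hdeg : P.degree < (S.q ^ 2 : ℕ) := by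
      apply lt_of_le_of_lt (Polynomial.degree_sum_le _ _)
      rw [Finset.sup_lt_iff (WithBot.bot_lt_coe _)]
      intro m hm
      exact lt_of_le_of_lt (Polynomial.degree_C_mul_X_pow_le _ _) (by exact_mod_cast m.2.2)
    obtain ⟨Γ, h1', h2⟩ := S.card_q2Roots
    have hP := tool S.y Γ h1'.ge (P - Polynomial.C g) (lt_of_le_of_lt (Polynomial.degree_sub_le _ _) (max_lt hdeg
      (lt_of_le_of_lt Polynomial.degree_C_le (by exact_mod_cast hq2)))) (by
      intro γ hγ
      obtain ⟨b, hb⟩ := S.exists_b γ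
      obtain ⟨σ, hx, hy, hz⟩ := S.exists_s ((h2 γ).1 hγ) hb
      have hfx := hfix σ (S.Sm_of hx hy hz)
      refine ⟨σ, fun i => ?_, hy⟩
      have h3 := S.fix_Az (σ := (σ : F →ₐ[K] F)) hz (hc i)
      have h3' : σ (P.coeff i) = P.coeff i := h3
      rw [Polynomial.coeff_sub, map_sub, Polynomial.coeff_C]
      change σ (P.coeff i) - σ (if i = 0 then g else 0) = _
      rw [h3']
      split_ifs
      · rw [hfx]
      · rw [map_zero]) (by
      rw [Polynomial.eval_sub, Polynomial.eval_C, sub_eq_zero, h1]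
      simp only [P, Polynomial.eval_finset_sum]
      apply Finset.sum_congr rfl; intro m _
      simp; ring)
    have := congrArg (fun P => Polynomial.coeff P 0) hP
    simp only [Polynomial.coeff_sub, Polynomial.coeff_C_zero, Polynomial.coeff_zero] at this
    rw [sub_eq_zero, hcf] at this
    exact this.symm
  rw [h2]
  exact Subalgebra.sum_mem _ fun m _ => mul_mem (Subalgebra.algebraMap_mem _ _) (pow_mem S.Az_z _)

theorem exists_min {k : ℕ} (ht : S.t ≠ 1) (hk : p ^ k = S.M) :
    ∃ m : S.Idx, S.mono m ∈ S.V ∧ S.La k (S.mono m) ≠ 0 ∧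
      ∀ f ∈ S.A, S.dL f (S.wt m - 1) → S.La k f = 0 := by
  classical
  have key : ∀ a : S.Idx →₀ K, S.La k (S.lc a) ≠ 0 → ∃ m ∈ a.support, S.La k (S.mono m) ≠ 0 := by
    intro a h
    by_contra hc
    push Not at hc
    apply h
    rw [S.lc_eq, La_sum]
    apply Finset.sum_eq_zero
    intro m hm
    obtain ⟨b, -, hb⟩ := S.La_K k (a m) (S.mono m)
    rw [hb, hc m hm, mul_zero]
  have hex : ∃ w : ℕ, ∃ m : S.Idx, S.wt m = w ∧ S.mono m ∈ S.V ∧ S.La k (S.mono m) ≠ 0 := by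
    obtain ⟨B, hB, hz⟩ := S.exists_O
    obtain ⟨s, hs, hy, hx⟩ := S.translate hB hz
    obtain ⟨i, j, l, h, hV⟩ := S.exists_f0 ht
    have hB' : S.Aff (B.comap (s : F →+* F)) := ⟨fun k => by
      rw [ValuationSubring.mem_comap]; change s _ ∈ B; rw [AlgEquiv.commutes]; exact hB.hK k, by
      rw [ValuationSubring.mem_comap]; change s _ ∈ B; rw [hs]; exact hB.hz⟩
    have h1 := S.f0_unit hk h hB' (by rw [vlt_comap, hs]; exact hz) (by rw [vlt_comap]; exact hy) (by rw [vlt_comap]; exact hx)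
    have h2 : S.La k (S.x ^ i * S.y ^ j * S.z ^ l) ≠ 0 := by
      intro h0; rw [h0, map_zero] at h1; exact zero_ne_one h1
    obtain ⟨a, ha⟩ := S.exists_lc hV.1
    obtain ⟨hA, hd⟩ := S.mem_V.1 hV
    rw [ha] at h2 hd
    obtain ⟨m, hm, hm'⟩ := key a h2
    exact ⟨_, m, rfl, S.mem_V.2 ⟨S.mono_mem m, (S.dE_mono m).L.mono (S.dL_lc.1 hd m hm)⟩, hm'⟩
  obtain ⟨m, hw, hV, h0⟩ := Nat.find_spec hex
  refine ⟨m, hV, h0, fun f hf hd => ?_⟩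
  by_contra hne
  obtain ⟨a, rfl⟩ := S.exists_lc hf
  obtain ⟨m', hm', h'⟩ := key a hne
  have h3 := S.dL_lc.1 hd m' hm'
  refine Nat.find_min hex (m := S.wt m') (by omega) ⟨m', rfl, S.mem_V.2 ⟨S.mono_mem m', ?_⟩, h'⟩
  apply (S.dE_mono m').L.mono
  have := (S.dE_mono m).le (S.mem_V.1 hV).2
  omega

theorem Co_ne : (S.Co : K) ≠ 0 := by
  have : CharP K p := cK (F := F)
  rw [Ne, CharP.cast_eq_zero_iff K p]
  intro h
  unfold Co at h
  rcases (hp.out.dvd_mul.1 h) with h | h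
  · exact (Nat.Prime.coprime_iff_not_dvd hp.out).1 S.cop_p_q1 h
  rcases (hp.out.dvd_mul.1 h) with h | h
  · have h1 := S.p_dvd_qb
    have h2 := S.two_le_qb
    have := (Nat.dvd_sub h1 h)
    rw [Nat.sub_sub_self (by omega)] at this
    exact hp.out.one_lt.ne' (Nat.dvd_one.1 this)
  · exact (Nat.Prime.coprime_iff_not_dvd hp.out).1 S.cop_p_t h

theorem exists_prim : ∃ δ : K, IsPrimitiveRoot δ S.Co := by
  haveI : NeZero (S.Co : K) := ⟨S.Co_ne⟩
  exact HasEnoughRootsOfUnity.exists_primitiveRoot K S.Co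

theorem G_lt : S.G < S.M * S.Co := by
  have ht : (0 : ℤ) < S.t := by exact_mod_cast S.t_pos
  have hN : (0 : ℤ) < S.N := by exact_mod_cast S.N_pos
  have hq : (2 : ℤ) ≤ S.q := by exact_mod_cast S.two_le_q
  have hM : (S.M : ℤ) = S.N * S.q ^ 2 := by unfold M; push_cast; ring
  have hq1 : (S.q : ℤ) + 1 < S.q ^ 2 := by exact_mod_cast S.q1_lt
  have hqb : (1 : ℤ) ≤ (S.qb - 1 : ℕ) := by have := S.two_le_qb; exact_mod_cast (by omega : 1 ≤ S.qb - 1)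
  have hCo : (S.Co : ℤ) = (S.q + 1) * ((S.qb - 1 : ℕ) * S.t) := by unfold Co; push_cast; ring
  have h1 : (S.q + 1 : ℤ) * S.t ≤ S.Co := by rw [hCo]; nlinarith
  have hMp : (0 : ℤ) < S.M := by rw [hM]; positivity
  have h2 : (S.M : ℤ) * (3 * S.t) ≤ S.M * S.Co := by
    apply mul_le_mul_of_nonneg_left _ hMp.le; nlinarith
  have h3 : (S.N : ℤ) * (S.t * (S.q + 1)) ≤ S.M * S.t := by
    rw [hM]
    have : (S.N * S.t : ℤ) * (S.q + 1) ≤ (S.N * S.t) * S.q ^ 2 := mul_le_mul_of_nonneg_left hq1.le (by positivity)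
    nlinarith
  have h4 : (0:ℤ) < S.t * (S.q + 1) := by positivity
  have h5 : (0:ℤ) < S.M * S.t := by positivity
  have h6 : (0:ℤ) < S.N * S.t := by positivity
  unfold G
  nlinarith

theorem no_aff (σ : F ≃ₐ[K] F) (hB : S.Aff (S.Bs σ)) : False := by
  by_cases ht : S.t = 1
  · exact S.no_t1 ht σ hB
  obtain ⟨k, -, hk, hL⟩ := S.exists_k
  have hk := hk ht
  obtain ⟨m, hV, h0, hmin⟩ := S.exists_min ht hk
  obtain ⟨g, hg⟩ : ∃ g, g = S.La k (S.mono m) := ⟨_, rfl⟩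
  have hgA : g ∈ S.A := hg ▸ S.La_A k (S.mono_mem m)
  have hDz : S.D S.z = 1 := S.hDz
  have hfix : ∀ s, S.Sm s → s g = g := by
    intro s hs
    have h1 := hs.mono m
    have hsA : s (S.mono m) - S.mono m ∈ S.A := by
      apply S.mem_A
      intro B hB
      apply sub_mem _ (hB.A (S.mono_mem m))
      have hB' : S.Aff (B.comap (s : F →+* F)) := ⟨fun k => by
        rw [ValuationSubring.mem_comap]; change s _ ∈ B; rw [AlgEquiv.commutes]; exact hB.hK k, by
        rw [ValuationSubring.mem_comap]; change s _ ∈ B; rw [hs.1]; exact hB.hz⟩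
      exact hB'.A (S.mono_mem m)
    have h2 := hmin _ hsA h1
    have h3 := S.La_sig k s (S.mono m)
    rw [hs.1, hDz, one_mul, one_mul, ← hg] at h3
    rw [← h3]
    have h4 := S.La_add k (s (S.mono m) - S.mono m) (S.mono m)
    rw [sub_add_cancel, h2, zero_add, ← hg] at h4
    exact h4
  obtain ⟨R, hR⟩ := S.Az_poly (S.fix_mem_Az hgA hfix)
  have hg0 : g ≠ 0 := hg ▸ h0
  have hR0 : R ≠ 0 := by rintro rfl; simp at hR; exact hg0 hR
  obtain ⟨δ, hδ⟩ := S.exists_prim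
  obtain ⟨τ, hx, hy, hz⟩ := S.exists_c hδ.pow_eq_one
  have hδ0 : δ ≠ 0 := hδ.ne_zero S.Co_pos.ne'
  obtain ⟨ε, hε⟩ : ∃ ε : K, τ g = algebraMap K F ε * g := by
    have h1 := S.La_sig k τ (S.mono m)
    have h2 : S.D (τ S.z) = algebraMap K F δ := by
      rw [hz, Derivation.leibniz, hDz]; simp
    obtain ⟨μ, hμ⟩ : ∃ μ : K, τ (S.mono m) = algebraMap K F μ * S.mono m := by
      refine ⟨(δ ^ (S.t * (S.q + 1))) ^ m.1.1 * (δ ^ S.t) ^ m.1.2.1 * δ ^ m.1.2.2, ?_⟩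
      simp only [Cv.mono, map_mul, map_pow, hx, hy, hz]; ring
    rw [h2, hμ, ← mul_assoc, ← map_mul, ← hg] at h1
    obtain ⟨b, -, hb⟩ := S.La_K k (δ * μ) (S.mono m)
    rw [hb, ← hg] at h1
    refine ⟨δ⁻¹ * b, ?_⟩
    have h3 : algebraMap K F δ ≠ 0 := by simpa using hδ0
    rw [map_mul, mul_assoc, h1, map_inv₀, ← mul_assoc, inv_mul_cancel₀ h3, one_mul]
  have hcoef : ∀ n, R.coeff n * δ ^ n = ε * R.coeff n := by
    have h1 : Polynomial.aeval S.z (R.comp (Polynomial.C δ * Polynomial.X) - Polynomial.C ε * R) = 0 := by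
      rw [map_sub, Polynomial.aeval_comp, map_mul, map_mul, Polynomial.aeval_C, Polynomial.aeval_C, Polynomial.aeval_X, ← hR, ← hz, ← hε, hR]
      rw [sub_eq_zero]
      exact Polynomial.aeval_algHom_apply (τ : F →ₐ[K] F) S.z R
    have h2 := transcendental_iff.1 S.htr _ h1
    intro n
    have := congrArg (fun P => Polynomial.coeff P n) h2
    simp only [Polynomial.coeff_sub, Polynomial.coeff_C_mul, Polynomial.comp_C_mul_X_coeff, Polynomial.coeff_zero] at this
    exact sub_eq_zero.1 this
  have hdeg : R.natDegree < S.Co := by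
    have h1 : S.dE g (R.natDegree * S.M) := by
      have hlead : S.dE (algebraMap K F R.leadingCoeff * S.z ^ R.natDegree) (R.natDegree * S.M) := by
        have := (S.dE_const (Polynomial.leadingCoeff_ne_zero.2 hR0)).mul (S.dE_z.pow R.natDegree)
        simpa using this
      rw [hR, Polynomial.aeval_eq_sum_range, Finset.sum_range_succ, add_comm]
      have hMp : (0 : ℤ) < S.M := by exact_mod_cast S.M_pos
      refine (show S.dE (R.coeff R.natDegree • S.z ^ R.natDegree) _ by rw [Algebra.smul_def]; exact hlead).add (e := R.natDegree * S.M - 1) (dL.sum ?_) (by omega)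
      intro i hi
      rw [Algebra.smul_def]
      apply ((S.dE_z.L.pow i).const_mul _).mono
      have hi' : (i : ℤ) + 1 ≤ R.natDegree := by have := Finset.mem_range.1 hi; exact_mod_cast this
      nlinarith
    have h2 : S.dL g (S.G - 1) := hg ▸ S.La_dL k (S.mem_V.1 hV).2
    have h3 := h1.le h2
    have h4 := S.G_lt
    have hMp : (0 : ℤ) < S.M := by exact_mod_cast S.M_pos
    by_contra hc
    push Not at hc
    have hc' : (S.Co : ℤ) ≤ R.natDegree := by exact_mod_cast hc
    nlinarith
  have hmono : R = Polynomial.monomial R.natDegree R.leadingCoeff := by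
    ext n
    rw [Polynomial.coeff_monomial]
    split_ifs with h
    · rw [← h]; rfl
    · by_contra hne
      have hn : n ≤ R.natDegree := Polynomial.le_natDegree_of_ne_zero hne
      have h1 := hcoef n
      have h2 := hcoef R.natDegree
      rw [mul_comm] at h1 h2
      have h1' := mul_right_cancel₀ hne h1
      have h2' := mul_right_cancel₀ (Polynomial.leadingCoeff_ne_zero.2 hR0) h2
      exact h (hδ.pow_inj (by omega) hdeg (h1'.trans h2'.symm)).symm
  have hv := S.key9 hL σ hB hV
  rw [← hg, hR, hmono, Polynomial.aeval_monomial, map_mul, val_const hB.hK (Polynomial.leadingCoeff_ne_zero.2 hR0), one_mul, map_pow] at hv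
  refine S.no_z ht hk hL σ hB ?_
  by_contra hc
  push Not at hc
  exact not_lt.2 (one_le_pow₀ hc) hv

theorem Bs_eq (σ : F ≃ₐ[K] F) : S.Bs σ = S.Vinf := by
  rcases S.aff_or (V := S.Bs σ) (fun k => by rw [mem_Bs, AlgEquiv.commutes]; exact S.Vinf_K k) with h | h
  · exact (S.no_aff σ h).elim
  · exact h

theorem sig_Vinf (σ : F ≃ₐ[K] F) (f : F) : σ f ∈ S.Vinf ↔ f ∈ S.Vinf := by
  rw [← S.mem_Bs, S.Bs_eq]

theorem sig_dL0 (σ : F ≃ₐ[K] F) (f : F) : S.dL (σ f) 0 ↔ S.dL f 0 := by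
  rw [← S.mem_Vinf, ← S.mem_Vinf, S.sig_Vinf]

theorem sig_dE0 (σ : F ≃ₐ[K] F) {f : F} (h : S.dE f 0) : S.dE (σ f) 0 := by
  have h1 := (S.sig_dL0 σ f).2 h.L
  have h2 := (S.sig_dL0 σ f⁻¹).2 (by simpa using h.inv.L)
  have h0 : σ f ≠ 0 := by simpa using h.ne_zero
  obtain ⟨d, hd⟩ := S.exists_dE h0
  have h3 := hd.le h1
  rw [map_inv₀] at h2
  have h4 := hd.inv.le h2
  have : d = 0 := by omega
  rwa [this] at hd

theorem sig_scale (σ : F ≃ₐ[K] F) : ∃ u : ℤ, ∀ f d, S.dE f d → S.dE (σ f) (d * u) := by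
  have h0 : σ S.tau ≠ 0 := by simpa using S.tau_dE.ne_zero
  obtain ⟨u, hu⟩ := S.exists_dE h0
  refine ⟨-u, fun f d hf => ?_⟩
  have h1 : S.dE (f * S.tau ^ d) 0 := by
    have := hf.mul (S.tau_dE.zpow d); simpa using this
  have h2 := (S.sig_dE0 σ h1).mul (hu.zpow (-d))
  rw [map_mul, map_zpow₀, mul_assoc, ← zpow_add₀ h0] at h2
  simpa using h2

theorem sig_dE (σ : F ≃ₐ[K] F) {f : F} {d : ℤ} (h : S.dE f d) : S.dE (σ f) d := by
  obtain ⟨u, hu⟩ := S.sig_scale σ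
  obtain ⟨v, hv⟩ := S.sig_scale σ.symm
  have h1 := hu _ _ (hv _ _ S.tau_dE)
  rw [AlgEquiv.apply_symm_apply] at h1
  have h2 := h1.unique S.tau_dE
  have h3 : v * u = 1 := by linarith
  have h5 : S.dL (σ S.tau) 0 := (S.sig_dL0 σ _).2 (S.tau_dE.L.mono (by norm_num))
  have h6 := (hu _ _ S.tau_dE).le h5
  have h7 : u = 1 := by
    rcases Int.isUnit_iff.1 (IsUnit.of_mul_eq_one v (by linarith : u * v = 1)) with h | h
    · exact h
    · omega
  have := hu _ _ h
  rwa [h7, mul_one] at this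

theorem sig_A (σ : F ≃ₐ[K] F) {f : F} (h : f ∈ S.A) : σ f ∈ S.A := by
  apply S.mem_A
  intro B hB
  have hK : ∀ k : K, algebraMap K F k ∈ B.comap (σ : F →+* F) := fun k => by
    rw [ValuationSubring.mem_comap]; change σ _ ∈ B; rw [AlgEquiv.commutes]; exact hB.hK k
  rcases S.aff_or hK with h1 | h1
  · exact h1.A h
  · exfalso
    apply S.Vinf_z
    have : (S.Vinf : ValuationSubring F) = B := by
      rw [← S.Bs_eq σ.symm]
      ext f
      rw [mem_Bs, ← h1, ValuationSubring.mem_comap]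
      change σ (σ.symm f) ∈ B ↔ _
      rw [AlgEquiv.apply_symm_apply]
    rw [this]; exact hB.hz

end fin9
end Cv
end

set_option linter.all false
noncomputable section
namespace Cv
section stab
variable {p : ℕ} [hp : Fact p.Prime] {K F : Type} [Field K] [Field F] [Algebra K F] (S : Cv p K F)

theorem mem_sub (W : Submodule K F) {f : F} (hf : f ∈ S.A) {d : ℤ} (hd : S.dL f d)
    (h : ∀ m : S.Idx, (S.wt m : ℤ) ≤ d → S.mono m ∈ W) : f ∈ W := by
  obtain ⟨a, rfl⟩ := S.exists_lc hf
  rw [S.lc_eq]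
  refine Submodule.sum_mem _ fun m hm => ?_
  rw [← Algebra.smul_def]
  exact W.smul_mem _ (h m (S.dL_lc.1 hd m hm))

theorem dE_aeval {R : Polynomial K} (hR0 : R ≠ 0) : S.dE (Polynomial.aeval S.z R) (R.natDegree * S.M) := by
  have hlead : S.dE (algebraMap K F R.leadingCoeff * S.z ^ R.natDegree) (R.natDegree * S.M) := by
    have := (S.dE_const (Polynomial.leadingCoeff_ne_zero.2 hR0)).mul (S.dE_z.pow R.natDegree)
    simpa using this
  rw [Polynomial.aeval_eq_sum_range, Finset.sum_range_succ, add_comm]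
  have hMp : (0 : ℤ) < S.M := by exact_mod_cast S.M_pos
  refine (show S.dE (R.coeff R.natDegree • S.z ^ R.natDegree) _ by rw [Algebra.smul_def]; exact hlead).add (e := R.natDegree * S.M - 1) (dL.sum ?_) (by omega)
  intro i hi
  rw [Algebra.smul_def]
  apply ((S.dE_z.L.pow i).const_mul _).mono
  have hi' : (i : ℤ) + 1 ≤ R.natDegree := by have := Finset.mem_range.1 hi; exact_mod_cast this
  nlinarith

theorem alg_const [IsAlgClosed K] {P : Polynomial K} (hP : P ≠ 0) {w : F} (h : Polynomial.aeval w P = 0) :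
    ∃ k : K, w = algebraMap K F k := by
  have hi : IsIntegral K w := isAlgebraic_iff_isIntegral.1 ⟨P, hP, h⟩
  have h1 := IsAlgClosed.degree_eq_one_of_irreducible K (minpoly.irreducible hi)
  obtain ⟨k, hk⟩ := minpoly.mem_range_of_degree_eq_one K w h1
  exact ⟨k, hk.symm⟩

variable [IsAlgClosed K]
theorem const_q2 {w : F} (h : w ^ S.q ^ 2 = w) : ∃ k : K, w = algebraMap K F k ∧ k ^ S.q ^ 2 = k := by
  have h1 : 1 < S.q ^ 2 := by have := S.q2_gt; have := S.two_le_q; omega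
  obtain ⟨k, hk⟩ := alg_const (FiniteField.X_pow_card_sub_X_ne_zero K h1) (w := w) (by simp [h])
  refine ⟨k, hk, ?_⟩
  rw [hk, ← map_pow] at h
  exact (algebraMap K F).injective h
theorem const_Tr {w : F} {v : K} (h : S.Tr w = algebraMap K F v) : ∃ k : K, w = algebraMap K F k ∧ S.Tr k = v := by
  obtain ⟨hm, hd⟩ := TrP_monic (R := K) S.qb S.e S.two_le_qb S.he v
  obtain ⟨k, hk⟩ := alg_const hm.ne_zero (w := w) (by
    unfold Tr at h
    simp [h])
  refine ⟨k, hk, ?_⟩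
  rw [hk, S.Tr_map] at h
  exact (algebraMap K F).injective h
theorem const_t {w : F} {β : K} {t : ℕ} (ht : 0 < t) (h : w ^ t = algebraMap K F β) : ∃ k : K, w = algebraMap K F k ∧ k ^ t = β := by
  obtain ⟨k, hk⟩ := alg_const (Polynomial.X_pow_sub_C_ne_zero ht β) (w := w) (by simp [h])
  refine ⟨k, hk, ?_⟩
  rw [hk, ← map_pow] at h
  exact (algebraMap K F).injective h

variable [CharP F p]

/-- conclusion about one automorphism -/
def Frm (σ : F ≃ₐ[K] F) : Prop := ∃ δ γ : K, δ ^ S.Co = 1 ∧ γ ^ S.q ^ 2 = γ ∧ σ S.z = algebraMap K F δ * S.z ∧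
  σ S.y = algebraMap K F (δ ^ S.t) * S.y + algebraMap K F γ

theorem sig_zt (σ : F ≃ₐ[K] F) : (σ S.z) ^ S.t = (σ S.y) ^ S.q ^ 2 - σ S.y := by
  have := congrArg σ S.hzt
  simpa using this
theorem sig_Tr (σ : F ≃ₐ[K] F) : S.Tr (σ S.x) = algebraMap K F S.c * (σ S.y) ^ (S.q + 1) := by
  have := congrArg σ S.Tr_x
  unfold Tr at this ⊢
  simpa using this

theorem transc_lin {a b : K} (h : algebraMap K F a * S.z ^ S.t + algebraMap K F b = 0) : a = 0 ∧ b = 0 := by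
  have ht := S.t_pos
  have := transcendental_iff.1 S.htr (Polynomial.C a * Polynomial.X ^ S.t + Polynomial.C b) (by simpa using h)
  constructor
  · have h1 := congrArg (fun P => Polynomial.coeff P S.t) this
    simpa [Polynomial.coeff_C, ht.ne'] using h1
  · have h1 := congrArg (fun P => Polynomial.coeff P 0) this
    simpa [Polynomial.coeff_X_pow, ht.ne] using h1

/-- common end -/
theorem frm_end (σ : F ≃ₐ[K] F) {δ β γ : K} (hz : σ S.z = algebraMap K F δ * S.z)
    (hy : σ S.y = algebraMap K F β * S.y + algebraMap K F γ) :
    δ ≠ 0 ∧ δ ^ S.t = β ∧ β ^ S.q ^ 2 = β ∧ γ ^ S.q ^ 2 = γ := by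
  have hδ : δ ≠ 0 := by
    rintro rfl
    rw [map_zero, zero_mul] at hz
    exact S.z0 (by simpa using hz)
  have h := S.sig_zt σ
  rw [hz, hy, S.add_q2, mul_pow, mul_pow] at h
  have hq : S.y ^ S.q ^ 2 = S.z ^ S.t + S.y := by rw [S.hzt]; ring
  rw [hq] at h
  have h2 := S.T2 (Polynomial.C (algebraMap K F (β ^ S.q ^ 2 - β)) * Polynomial.X + Polynomial.C (algebraMap K F (β ^ S.q ^ 2 - δ ^ S.t) * S.z ^ S.t + algebraMap K F (γ ^ S.q ^ 2 - γ))) (by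
      refine lt_of_le_of_lt Polynomial.degree_linear_le ?_
      have h1 : 1 < S.q ^ 2 := by have := S.q2_gt; have := S.two_le_q; omega
      exact_mod_cast h1) (by
      intro i
      simp only [Polynomial.coeff_add, Polynomial.coeff_C_mul, Polynomial.coeff_X, Polynomial.coeff_C]
      apply add_mem
      · exact mul_mem (Subalgebra.algebraMap_mem _ _) (by split_ifs; exacts [one_mem _, zero_mem _])
      · split_ifs
        · exact add_mem (mul_mem (Subalgebra.algebraMap_mem _ _) (pow_mem S.Az_z _)) (Subalgebra.algebraMap_mem _ _)
        · exact zero_mem _) (by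
      simp only [Polynomial.eval_add, Polynomial.eval_mul, Polynomial.eval_C, Polynomial.eval_X]
      simp only [map_sub, map_pow]
      linear_combination -h)
  have h3 := congrArg (fun P => Polynomial.coeff P 1) h2
  have h4 := congrArg (fun P => Polynomial.coeff P 0) h2
  simp only [Polynomial.coeff_add, Polynomial.coeff_C_mul, Polynomial.coeff_X_one, Polynomial.coeff_C_succ, Polynomial.coeff_C_zero, Polynomial.coeff_zero, Polynomial.coeff_X_zero, mul_one, mul_zero, add_zero, zero_add] at h3 h4
  have h5 : β ^ S.q ^ 2 - β = 0 := (map_eq_zero _).1 h3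
  obtain ⟨h6, h7⟩ := S.transc_lin h4
  have h5 := sub_eq_zero.1 h5
  exact ⟨hδ, by rw [← sub_eq_zero.1 h6, h5], h5, sub_eq_zero.1 h7⟩

theorem frm_N1 (hN : S.N = 1) (σ : F ≃ₐ[K] F) {δ β γ : K} (hz : σ S.z = algebraMap K F δ * S.z)
    (hy : σ S.y = algebraMap K F β * S.y + algebraMap K F γ) : S.Frm σ := by
  obtain ⟨h0, h1, h2, h3⟩ := S.frm_end σ hz hy
  refine ⟨δ, γ, ?_, h3, hz, by rw [h1, hy]⟩
  have hb : S.q = S.qb := by rw [S.q_eq, hN, one_mul]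
  have hβ : β ≠ 0 := h1 ▸ pow_ne_zero _ h0
  unfold Co
  rw [← hb, ← mul_assoc, mul_comm, pow_mul, h1]
  have h4 : (S.q + 1) * (S.q - 1) = S.q ^ 2 - 1 := by rw [← Nat.sq_sub_sq, one_pow]
  rw [h4]
  have h5 : 1 ≤ S.q ^ 2 := Nat.one_le_pow _ _ (by have := S.two_le_q; omega)
  apply mul_right_cancel₀ hβ
  rw [← pow_succ, Nat.sub_add_cancel h5, h2, one_mul]

theorem wt_N1 (hN : S.N = 1) (m : S.Idx) : m.1.1 = 0 ∧ S.wt m = m.1.2.1 * S.t + m.1.2.2 * S.q ^ 2 := by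
  have h1 : m.1.1 = 0 := by have := m.2.1; omega
  refine ⟨h1, ?_⟩
  unfold wt M; simp only [h1, hN]; ring

theorem q2_ne_t : ¬ S.q ^ 2 ∣ S.t := by
  intro h
  exact (Nat.Prime.coprime_iff_not_dvd hp.out).1 S.cop_p_t ((dvd_pow S.p_dvd_q two_ne_zero).trans h)

/-- case N = 1, t < q^2 -/
theorem frm_a (hN : S.N = 1) (ht : S.t < S.q ^ 2) (σ : F ≃ₐ[K] F) : S.Frm σ := by
  have ht3 := S.t_of_N hN
  -- sigma y
  have hy : σ S.y ∈ Submodule.span K {S.y, 1} := by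
    refine S.mem_sub _ (S.sig_A σ S.y_mem) (S.sig_dE σ S.dE_y).L fun m hm => ?_
    obtain ⟨h1, h2⟩ := S.wt_N1 hN m
    rw [h2] at hm
    have hm' : m.1.2.1 * S.t + m.1.2.2 * S.q ^ 2 ≤ S.t := by
      have h5 : ((S.N : ℤ) * S.t) = S.t := by rw [hN]; simp
      rw [h5] at hm; exact_mod_cast hm
    have h3 : m.1.2.2 = 0 := by
      by_contra h; have : 1 ≤ m.1.2.2 := Nat.one_le_iff_ne_zero.2 h; nlinarith
    have h4 : m.1.2.1 ≤ 1 := by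
      by_contra h; push Not at h; nlinarith
    unfold mono
    rw [h1, h3]
    interval_cases h5 : m.1.2.1
    · simp; exact Submodule.subset_span (by simp)
    · simp; exact Submodule.subset_span (by simp)
  obtain ⟨β, γ, hy⟩ := Submodule.mem_span_pair.1 hy
  rw [Algebra.smul_def, Algebra.smul_def, mul_one] at hy
  -- root of unity
  obtain ⟨η, hη⟩ := S.exists_prim
  obtain ⟨ζ, hζ1, hζ⟩ : ∃ ζ : K, ζ ≠ 1 ∧ ζ ^ S.t = 1 := by
    have := hη.pow S.Co_pos (show S.Co = ((S.q + 1) * (S.qb - 1)) * S.t by unfold Co; ring)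
    exact ⟨_, this.ne_one (by omega), this.pow_eq_one⟩
  obtain ⟨τ, -, hτy, hτz⟩ := S.exists_c (δ := ζ) (by unfold Co; rw [← mul_assoc, mul_comm, pow_mul, hζ, one_pow])
  rw [hζ, map_one, one_mul] at hτy
  let Fx : Submodule K F := LinearMap.eqLocus (τ : F →ₐ[K] F).toLinearMap LinearMap.id
  have hFx : ∀ f, f ∈ Fx ↔ τ f = f := fun f => Iff.rfl
  have hz : σ S.z ∈ Submodule.span K {S.z} ⊔ Fx := by
    refine S.mem_sub _ (S.sig_A σ S.z_mem) (S.sig_dE σ S.dE_z).L fun m hm => ?_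
    obtain ⟨h1, h2⟩ := S.wt_N1 hN m
    have hM : S.M = S.q ^ 2 := by unfold M; rw [hN, one_mul]
    rw [h2, hM] at hm
    have hm' : m.1.2.1 * S.t + m.1.2.2 * S.q ^ 2 ≤ S.q ^ 2 := by exact_mod_cast hm
    have h3 : m.1.2.2 ≤ 1 := by
      by_contra h; push Not at h; nlinarith
    unfold mono
    rw [h1]
    interval_cases h5 : m.1.2.2
    · apply Submodule.mem_sup_right
      rw [hFx]; simp [hτy]
    · have : m.1.2.1 = 0 := by
        by_contra h; have : 1 ≤ m.1.2.1 := Nat.one_le_iff_ne_zero.2 h; nlinarith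
      rw [this]; simp
      exact Submodule.mem_sup_left (Submodule.mem_span_singleton_self _)
  obtain ⟨w, hw, Q, hQ, hz⟩ := Submodule.mem_sup.1 hz
  obtain ⟨δ, rfl⟩ := Submodule.mem_span_singleton.1 hw
  rw [Algebra.smul_def] at hz
  rw [hFx] at hQ
  have hz0 : σ S.z ≠ 0 := by simpa using S.z0
  -- ratio
  obtain ⟨ζ', hr, -⟩ : ∃ k : K, τ (σ S.z) / σ S.z = algebraMap K F k ∧ k ^ S.t = 1 := by
    apply const_t S.t_pos
    rw [div_pow, ← map_pow, S.sig_zt σ, ← hy]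
    have : τ ((algebraMap K F β * S.y + algebraMap K F γ) ^ S.q ^ 2 - (algebraMap K F β * S.y + algebraMap K F γ)) = ((algebraMap K F β * S.y + algebraMap K F γ) ^ S.q ^ 2 - (algebraMap K F β * S.y + algebraMap K F γ)) := by
      simp [hτy]
    rw [this, map_one, div_self]
    rw [hy, ← S.sig_zt σ]; exact pow_ne_zero _ hz0
  rw [div_eq_iff hz0, ← hz] at hr
  simp only [map_add, map_mul, hQ, hτz, AlgEquiv.commutes] at hr
  -- δ(ζ-ζ') z = (ζ'-1) Q
  have h1 : algebraMap K F (δ * (ζ - ζ')) * S.z = algebraMap K F (ζ' - 1) * Q := by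
    simp only [map_mul, map_sub, map_one]; linear_combination hr
  have h2 := congrArg τ h1
  simp only [map_mul, hQ, hτz, AlgEquiv.commutes] at h2
  have h3 : algebraMap K F (δ * (ζ - ζ') * (ζ - 1)) * S.z = 0 := by
    simp only [map_mul, map_sub, map_one] at h1 h2 ⊢; linear_combination h2 - h1
  have h4 : δ * (ζ - ζ') * (ζ - 1) = 0 := by
    rcases mul_eq_zero.1 h3 with h | h
    · exact (map_eq_zero _).1 h
    · exact (S.z0 h).elim
  have h5 : δ * (ζ - ζ') = 0 := (mul_eq_zero.1 h4).resolve_right (sub_ne_zero.2 hζ1)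
  have hQ0 : Q = 0 := by
    rw [h5, map_zero, zero_mul] at h1
    rcases mul_eq_zero.1 h1.symm with h | h
    · have h6 : ζ' - 1 = 0 := (map_eq_zero _).1 h
      rcases mul_eq_zero.1 h5 with h7 | h7
      · -- δ = 0 : then σ z = Q fixed, in A with...
        exfalso
        rw [h7, map_zero, zero_mul, zero_add] at hz
        have he : S.e = 1 := S.N_eq_one_iff.1 hN
        have hx := S.sig_Tr σ
        have hTr : S.Tr (σ S.x) = σ S.x := by unfold Tr; rw [he]; simp
        rw [hTr] at hx
        have hty : τ (σ S.y) = σ S.y := by rw [← hy]; simp [hτy]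
        have hst : τ * σ = σ := S.ext3' (by rw [AlgEquiv.mul_apply, hx]; simp [hty]) hty
          (by rw [AlgEquiv.mul_apply, ← hz, hQ])
        have hτ1 : τ = 1 := by simpa using hst
        rw [hτ1, AlgEquiv.one_apply] at hτz
        have h8 : algebraMap K F (ζ - 1) * S.z = 0 := by rw [map_sub, map_one]; linear_combination -hτz
        rcases mul_eq_zero.1 h8 with h | h
        · exact sub_ne_zero.2 hζ1 ((map_eq_zero _).1 h)
        · exact S.z0 h
      · exact (hζ1 (by linear_combination h6 + h7)).elim
    · exact h
  rw [hQ0, add_zero] at hz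
  exact S.frm_N1 hN σ hz.symm hy.symm
end stab
end Cv
end

set_option linter.all false
noncomputable section
namespace Cv
section stab2
variable {p : ℕ} [hp : Fact p.Prime] {K F : Type} [Field K] [Field F] [Algebra K F] (S : Cv p K F)

theorem coeff_pp {R : Type} [CommRing R] [CharP R p] (G : Polynomial R) (n k : ℕ) :
    (G ^ p ^ n).coeff k = if p ^ n ∣ k then (G.coeff (k / p ^ n)) ^ p ^ n else 0 := by
  rw [← Polynomial.map_iterateFrobenius_expand, Polynomial.coeff_map, Polynomial.coeff_expand (pow_pos hp.out.pos n)]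
  split_ifs
  · rw [iterateFrobenius_def]
  · rw [map_zero]

variable [IsAlgClosed K] [CharP F p]

theorem T2lin {u : K} {v : F} (hv : v ∈ S.Az) (h : algebraMap K F u * S.y + v = 0) : u = 0 ∧ v = 0 := by
  have h2 := S.T2 (Polynomial.C (algebraMap K F u) * Polynomial.X + Polynomial.C v) (by
      refine lt_of_le_of_lt Polynomial.degree_linear_le ?_
      have h1 : 1 < S.q ^ 2 := by have := S.q2_gt; have := S.two_le_q; omega
      exact_mod_cast h1) (by
      intro i
      simp only [Polynomial.coeff_add, Polynomial.coeff_C_mul, Polynomial.coeff_X, Polynomial.coeff_C]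
      apply add_mem
      · exact mul_mem (Subalgebra.algebraMap_mem _ _) (by split_ifs; exacts [one_mem _, zero_mem _])
      · split_ifs
        · exact hv
        · exact zero_mem _) (by simpa using h)
  have h3 := congrArg (fun P => Polynomial.coeff P 1) h2
  have h4 := congrArg (fun P => Polynomial.coeff P 0) h2
  simp only [Polynomial.coeff_add, Polynomial.coeff_C_mul, Polynomial.coeff_X_one, Polynomial.coeff_C_succ, Polynomial.coeff_C_zero, Polynomial.coeff_zero, Polynomial.coeff_X_zero, mul_one, mul_zero, add_zero, zero_add] at h3 h4
  exact ⟨(map_eq_zero _).1 h3, h4⟩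

theorem frm_b (hN : S.N = 1) (ht : S.q ^ 2 < S.t) (σ : F ≃ₐ[K] F) : S.Frm σ := by
  have hcK : CharP K p := cK (F := F)
  have hM : S.M = S.q ^ 2 := by unfold M; rw [hN, one_mul]
  have hq4 : 4 ≤ S.q ^ 2 := by have := S.two_le_q; nlinarith
  have hz : σ S.z ∈ Submodule.span K {S.z, 1} := by
    refine S.mem_sub _ (S.sig_A σ S.z_mem) (S.sig_dE σ S.dE_z).L fun m hm => ?_
    obtain ⟨h1, h2⟩ := S.wt_N1 hN m
    rw [h2, hM] at hm
    have hm' : m.1.2.1 * S.t + m.1.2.2 * S.q ^ 2 ≤ S.q ^ 2 := by exact_mod_cast hm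
    have h3 : m.1.2.1 = 0 := by
      by_contra h; have : 1 ≤ m.1.2.1 := Nat.one_le_iff_ne_zero.2 h; nlinarith
    have h4 : m.1.2.2 ≤ 1 := by
      by_contra h; push Not at h; nlinarith
    unfold mono
    rw [h1, h3]
    interval_cases h5 : m.1.2.2
    · simp; exact Submodule.subset_span (by simp)
    · simp; exact Submodule.subset_span (by simp)
  obtain ⟨δ, ε, hz⟩ := Submodule.mem_span_pair.1 hz
  rw [Algebra.smul_def, Algebra.smul_def, mul_one] at hz
  have hy : σ S.y ∈ Submodule.span K {S.y} ⊔ Subalgebra.toSubmodule S.Az := by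
    refine S.mem_sub _ (S.sig_A σ S.y_mem) (S.sig_dE σ S.dE_y).L fun m hm => ?_
    obtain ⟨h1, h2⟩ := S.wt_N1 hN m
    rw [h2] at hm
    have hm' : m.1.2.1 * S.t + m.1.2.2 * S.q ^ 2 ≤ S.t := by
      have h5 : ((S.N : ℤ) * S.t) = S.t := by rw [hN]; simp
      rw [h5] at hm; exact_mod_cast hm
    have h3 : m.1.2.1 ≤ 1 := by
      by_contra h; push Not at h; nlinarith
    unfold mono
    rw [h1]
    interval_cases h5 : m.1.2.1
    · apply Submodule.mem_sup_right
      simp; exact pow_mem S.Az_z _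
    · have h6 : m.1.2.2 = 0 := by
        by_contra h; have : 1 ≤ m.1.2.2 := Nat.one_le_iff_ne_zero.2 h; nlinarith
      rw [h6]; simp
      exact Submodule.mem_sup_left (Submodule.mem_span_singleton_self _)
  obtain ⟨w, hw, Pz, hPz, hy⟩ := Submodule.mem_sup.1 hy
  obtain ⟨β, rfl⟩ := Submodule.mem_span_singleton.1 hw
  rw [Algebra.smul_def] at hy
  rw [Subalgebra.mem_toSubmodule] at hPz
  have hδ : δ ≠ 0 := by
    rintro rfl
    rw [map_zero, zero_mul, zero_add] at hz
    have h1 := S.sig_dE σ S.dE_z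
    rw [← hz] at h1
    have := h1.le (S.dL_const ε)
    rw [hM] at this
    have h2 : (4 : ℤ) ≤ ((S.q ^ 2 : ℕ) : ℤ) := by exact_mod_cast hq4
    omega
  have h := S.sig_zt σ
  rw [← hz, ← hy, S.add_q2, mul_pow] at h
  have hq : S.y ^ S.q ^ 2 = S.z ^ S.t + S.y := by rw [S.hzt]; ring
  rw [hq] at h
  obtain ⟨h1, h2⟩ := S.T2lin (u := β ^ S.q ^ 2 - β) (v := algebraMap K F (β ^ S.q ^ 2) * S.z ^ S.t + Pz ^ S.q ^ 2 - Pz - (algebraMap K F δ * S.z + algebraMap K F ε) ^ S.t)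
    (sub_mem (sub_mem (add_mem (mul_mem (Subalgebra.algebraMap_mem _ _) (pow_mem S.Az_z _)) (pow_mem hPz _)) hPz)
      (pow_mem (add_mem (mul_mem (Subalgebra.algebraMap_mem _ _) S.Az_z) (Subalgebra.algebraMap_mem _ _)) _))
    (by simp only [map_sub, map_pow]; linear_combination -h)
  have h1 := sub_eq_zero.1 h1
  rw [h1] at h2
  obtain ⟨P, rfl⟩ := S.Az_poly hPz
  have hdeg : P.natDegree < S.t - 1 := by
    by_cases hP0 : P = 0
    · rw [hP0]; simp; omega
    have h3 := S.dE_aeval hP0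
    have h4 : S.dL (Polynomial.aeval S.z P) (S.N * S.t) := by
      have := (S.sig_dE σ S.dE_y).L.sub (S.dE_y.L.const_mul β)
      rw [← hy, add_sub_cancel_left] at this
      exact this
    have h5 := h3.le h4
    rw [hN, hM] at h5
    have h6 : P.natDegree * S.q ^ 2 ≤ 1 * S.t := by exact_mod_cast h5
    have h7 : P.natDegree * 4 ≤ P.natDegree * S.q ^ 2 := Nat.mul_le_mul_left _ hq4
    omega
  have hpoly : Polynomial.C β * Polynomial.X ^ S.t + P ^ S.q ^ 2 - P - (Polynomial.C δ * (Polynomial.X + Polynomial.C (ε / δ))) ^ S.t = 0 := by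
    apply transcendental_iff.1 S.htr
    simp only [map_sub, map_add, map_mul, map_pow, Polynomial.aeval_C, Polynomial.aeval_X]
    rw [← h2, mul_add, ← map_mul (algebraMap K F) δ, mul_div_cancel₀ _ hδ]
  rw [mul_pow, ← Polynomial.C_pow] at hpoly
  have hq2 : S.q ^ 2 = p ^ (S.b * S.e * 2) := by rw [S.q_powp, ← pow_mul]
  have hpow : ∀ k, ¬ S.q ^ 2 ∣ k → (P ^ S.q ^ 2).coeff k = 0 := by
    intro k hk; rw [hq2] at hk ⊢; rw [coeff_pp, if_neg hk]
  have hct := congrArg (fun P => Polynomial.coeff P S.t) hpoly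
  have hct1 := congrArg (fun P => Polynomial.coeff P (S.t - 1)) hpoly
  simp only [Polynomial.coeff_sub, Polynomial.coeff_add, Polynomial.coeff_C_mul, Polynomial.coeff_X_pow, Polynomial.coeff_X_add_C_pow, Polynomial.coeff_zero] at hct hct1
  rw [hpow _ S.q2_ne_t, Polynomial.coeff_eq_zero_of_natDegree_lt (by omega)] at hct
  rw [hpow _ (S.hcond (S.N_eq_one_iff.1 hN)), Polynomial.coeff_eq_zero_of_natDegree_lt hdeg, if_neg (by omega), Nat.sub_sub_self S.t_pos,
    Nat.choose_symm (by have := S.t_pos; omega : 1 ≤ S.t), Nat.choose_one_right] at hct1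
  simp at hct hct1
  have htK : (S.t : K) ≠ 0 := by
    rw [Ne, CharP.cast_eq_zero_iff K p]
    exact (Nat.Prime.coprime_iff_not_dvd hp.out).1 S.cop_p_t
  have hε : ε = 0 := by
    simpa [hδ, htK] using hct1
  rw [hε, map_zero, add_zero] at hz
  have hβ : β = δ ^ S.t := sub_eq_zero.1 hct
  rw [hε, map_zero, add_zero, hβ, mul_pow, map_pow] at h2
  obtain ⟨γ, hγ, -⟩ := S.const_q2 (w := Polynomial.aeval S.z P) (by linear_combination h2)
  rw [hγ] at hy
  exact S.frm_N1 hN σ hz.symm hy.symm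

/-- polynomials of degree at most qb in y over K[z] -/
def W2 : Submodule K F where
  carrier := {f | ∃ G : Polynomial F, G ∈ Polynomial.lifts (algebraMap S.Az F) ∧ G.natDegree ≤ S.qb ∧ f = G.eval S.y}
  zero_mem' := ⟨0, zero_mem _, by simp, by simp⟩
  add_mem' := by
    rintro f g ⟨G, h1, h2, rfl⟩ ⟨H, h3, h4, rfl⟩
    exact ⟨G + H, add_mem h1 h3, (Polynomial.natDegree_add_le _ _).trans (max_le h2 h4), by simp⟩
  smul_mem' := by
    rintro k f ⟨G, h1, h2, rfl⟩
    refine ⟨Polynomial.C (algebraMap K F k) * G, mul_mem ?_ h1, (Polynomial.natDegree_C_mul_le _ _).trans h2, by simp [Algebra.smul_def]⟩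
    exact Polynomial.C_mem_lifts (algebraMap S.Az F) ⟨algebraMap K F k, Subalgebra.algebraMap_mem _ _⟩

theorem C_lifts {v : F} (hv : v ∈ S.Az) : Polynomial.C v ∈ Polynomial.lifts (algebraMap S.Az F) :=
  Polynomial.C_mem_lifts (algebraMap S.Az F) ⟨v, hv⟩

theorem T2' (P : Polynomial F) (hP : P.natDegree < S.q ^ 2) (hc : P ∈ Polynomial.lifts (algebraMap S.Az F)) (h0 : P.eval S.y = 0) : P = 0 := by
  refine S.T2 P ?_ ?_ h0
  · exact lt_of_le_of_lt Polynomial.degree_le_natDegree (by exact_mod_cast hP)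
  · intro i
    rw [Polynomial.lifts_iff_coeff_lifts] at hc
    obtain ⟨v, hv⟩ := hc i
    rw [← hv]; exact v.2

theorem coeff_qb (G : Polynomial F) (i k : ℕ) :
    (G ^ S.qb ^ i).coeff k = if S.qb ^ i ∣ k then (G.coeff (k / S.qb ^ i)) ^ S.qb ^ i else 0 := by
  have : S.qb ^ i = p ^ (S.b * i) := by unfold qb; rw [pow_mul]
  rw [this, coeff_pp]

theorem neg_N (f : F) : (-f) ^ S.N = - f ^ S.N := by
  have := S.sub_qb (0 : F) f (S.e - 1)
  rw [zero_pow (pow_ne_zero _ (by have := S.two_le_qb; omega)), zero_sub, zero_sub] at this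
  exact this

/-- shape of σ x, σ y when N > 1 -/
theorem shape_c (hN : S.N ≠ 1) (σ : F ≃ₐ[K] F) :
    (∃ β : K, ∃ P ∈ S.Az, σ S.y = algebraMap K F β * S.y + P) ∧
    (∃ α : K, ∃ g ∈ S.W2, σ S.x = algebraMap K F α * S.x + g) := by
  have hN0 := S.N_pos
  have hNq := S.N_lt_q
  have ht := S.t_pos
  have hq2 := S.q1_lt
  have hqe := S.q_eq
  have hqb := S.two_le_qb
  constructor
  · have hy : σ S.y ∈ Submodule.span K {S.y} ⊔ Subalgebra.toSubmodule S.Az := by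
      refine S.mem_sub _ (S.sig_A σ S.y_mem) (S.sig_dE σ S.dE_y).L fun m hm => ?_
      have hm' : m.1.1 * (S.t * (S.q + 1)) + m.1.2.1 * (S.N * S.t) + m.1.2.2 * (S.N * S.q ^ 2) ≤ S.N * S.t := by
        have : S.wt m ≤ S.N * S.t := by exact_mod_cast hm
        unfold wt M at this; exact this
      have h1 : m.1.1 = 0 := by
        by_contra h; have h' : 1 ≤ m.1.1 := Nat.one_le_iff_ne_zero.2 h
        have h2 : 1 * (S.t * (S.q + 1)) ≤ m.1.1 * (S.t * (S.q + 1)) := Nat.mul_le_mul_right _ h'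
        have h3 : S.N * S.t < (S.q + 1) * S.t := Nat.mul_lt_mul_of_pos_right (by omega) ht
        have h4 : 1 * (S.t * (S.q + 1)) = (S.q + 1) * S.t := by ring
        omega
      have hNt : 0 < S.N * S.t := Nat.mul_pos hN0 ht
      have h3 : m.1.2.1 ≤ 1 := by
        by_contra h; push Not at h
        have : 2 * (S.N * S.t) ≤ m.1.2.1 * (S.N * S.t) := Nat.mul_le_mul_right _ h
        omega
      unfold mono
      rw [h1]
      interval_cases h5 : m.1.2.1
      · apply Submodule.mem_sup_right
        simp; exact pow_mem S.Az_z _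
      · have h6 : m.1.2.2 = 0 := by
          by_contra h
          have h7 : 0 < m.1.2.2 * (S.N * S.q ^ 2) := Nat.mul_pos (Nat.pos_of_ne_zero h) (Nat.mul_pos hN0 (by omega))
          omega
        rw [h6]; simp
        exact Submodule.mem_sup_left (Submodule.mem_span_singleton_self _)
    obtain ⟨w, hw, Pz, hPz, hy⟩ := Submodule.mem_sup.1 hy
    obtain ⟨β, rfl⟩ := Submodule.mem_span_singleton.1 hw
    rw [Algebra.smul_def] at hy
    exact ⟨β, Pz, hPz, hy.symm⟩
  · have hx : σ S.x ∈ Submodule.span K {S.x} ⊔ S.W2 := by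
      refine S.mem_sub _ (S.sig_A σ S.x_mem) (S.sig_dE σ S.dE_x).L fun m hm => ?_
      have hm' : m.1.1 * (S.t * (S.q + 1)) + m.1.2.1 * (S.N * S.t) + m.1.2.2 * (S.N * S.q ^ 2) ≤ S.t * (S.q + 1) := by
        have : S.wt m ≤ S.t * (S.q + 1) := by exact_mod_cast hm
        unfold wt M at this; exact this
      have hNt : 0 < S.N * S.t := Nat.mul_pos hN0 ht
      have htq : 0 < S.t * (S.q + 1) := Nat.mul_pos ht (by omega)
      have hMp : 0 < S.N * S.q ^ 2 := Nat.mul_pos hN0 (by omega)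
      have h1 : m.1.1 ≤ 1 := by
        by_contra h; push Not at h
        have : 2 * (S.t * (S.q + 1)) ≤ m.1.1 * (S.t * (S.q + 1)) := Nat.mul_le_mul_right _ h
        omega
      unfold mono
      interval_cases h5 : m.1.1
      · apply Submodule.mem_sup_right
        refine ⟨Polynomial.C (S.z ^ m.1.2.2) * Polynomial.X ^ m.1.2.1, mul_mem (S.C_lifts (pow_mem S.Az_z _)) (Polynomial.X_pow_mem_lifts _ _), (Polynomial.natDegree_C_mul_X_pow_le _ _).trans ?_, by simp; ring⟩
        by_contra h; push Not at h
        have h2 : (S.qb + 1) * (S.N * S.t) ≤ m.1.2.1 * (S.N * S.t) := Nat.mul_le_mul_right _ h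
        have h3 : (S.qb + 1) * (S.N * S.t) = S.t * (S.q + S.N) := by rw [hqe]; ring
        have h4 : S.t * (S.q + 1) < S.t * (S.q + S.N) := Nat.mul_lt_mul_of_pos_left (by omega) ht
        omega
      · have h6 : m.1.2.1 = 0 := by
          by_contra h
          have h7 : 0 < m.1.2.1 * (S.N * S.t) := Nat.mul_pos (Nat.pos_of_ne_zero h) hNt
          omega
        have h7 : m.1.2.2 = 0 := by
          by_contra h
          have h7 : 0 < m.1.2.2 * (S.N * S.q ^ 2) := Nat.mul_pos (Nat.pos_of_ne_zero h) hMp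
          omega
        rw [h6, h7]; simp
        exact Submodule.mem_sup_left (Submodule.mem_span_singleton_self _)
    obtain ⟨w, hw, g, hg, hx⟩ := Submodule.mem_sup.1 hx
    obtain ⟨α, rfl⟩ := Submodule.mem_span_singleton.1 hw
    rw [Algebra.smul_def] at hx
    exact ⟨α, g, hg, hx.symm⟩

theorem Az_le : S.Az ≤ S.Ayz := Algebra.adjoin_mono (by simp)

theorem T1sum {v : F} (hv : v ∈ S.Ayz) {u : ℕ → K} (h : ∑ i ∈ Finset.range (S.e - 1), algebraMap K F (u i) * S.x ^ S.qb ^ i + v = 0) :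
    v = 0 ∧ ∀ i < S.e - 1, u i = 0 := by
  have hqb := S.two_le_qb
  have hcoef : ∀ i < S.e - 1, u i = 0 := by
    have h2 := S.T1 (∑ i ∈ Finset.range (S.e - 1), Polynomial.C (algebraMap K F (u i)) * Polynomial.X ^ S.qb ^ i + Polynomial.C v) (by
      refine lt_of_le_of_lt (Polynomial.degree_add_le _ _) (max_lt ?_ (lt_of_le_of_lt Polynomial.degree_C_le (by exact_mod_cast S.N_pos)))
      refine lt_of_le_of_lt (Polynomial.degree_sum_le _ _) ?_
      rw [Finset.sup_lt_iff (WithBot.bot_lt_coe _)]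
      intro i hi
      refine lt_of_le_of_lt (Polynomial.degree_C_mul_X_pow_le _ _) ?_
      have : S.qb ^ i < S.N := Nat.pow_lt_pow_right (by omega) (Finset.mem_range.1 hi)
      exact_mod_cast this) (by
      intro k
      rw [Polynomial.coeff_add, Polynomial.finset_sum_coeff, Polynomial.coeff_C]
      apply add_mem
      · refine Subalgebra.sum_mem _ fun i _ => ?_
        rw [Polynomial.coeff_C_mul, Polynomial.coeff_X_pow]
        exact mul_mem (Subalgebra.algebraMap_mem _ _) (by split_ifs; exacts [one_mem _, zero_mem _])
      · split_ifs
        · exact hv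
        · exact zero_mem _) (by simpa [Polynomial.eval_finset_sum] using h)
    intro j hj
    have h3 := congrArg (fun P => Polynomial.coeff P (S.qb ^ j)) h2
    simp only [Polynomial.coeff_add, Polynomial.finset_sum_coeff, Polynomial.coeff_C_mul, Polynomial.coeff_X_pow, Polynomial.coeff_C, Polynomial.coeff_zero] at h3
    rw [if_neg (pow_ne_zero _ (by omega)), add_zero, Finset.sum_eq_single j] at h3
    · simpa using h3
    · intro i _ hij
      rw [if_neg, mul_zero]
      intro h; exact hij (Nat.pow_right_injective hqb h).symm
    · intro h; exact (h (Finset.mem_range.2 hj)).elim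
  refine ⟨?_, hcoef⟩
  rw [Finset.sum_eq_zero, zero_add] at h
  · exact h
  · intro i hi; rw [hcoef i (Finset.mem_range.1 hi), map_zero, zero_mul]

theorem frm_c (hN : S.N ≠ 1) (σ : F ≃ₐ[K] F) : S.Frm σ := by
  obtain ⟨⟨β, P, hP, hy⟩, ⟨α, g, hg, hx⟩⟩ := S.shape_c hN σ
  obtain ⟨G, hG, hGd, rfl⟩ := hg
  have hc0 : algebraMap K F S.c ≠ 0 := by simpa using S.hc0
  have hqb := S.two_le_qb
  have he : 2 ≤ S.e := by
    have := S.he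
    rw [Ne, S.N_eq_one_iff] at hN; omega
  have hNN : S.N = S.qb ^ (S.e - 1) := rfl
  have hqq : S.q = S.qb ^ S.e := rfl
  have hqbq : S.qb < S.q := by
    rw [hqq]; calc S.qb = S.qb ^ 1 := (pow_one _).symm
      _ < S.qb ^ S.e := Nat.pow_lt_pow_right (by omega) (by omega)
  have hgA : G.eval S.y ∈ S.Ayz := by
    rw [Polynomial.eval_eq_sum_range]
    refine Subalgebra.sum_mem _ fun i _ => mul_mem ?_ (pow_mem S.Ayz_y _)
    rw [Polynomial.lifts_iff_coeff_lifts] at hG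
    obtain ⟨v, hv⟩ := hG i
    rw [← hv]; exact S.Az_le v.2
  have hTr := S.sig_Tr σ
  rw [hx, S.Tr_add, hy] at hTr
  have hTx : S.Tr (algebraMap K F α * S.x) = ∑ i ∈ Finset.range (S.e - 1), algebraMap K F (α ^ S.qb ^ i - α ^ S.N) * S.x ^ S.qb ^ i + algebraMap K F (α ^ S.N) * (algebraMap K F S.c * S.y ^ (S.q + 1)) := by
    have hs : ∑ i ∈ Finset.range (S.e - 1), algebraMap K F (α ^ S.qb ^ i - α ^ S.N) * S.x ^ S.qb ^ i
      = ∑ i ∈ Finset.range (S.e - 1), algebraMap K F (α ^ S.qb ^ i) * S.x ^ S.qb ^ i - algebraMap K F (α ^ S.N) * ∑ i ∈ Finset.range (S.e - 1), S.x ^ S.qb ^ i := by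
      rw [Finset.mul_sum, ← Finset.sum_sub_distrib]
      apply Finset.sum_congr rfl; intro i _; rw [map_sub]; ring
    have h1 : S.Tr (algebraMap K F α * S.x) = ∑ i ∈ Finset.range (S.e - 1), algebraMap K F (α ^ S.qb ^ i) * S.x ^ S.qb ^ i + algebraMap K F (α ^ S.N) * S.x ^ S.N := by
      unfold Tr
      rw [show S.e = S.e - 1 + 1 by omega, Finset.sum_range_succ, Nat.add_sub_cancel, ← hNN]
      simp only [mul_pow, map_pow]
    rw [h1, hs, S.xN]; ring
  rw [hTx] at hTr
  obtain ⟨hv, hα⟩ := S.T1sum (u := fun i => α ^ S.qb ^ i - α ^ S.N)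
    (v := algebraMap K F (α ^ S.N) * (algebraMap K F S.c * S.y ^ (S.q + 1)) + S.Tr (G.eval S.y) - algebraMap K F S.c * (algebraMap K F β * S.y + P) ^ (S.q + 1))
    (by
      refine sub_mem (add_mem (mul_mem (Subalgebra.algebraMap_mem _ _) (mul_mem (Subalgebra.algebraMap_mem _ _) (pow_mem S.Ayz_y _))) ?_) (mul_mem (Subalgebra.algebraMap_mem _ _) (pow_mem (add_mem (mul_mem (Subalgebra.algebraMap_mem _ _) S.Ayz_y) (S.Az_le hP)) _))
      exact Subalgebra.sum_mem _ fun i _ => pow_mem hgA _)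
    (by linear_combination hTr)
  have hα0 : α = α ^ S.N := by
    have := hα 0 (by omega); simpa using sub_eq_zero.1 this
  have hαqb : α ^ S.qb = α := by
    by_cases h2 : S.e = 2
    · have : S.N = S.qb := by rw [hNN, h2]; simp
      rw [← this]; exact hα0.symm
    · have := sub_eq_zero.1 (hα 1 (by omega))
      rw [pow_one] at this
      rw [this, ← hα0]
  rw [← hα0] at hv
  have hexp : (algebraMap K F β * S.y + P) ^ (S.q + 1) = (algebraMap K F β) ^ (S.q + 1) * S.y ^ (S.q + 1) + (algebraMap K F β) ^ S.q * P * S.y ^ S.q + algebraMap K F β * P ^ S.q * S.y + P ^ (S.q + 1) := by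
    rw [pow_succ, S.add_q, mul_pow]; ring
  rw [hexp] at hv
  have hpoly := S.T2' (Polynomial.C (algebraMap K F (α * S.c - S.c * β ^ (S.q + 1))) * Polynomial.X ^ (S.q + 1)
      + ∑ i ∈ Finset.range S.e, G ^ S.qb ^ i
      + Polynomial.C (algebraMap K F (- S.c * β ^ S.q) * P) * Polynomial.X ^ S.q
      + Polynomial.C (algebraMap K F (- S.c * β) * P ^ S.q) * Polynomial.X
      + Polynomial.C (algebraMap K F (- S.c) * P ^ (S.q + 1))) (by
      have hq2 := S.q1_lt
      refine lt_of_le_of_lt (b := S.q + 1) ?_ hq2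
      refine Polynomial.natDegree_add_le_of_degree_le (Polynomial.natDegree_add_le_of_degree_le (Polynomial.natDegree_add_le_of_degree_le (Polynomial.natDegree_add_le_of_degree_le ?_ ?_) ?_) ?_) ?_
      · exact Polynomial.natDegree_C_mul_X_pow_le _ _
      · apply Polynomial.natDegree_sum_le_of_forall_le
        intro i hi
        have hi := Finset.mem_range.1 hi
        refine (Polynomial.natDegree_pow_le).trans ?_
        have h1 : S.qb ^ i * G.natDegree ≤ S.qb ^ i * S.qb := Nat.mul_le_mul_left _ hGd
        have h2 : S.qb ^ i * S.qb ≤ S.q := by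
          rw [← pow_succ, hqq]; exact Nat.pow_le_pow_right (by omega) hi
        omega
      · exact (Polynomial.natDegree_C_mul_X_pow_le _ _).trans (by omega)
      · exact (Polynomial.natDegree_C_mul_le _ _).trans (Polynomial.natDegree_X_le.trans (by omega))
      · rw [Polynomial.natDegree_C]; omega) (by
      have hk : ∀ k : K, algebraMap K F k ∈ S.Az := fun k => Subalgebra.algebraMap_mem _ _
      have hX : (Polynomial.X : Polynomial F) ∈ Polynomial.lifts (algebraMap S.Az F) := Polynomial.X_mem_lifts _
      exact add_mem (add_mem (add_mem (add_mem (mul_mem (S.C_lifts (hk _)) (pow_mem hX _)) (sum_mem fun i _ => pow_mem hG _))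
        (mul_mem (S.C_lifts (mul_mem (hk _) hP)) (pow_mem hX _))) (mul_mem (S.C_lifts (mul_mem (hk _) (pow_mem hP _))) hX))
        (S.C_lifts (mul_mem (hk _) (pow_mem hP _)))) (by
      simp only [Polynomial.eval_add, Polynomial.eval_mul, Polynomial.eval_C, Polynomial.eval_pow, Polynomial.eval_X, Polynomial.eval_finset_sum]
      unfold Tr at hv
      simp only [map_sub, map_mul, map_neg, map_pow] at hv ⊢
      linear_combination hv)
  have hcf : ∀ k, (if k = S.q + 1 then algebraMap K F (α * S.c - S.c * β ^ (S.q + 1)) else 0)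
      + ∑ i ∈ Finset.range S.e, (if S.qb ^ i ∣ k then (G.coeff (k / S.qb ^ i)) ^ S.qb ^ i else 0)
      + (if k = S.q then algebraMap K F (- S.c * β ^ S.q) * P else 0)
      + (if 1 = k then algebraMap K F (- S.c * β) * P ^ S.q else 0)
      + (if k = 0 then algebraMap K F (- S.c) * P ^ (S.q + 1) else 0) = 0 := by
    intro k
    have h3 := congrArg (fun P => Polynomial.coeff P k) hpoly
    simp only [Polynomial.coeff_add, Polynomial.finset_sum_coeff, Polynomial.coeff_C_mul, Polynomial.coeff_X_pow, Polynomial.coeff_X, Polynomial.coeff_C, Polynomial.coeff_zero, S.coeff_qb, mul_ite, mul_one, mul_zero] at h3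
    exact h3
  have hG0 : ∀ k, S.qb < k → G.coeff k = 0 := fun k hk => Polynomial.coeff_eq_zero_of_natDegree_lt (by omega)
  have hdvd1 : ∀ i, i ≠ 0 → ¬ S.qb ^ i ∣ 1 := fun i hi h => by
    have := Nat.dvd_one.1 h
    rw [Nat.pow_eq_one] at this; omega
  have hβα : α = β ^ (S.q + 1) := by
    have h := hcf (S.q + 1)
    rw [if_pos rfl, if_neg (by omega), if_neg (by omega), if_neg (by omega), Finset.sum_eq_zero] at h
    · have h' : α * S.c - S.c * β ^ (S.q + 1) = 0 := (map_eq_zero (algebraMap K F)).1 (by simpa only [add_zero] using h)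
      exact mul_right_cancel₀ S.hc0 (by linear_combination h')
    · intro i hi
      by_cases h0 : i = 0
      · rw [h0]; simp [hG0 (S.q + 1) (by omega)]; 
      · rw [if_neg]
        intro hd
        have h1 : S.qb ^ i ∣ S.q := pow_dvd_pow _ (Finset.mem_range.1 hi).le
        exact hdvd1 i h0 ((Nat.dvd_add_right h1).1 hd)
  have hG1 : G.coeff 1 = algebraMap K F (S.c * β) * P ^ S.q := by
    have h := hcf 1
    rw [if_neg (by omega), if_neg (by omega), if_pos rfl, if_neg (by omega), Finset.sum_eq_single 0] at h
    · simp at h; rw [map_mul]; linear_combination h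
    · intro i _ hi; rw [if_neg (hdvd1 i hi)]
    · intro h; exact (h (Finset.mem_range.2 (by omega))).elim
  have hGqb : G.coeff S.qb = - (G.coeff 1) ^ S.qb := by
    have h := hcf S.qb
    rw [if_neg (by omega), if_neg (by omega), if_neg (by omega), if_neg (by omega)] at h
    obtain ⟨k, hk⟩ : ∃ k, S.e = k + 2 := ⟨S.e - 2, by omega⟩
    rw [hk, Finset.sum_range_succ', Finset.sum_range_succ', Finset.sum_eq_zero] at h
    · simp [Nat.div_self (show 0 < S.qb by omega)] at h
      linear_combination h
    · intro i _
      rw [if_neg]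
      intro hd
      have := Nat.le_of_dvd (by omega) hd
      have h2 : S.qb ^ 1 < S.qb ^ (i + 1 + 1) := Nat.pow_lt_pow_right (by omega) (by omega)
      rw [pow_one] at h2; omega
  have hGq : (G.coeff S.qb) ^ S.N = algebraMap K F (S.c * β ^ S.q) * P := by
    have h := hcf S.q
    rw [if_neg (by omega), if_pos rfl, if_neg (by omega), if_neg (by omega), Finset.sum_eq_single (S.e - 1)] at h
    · have h1 : S.q / S.qb ^ (S.e - 1) = S.qb := by
        rw [← hNN, S.q_eq, Nat.mul_div_cancel_left _ S.N_pos]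
      rw [if_pos (show S.qb ^ (S.e - 1) ∣ S.q from pow_dvd_pow _ (by omega)), h1, ← hNN] at h
      simp only [map_mul, map_neg] at h ⊢
      linear_combination h
    · intro i hi hne
      have hi := Finset.mem_range.1 hi
      split_ifs with hd
      · rw [hG0, zero_pow (pow_ne_zero _ (by omega))]
        rw [hqq, Nat.pow_div hi.le (by omega)]
        calc S.qb = S.qb ^ 1 := (pow_one _).symm
          _ < _ := Nat.pow_lt_pow_right (by omega) (by omega)
      · rfl
    · intro h; exact (h (Finset.mem_range.2 (by omega))).elim
  -- β ≠ 0
  have hβ : β ≠ 0 := by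
    rintro rfl
    rw [map_zero, zero_mul, zero_add] at hy
    obtain ⟨R, hR⟩ := S.Az_poly hP
    have hy0 : σ S.y ≠ 0 := by simpa using S.y0
    have hR0 : R ≠ 0 := by rintro rfl; rw [hy, hR] at hy0; simp at hy0
    have h1 := S.dE_aeval hR0
    rw [← hR, ← hy] at h1
    have h2 := h1.unique (S.sig_dE σ S.dE_y)
    have h3 : R.natDegree * (S.N * S.q ^ 2) = S.N * S.t := by
      have : R.natDegree * S.M = S.N * S.t := by exact_mod_cast h2
      unfold M at this; exact this
    apply S.q2_ne_t
    refine ⟨R.natDegree, Nat.eq_of_mul_eq_mul_left S.N_pos ?_⟩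
    rw [← h3]; ring
  have hPP : P ^ S.q ^ 2 = P := by
    have hqN : S.qb * S.N = S.q := by rw [S.q_eq]; ring
    rw [hGqb, S.neg_N, ← pow_mul, hqN, hG1, mul_pow, ← map_pow, mul_pow, S.hcq, ← pow_mul] at hGq
    have h1 : algebraMap K F (S.c * β ^ S.q) ≠ 0 := by
      rw [Ne, map_eq_zero]; exact mul_ne_zero S.hc0 (pow_ne_zero _ hβ)
    apply mul_left_cancel₀ h1
    rw [← hGq, ← pow_two, neg_mul, map_neg]; ring
  obtain ⟨γ, hγ, hγ2⟩ := S.const_q2 hPP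
  rw [hγ] at hy
  have hβq : β ^ S.q ^ 2 = β := by
    have h1 : α ^ S.q = α := by
      rw [hqq]
      have : ∀ n, α ^ S.qb ^ n = α := by
        intro n
        induction n with
        | zero => simp
        | succ n ih => rw [pow_succ, pow_mul, ih, hαqb]
      exact this _
    rw [hβα, ← pow_mul] at h1
    apply mul_right_cancel₀ (pow_ne_zero S.q hβ)
    rw [← pow_add, ← pow_succ', ← h1]; ring
  have hz0 := S.z0
  obtain ⟨δ, hδ, hδt⟩ : ∃ k : K, σ S.z / S.z = algebraMap K F k ∧ k ^ S.t = β := by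
    apply const_t S.t_pos
    rw [div_pow, div_eq_iff (pow_ne_zero _ hz0), S.sig_zt σ, hy, S.add_q2, mul_pow, ← map_pow, hβq, ← map_pow, hγ2, S.hzt]
    ring
  rw [div_eq_iff hz0] at hδ
  refine ⟨δ, γ, ?_, hγ2, hδ, by rw [hδt, hy]⟩
  unfold Co
  rw [show (S.q + 1) * ((S.qb - 1) * S.t) = S.t * (S.q + 1) * (S.qb - 1) by ring, pow_mul, pow_mul, hδt, ← hβα]
  have hα1 : α ≠ 0 := hβα ▸ pow_ne_zero _ hβ
  apply mul_right_cancel₀ hα1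
  rw [← pow_succ, Nat.sub_add_cancel (by omega), hαqb, one_mul]

theorem frm (σ : F ≃ₐ[K] F) : S.Frm σ := by
  by_cases hN : S.N = 1
  · rcases lt_trichotomy S.t (S.q ^ 2) with h | h | h
    · exact S.frm_a hN h σ
    · exact (S.q2_ne_t (h ▸ dvd_refl _)).elim
    · exact S.frm_b hN h σ
  · exact S.frm_c hN σ

end stab2
end Cv
end

set_option linter.all false
noncomputable section
namespace Cv
section grp
variable {p : ℕ} [hp : Fact p.Prime] {K F : Type} [Field K] [Field F] [Algebra K F] (S : Cv p K F)
variable [IsAlgClosed K] [CharP F p]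

/-- The stabilizer of `z`. -/
def Sub : Subgroup (F ≃ₐ[K] F) where
  carrier := {σ | σ S.z = S.z}
  mul_mem' := fun {a b} ha hb => by
    simp only [Set.mem_setOf_eq] at ha hb ⊢
    rw [AlgEquiv.mul_apply, hb, ha]
  one_mem' := rfl
  inv_mem' := fun {a} ha => by
    simp only [Set.mem_setOf_eq] at ha ⊢
    have : a⁻¹ (a S.z) = S.z := by rw [← AlgEquiv.mul_apply, inv_mul_cancel]; rfl
    rwa [ha] at this

theorem mem_Sub {σ : F ≃ₐ[K] F} : σ ∈ S.Sub ↔ σ S.z = S.z := Iff.rfl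

theorem Sub_normal : S.Sub.Normal := by
  refine ⟨fun n hn g => ?_⟩
  rw [mem_Sub] at hn ⊢
  obtain ⟨δ, γ, hδ, -, hz, -⟩ := S.frm g⁻¹
  have h : g (g⁻¹ S.z) = S.z := by rw [← AlgEquiv.mul_apply, mul_inv_cancel]; rfl
  rw [AlgEquiv.mul_apply, AlgEquiv.mul_apply, hz, map_mul, AlgEquiv.commutes, hn, ← hz, h]

theorem Sub_form {σ : F ≃ₐ[K] F} (h : σ ∈ S.Sub) : ∃ γ b : K, γ ^ S.q ^ 2 = γ ∧ S.Tr b = S.c * γ ^ (S.q + 1) ∧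
    σ S.x = S.x + (algebraMap K F (S.c * γ ^ S.q) * S.y - (algebraMap K F (S.c * γ ^ S.q) * S.y) ^ S.qb) + algebraMap K F b ∧
      σ S.y = S.y + algebraMap K F γ := by
  haveI : CharP K p := cK (F := F)
  rw [mem_Sub] at h
  obtain ⟨δ, γ, hδ, hγ, hz, hy⟩ := S.frm σ
  have h1 : δ = 1 := by
    rw [h] at hz
    have : algebraMap K F δ = 1 := by
      apply mul_right_cancel₀ S.z0; rw [← hz, one_mul]
    exact (algebraMap K F).injective (by rw [this, map_one])
  subst h1
  rw [one_pow, map_one, one_mul] at hy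
  obtain ⟨b0, hb0⟩ := S.exists_b γ
  obtain ⟨s, sx, sy, sz⟩ := S.exists_s hγ hb0
  have h2 : S.Tr (σ S.x - s S.x) = algebraMap K F 0 := by
    rw [S.Tr_sub, S.sig_Tr, S.sig_Tr, hy, sy, sub_self, map_zero]
  obtain ⟨b1, hb1, hT⟩ := S.const_Tr h2
  refine ⟨γ, b0 + b1, hγ, by rw [S.Tr_add, hT, hb0, add_zero], ?_, hy⟩
  rw [map_add, ← add_assoc, ← sx, ← hb1]; ring

theorem card_Sub : Nat.card S.Sub = S.q ^ 2 * S.N := by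
  classical
  obtain ⟨Γ, hΓ, hm⟩ := S.card_q2Roots
  choose B hB hBm using fun γ : K => S.card_TrRoots (S.c * γ ^ (S.q + 1))
  have hcard : (Γ.sigma B).card = S.q ^ 2 * S.N := by
    rw [Finset.card_sigma, Finset.sum_congr rfl (fun γ _ => hB γ), Finset.sum_const, hΓ, smul_eq_mul]
  rw [← hcard, ← Nat.card_eq_finsetCard]
  have key : ∀ u : (Γ.sigma B), ∃ σ : F ≃ₐ[K] F,
    σ S.x = S.x + (algebraMap K F (S.c * u.1.1 ^ S.q) * S.y - (algebraMap K F (S.c * u.1.1 ^ S.q) * S.y) ^ S.qb) + algebraMap K F u.1.2 ∧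
      σ S.y = S.y + algebraMap K F u.1.1 ∧ σ S.z = S.z := fun u =>
    S.exists_s ((hm _).1 (Finset.mem_sigma.1 u.2).1) ((hBm _ _).1 (Finset.mem_sigma.1 u.2).2)
  choose f fx fy fz using key
  symm
  apply Nat.card_congr
  refine Equiv.ofBijective (fun u => (⟨f u, fz u⟩ : S.Sub)) ⟨?_, ?_⟩
  · intro u v huv
    have h : f u = f v := congrArg Subtype.val huv
    have h1 : u.1.1 = v.1.1 := by
      have := fy u
      rw [h, fy v, add_right_inj] at this
      exact ((algebraMap K F).injective this).symm
    have h2 : u.1.2 = v.1.2 := by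
      have := fx u
      rw [h, fx v, h1, add_right_inj] at this
      exact ((algebraMap K F).injective this).symm
    obtain ⟨⟨u1, u2⟩, hu⟩ := u
    obtain ⟨⟨v1, v2⟩, hv⟩ := v
    simp only at h1 h2
    subst h1 h2
    rfl
  · rintro ⟨σ, hσ⟩
    obtain ⟨γ, b, hγ, hb, hx, hy⟩ := S.Sub_form hσ
    refine ⟨⟨⟨γ, b⟩, Finset.mem_sigma.2 ⟨(hm _).2 hγ, (hBm _ _).2 hb⟩⟩, ?_⟩
    apply Subtype.ext
    exact S.ext3' (by rw [fx, hx]) (by rw [fy, hy]) (by rw [fz]; exact hσ.symm)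

theorem final : Finite (F ≃ₐ[K] F) ∧ Nat.card (F ≃ₐ[K] F) = S.q ^ 2 * S.N * S.Co ∧
    ∃ A C : Subgroup (F ≃ₐ[K] F), A.Normal ∧ Nat.card A = S.q ^ 2 * S.N ∧ IsCyclic C ∧ Nat.card C = S.Co ∧
      A ⊓ C = ⊥ ∧ ∀ g : F ≃ₐ[K] F, ∃ σ ∈ A, ∃ τ ∈ C, g = σ * τ := by
  obtain ⟨η, hη⟩ := S.exists_prim
  obtain ⟨τ, tx, ty, tz⟩ := S.exists_c hη.pow_eq_one
  have px : ∀ i : ℕ, (τ ^ i) S.x = algebraMap K F ((η ^ i) ^ (S.t * (S.q + 1))) * S.x := by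
    intro i
    induction i with
    | zero => simp
    | succ i ih =>
      rw [pow_succ', AlgEquiv.mul_apply, ih, map_mul, AlgEquiv.commutes, tx, ← mul_assoc, ← map_mul, ← mul_pow, pow_succ]
  have py : ∀ i : ℕ, (τ ^ i) S.y = algebraMap K F ((η ^ i) ^ S.t) * S.y := by
    intro i
    induction i with
    | zero => simp
    | succ i ih =>
      rw [pow_succ', AlgEquiv.mul_apply, ih, map_mul, AlgEquiv.commutes, ty, ← mul_assoc, ← map_mul, ← mul_pow, pow_succ]
  have pz : ∀ i : ℕ, (τ ^ i) S.z = algebraMap K F (η ^ i) * S.z := by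
    intro i
    induction i with
    | zero => simp
    | succ i ih =>
      rw [pow_succ', AlgEquiv.mul_apply, ih, map_mul, AlgEquiv.commutes, tz, ← mul_assoc, ← map_mul, pow_succ]
  have hz1 : ∀ i : ℕ, (τ ^ i) S.z = S.z → S.Co ∣ i := by
    intro i h
    rw [pz] at h
    apply hη.dvd_of_pow_eq_one
    have : algebraMap K F (η ^ i) = 1 := by
      apply mul_right_cancel₀ S.z0; rw [h, one_mul]
    exact (algebraMap K F).injective (by rw [this, map_one])
  have hCo : τ ^ S.Co = 1 := S.ext3' (by rw [px, hη.pow_eq_one]; simp) (by rw [py, hη.pow_eq_one]; simp)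
    (by rw [pz, hη.pow_eq_one]; simp)
  have hord : orderOf τ = S.Co := by
    apply Nat.dvd_antisymm (orderOf_dvd_of_pow_eq_one hCo)
    apply hz1; rw [pow_orderOf_eq_one]; rfl
  have hfin : IsOfFinOrder τ := isOfFinOrder_iff_pow_eq_one.2 ⟨_, S.Co_pos, hCo⟩
  have hcC : Nat.card (Subgroup.zpowers τ) = S.Co := by rw [Nat.card_zpowers, hord]
  have hinf : S.Sub ⊓ Subgroup.zpowers τ = ⊥ := by
    rw [eq_bot_iff]
    rintro g ⟨h1, h2⟩
    obtain ⟨i, rfl⟩ := (hfin.mem_powers_iff_mem_zpowers).2 h2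
    change (τ ^ i) ∈ S.Sub at h1
    change (τ ^ i) ∈ _
    obtain ⟨k, hk⟩ := hz1 i h1
    rw [Subgroup.mem_bot, hk, pow_mul, hCo, one_pow]
  have hprod : ∀ g : F ≃ₐ[K] F, ∃ σ ∈ S.Sub, ∃ τ' ∈ Subgroup.zpowers τ, g = σ * τ' := by
    intro g
    obtain ⟨δ, γ, hδ, -, hz, -⟩ := S.frm g
    haveI : NeZero S.Co := ⟨S.Co_pos.ne'⟩
    obtain ⟨i, -, rfl⟩ := hη.eq_pow_of_pow_eq_one hδ
    refine ⟨g * (τ ^ i)⁻¹, ?_, τ ^ i, Subgroup.npow_mem_zpowers _ _, by rw [inv_mul_cancel_right]⟩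
    have h : g S.z = (τ ^ i) S.z := by rw [hz, pz]
    obtain ⟨hn⟩ := S.Sub_normal
    have h1 : (τ ^ i)⁻¹ * g ∈ S.Sub := by
      rw [mem_Sub, AlgEquiv.mul_apply, h, ← AlgEquiv.mul_apply, inv_mul_cancel]; rfl
    have := hn _ h1 (τ ^ i)
    rwa [mul_inv_cancel_left] at this
  have hdis : Disjoint S.Sub (Subgroup.zpowers τ) := disjoint_iff.2 hinf
  have hcomp : Subgroup.IsComplement' S.Sub (Subgroup.zpowers τ) := by
    haveI := S.Sub_normal
    apply Subgroup.isComplement'_of_disjoint_and_mul_eq_univ hdis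
    rw [Set.eq_univ_iff_forall]
    intro g
    obtain ⟨σ, h1, τ', h2, rfl⟩ := hprod g
    exact Set.mul_mem_mul h1 h2
  have hcard : Nat.card (F ≃ₐ[K] F) = S.q ^ 2 * S.N * S.Co := by
    rw [← hcomp.card_mul, S.card_Sub, hcC]
  refine ⟨?_, hcard, S.Sub, Subgroup.zpowers τ, S.Sub_normal, S.card_Sub, inferInstance, hcC, hinf, hprod⟩
  apply Nat.finite_of_card_ne_zero
  rw [hcard]
  have := S.two_le_q
  have := S.N_pos
  have := S.Co_pos
  positivity

end grp
end Cv
end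


theorem aux_N {Q N B q qb : ℕ} (h : Q = N * B) (h0 : 2 ≤ B) (h1 : Q = q) (h2 : B = qb) :
    Q ^ 2 * N = q ^ 3 / qb := by
  subst h1 h2
  symm
  apply Nat.div_eq_of_eq_mul_left (by omega)
  rw [pow_succ, mul_assoc, ← h]

/-- Theorem (main theorem for `X_{a,b,n,s}`): if `b < a` or `q^2 ∤ (m/s - 1)`, then
`Aut(F'/K)` is finite of order `(q^3/q̄)(q+1)(q̄-1)(m/s)`, and it is an internal
semidirect product of a normal subgroup `S` of order `q^3/q̄` and a cyclic subgroup `C`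
of order `(q+1)(q̄-1)(m/s)`. -/
theorem stmt2 (p a b q qb n m s : ℕ) (hp : p.Prime) (ha : 0 < a) (hq : q = p ^ a)
    (hb : 0 < b) (hba : b ∣ a) (hqb : qb = p ^ b)
    (hn : 3 ≤ n) (hodd : Odd n) (hm : m * (q + 1) = q ^ n + 1)
    (hs : s ∣ m) (hs0 : 0 < s)
    (K : Type) [Field K] [IsAlgClosed K] [CharP K p]
    (c : K) (hc2 : c ^ q ^ 2 = c) (hc : c ^ (q - 1) = -1)
    [hI : (XIdeal K c q qb (m / s) (a / b)).IsPrime]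
    (hcond : b < a ∨ ¬(q ^ 2 ∣ (m / s - 1))) :
    Finite (XField K c q qb (m / s) (a / b) ≃ₐ[K] XField K c q qb (m / s) (a / b)) ∧
    Nat.card (XField K c q qb (m / s) (a / b) ≃ₐ[K] XField K c q qb (m / s) (a / b))
      = q ^ 3 / qb * ((q + 1) * ((qb - 1) * (m / s))) ∧
    ∃ S C : Subgroup (XField K c q qb (m / s) (a / b) ≃ₐ[K] XField K c q qb (m / s) (a / b)),
      S.Normal ∧ Nat.card S = q ^ 3 / qb ∧ IsCyclic C ∧
      Nat.card C = (q + 1) * ((qb - 1) * (m / s)) ∧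
      S ⊓ C = ⊥ ∧
      ∀ g : XField K c q qb (m / s) (a / b) ≃ₐ[K] XField K c q qb (m / s) (a / b),
        ∃ σ ∈ S, ∃ τ ∈ C, g = σ * τ := by
  obtain ⟨S, h1, h2, h3⟩ := exists_Cv p a b q qb n m s hp ha hq hb hba hqb hn hodd hm hs hs0 K c hc hcond
  haveI : Fact p.Prime := ⟨hp⟩
  haveI : CharP (XField K c q qb (m / s) (a / b)) p :=
    charP_of_injective_algebraMap (algebraMap K _).injective p
  have hSqb : S.qb = qb := by unfold Cv.qb; rw [h1, hqb]
  have hSq : S.q = q := by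
    unfold Cv.q; rw [hSqb, h2, hqb, hq, ← pow_mul, Nat.mul_div_cancel' hba]
  have hN : S.q ^ 2 * S.N = q ^ 3 / qb := by
    exact aux_N S.q_eq S.two_le_qb hSq hSqb
  have hCo : S.Co = (q + 1) * ((qb - 1) * (m / s)) := by
    unfold Cv.Co; rw [hSq, hSqb, h3]
  have h := S.final
  rw [hN, hCo] at h
  exact h
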